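/- arXiv:0709.3810 — 3 statements merged into one kernel-verified Lean document; each statement's English description precedes it below -/
import Mathlib

section
/- Let m, n > 1 be integers with m + n ≥ 10, let R = (r_1, …, r_m) and C = (c_1, …, c_n) be positive integer vectors with r_1 + … + r_m = c_1 + … + c_n = N, and let W = (w_{ij}) be an m × n matrix with nonnegative real entries. Then T(R, C; W) ≥ [Γ((m+n)/2) / (2 e^5 π^{(m+n-2)/2} m n (N+mn))] · (2 / ((mn)^2 (N+1)(N+mn)))^{m+n-1} · (∏_{i=1}^m r_i^{r_i}/r_i!) · (∏_{j=1}^n c_j^{c_j}/c_j!) · [N! (N+mn)! (mn)^{mn}] / [N^N (N+mn)^{N+mn} (mn)!] · ρ(R, C; W). -/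
section PrekopaLeindler

open MeasureTheory ENNReal
open scoped Pointwise

theorem volume_add_volume_le_of_add_subset {A B H : Set ℝ} (hA : MeasurableSet A)
    (hB : MeasurableSet B) (hAn : A.Nonempty) (hBn : B.Nonempty)
    (hH : ∀ a ∈ A, ∀ b ∈ B, a + b ∈ H) : volume A + volume B ≤ volume H := by
  have translate : ∀ {S : Set ℝ} (c : ℝ), (∀ s ∈ S, c + s ∈ H) → volume S ≤ volume H := by
    intro S c hS
    rw [← measure_preimage_add volume (-c) S]
    refine measure_mono fun x hx => ?_
    simpa using hS _ hx
  rcases eq_or_ne (volume A) 0 with h0 | h0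
  · obtain ⟨a, ha⟩ := hAn
    rw [h0, zero_add]
    exact translate a fun b hb => hH a ha b hb
  rcases eq_or_ne (volume B) 0 with h1 | h1
  · obtain ⟨b, hb⟩ := hBn
    rw [h1, add_zero]
    exact translate b fun a ha => by rw [add_comm]; exact hH a ha b hb
  have key : ∀ K L : Set ℝ, K ⊆ A → IsCompact K → L ⊆ B → IsCompact L →
      volume K + volume L ≤ volume H := by
    intro K L hKA hK hLB hL
    rcases K.eq_empty_or_nonempty with rfl | hKn
    · obtain ⟨a, ha⟩ := hAn
      simpa using translate a fun b hb => hH a ha b (hLB hb)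
    rcases L.eq_empty_or_nonempty with rfl | hLn
    · obtain ⟨b, hb⟩ := hBn
      simpa using translate b fun a ha => by rw [add_comm]; exact hH a (hKA ha) b hb
    obtain ⟨a, haK, ha⟩ := hK.exists_isGreatest hKn
    obtain ⟨b, hbL, hb⟩ := hL.exists_isLeast hLn
    have e1 : volume K = volume ((fun x => -b + x) ⁻¹' K) :=
      (measure_preimage_add volume (-b) K).symm
    have e2 : volume L = volume ((fun x => -a + x) ⁻¹' L) :=
      (measure_preimage_add volume (-a) L).symm
    rw [e1, e2, ← measure_union₀]
    · refine measure_mono ?_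
      rintro x (hx | hx)
      · simpa using hH _ (hKA hx) b (hLB hbL)
      · simpa using hH a (hKA haK) _ (hLB hx)
    · exact (hL.measurableSet.preimage (measurable_const_add _)).nullMeasurableSet
    · refine measure_mono_null (t := {a + b}) ?_ (by simp)
      rintro x ⟨h1, h2⟩
      have := ha h1
      have := hb h2
      simp only [Set.mem_singleton_iff] at *
      linarith
  have hAH : volume A ≤ volume H := by
    obtain ⟨b, hb⟩ := hBn
    exact translate b fun a ha => by rw [add_comm]; exact hH a ha b hb
  have hBH : volume B ≤ volume H := by
    obtain ⟨a, ha⟩ := hAn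
    exact translate a fun b hb => hH a ha b hb
  have step : ∀ L : Set ℝ, L ⊆ B → IsCompact L → volume A + volume L ≤ volume H := by
    intro L hLB hL
    have hLH : volume L ≤ volume H := (measure_mono hLB).trans hBH
    refine add_le_of_le_tsub_right_of_le hLH ?_
    rw [hA.measure_eq_iSup_isCompact]
    exact iSup₂_le fun K hKA => iSup_le fun hK =>
      ENNReal.le_sub_of_add_le_right hL.measure_lt_top.ne (key K L hKA hK hLB hL)
  rcases eq_or_ne (volume A) ∞ with hAt | hAt
  · exact le_top.trans_eq (top_le_iff.1 (hAt ▸ hAH)).symm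
  rw [add_comm]
  refine add_le_of_le_tsub_right_of_le hAH ?_
  rw [hB.measure_eq_iSup_isCompact]
  exact iSup₂_le fun L hLB => iSup_le fun hL =>
    ENNReal.le_sub_of_add_le_right hAt (by rw [add_comm]; exact step L hLB hL)

theorem volume_convexComb_le {A B H : Set ℝ} {a b : ℝ} (ha : 0 < a) (hb : 0 < b)
    (hA : MeasurableSet A) (hB : MeasurableSet B) (hAn : A.Nonempty) (hBn : B.Nonempty)
    (hH : ∀ x ∈ A, ∀ y ∈ B, a * x + b * y ∈ H) :
    ENNReal.ofReal a * volume A + ENNReal.ofReal b * volume B ≤ volume H := by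
  have h := volume_add_volume_le_of_add_subset (A := a • A) (B := b • B) (H := H)
    (hA.const_smul₀ a) (hB.const_smul₀ b) hAn.smul_set hBn.smul_set (by
      rintro _ ⟨x, hx, rfl⟩ _ ⟨y, hy, rfl⟩
      exact hH x hx y hy)
  simpa [Measure.addHaar_smul, abs_of_pos ha, abs_of_pos hb] using h

theorem lintegral_eq_lintegral_Ioo_volume_lt {u : ℝ → ℝ≥0∞} (hu : Measurable u)
    (hu1 : ∀ x, u x ≤ 1) :
    ∫⁻ x, u x = ∫⁻ t in Set.Ioo (0 : ℝ) 1, volume {x | ENNReal.ofReal t < u x} := by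
  have hfin : ∀ x, u x ≠ ∞ := fun x => ((hu1 x).trans_lt one_lt_top).ne
  have h := lintegral_eq_lintegral_meas_lt (volume : Measure ℝ) (f := fun x => (u x).toReal)
    (Filter.Eventually.of_forall fun x => toReal_nonneg) hu.ennreal_toReal.aemeasurable
  simp only [ENNReal.ofReal_toReal (hfin _)] at h
  rw [h, ← Set.Ioo_union_Ici_eq_Ioi (zero_lt_one' ℝ), lintegral_union measurableSet_Ici]
  · have h0 : ∫⁻ t in Set.Ici (1 : ℝ), volume {x | t < (u x).toReal} = 0 := by
      rw [setLIntegral_congr_fun (g := fun _ => 0) measurableSet_Ici]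
      · simp
      · intro t ht
        have : {x | t < (u x).toReal} = ∅ := by
          ext x
          have h1 : (u x).toReal ≤ 1 := by
            simpa using ENNReal.toReal_mono one_ne_top (hu1 x)
          have h2 : (1 : ℝ) ≤ t := ht
          simp only [Set.mem_ofPred_eq, Set.mem_empty_iff_false, iff_false, not_lt]
          linarith
        simp [this]
    rw [h0, add_zero]
    refine setLIntegral_congr_fun measurableSet_Ioo fun t ht => ?_
    simp only [ENNReal.ofReal_lt_iff_lt_toReal ht.1.le (hfin _)]
  · rw [Set.disjoint_left]
    rintro x hx hx'
    exact absurd hx.2 (not_lt.2 hx')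

theorem ennreal_geom_mean_le_arith_mean {a b : ℝ} (ha : 0 < a) (hb : 0 < b) (hab : a + b = 1)
    (p q : ℝ≥0∞) : p ^ a * q ^ b ≤ ENNReal.ofReal a * p + ENNReal.ofReal b * q := by
  rcases eq_or_ne p ∞ with rfl | hp
  · simp [ENNReal.mul_top, ha]
  rcases eq_or_ne q ∞ with rfl | hq
  · simp [ENNReal.mul_top, hb]
  lift p to NNReal using hp
  lift q to NNReal using hq
  have h := NNReal.geom_mean_le_arith_mean2_weighted a.toNNReal b.toNNReal p q
    (by rw [← Real.toNNReal_add ha.le hb.le, hab, Real.toNNReal_one])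
  rw [Real.coe_toNNReal _ ha.le, Real.coe_toNNReal _ hb.le] at h
  rw [← ENNReal.coe_rpow_of_nonneg _ ha.le, ← ENNReal.coe_rpow_of_nonneg _ hb.le,
    ENNReal.ofReal, ENNReal.ofReal]
  exact_mod_cast h

theorem prekopaLeindler_of_le_one {a b : ℝ} (ha : 0 < a) (hb : 0 < b) (hab : a + b = 1)
    {f g h : ℝ → ℝ≥0∞} (hf : Measurable f) (hg : Measurable g) (hh : Measurable h)
    (hf1 : ∀ x, f x ≤ 1) (hg1 : ∀ x, g x ≤ 1)
    (hfs : ∀ t < 1, ∃ x, t < f x) (hgs : ∀ t < 1, ∃ x, t < g x)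
    (H : ∀ x y, f x ^ a * g y ^ b ≤ h (a * x + b * y)) :
    (∫⁻ x, f x) ^ a * (∫⁻ x, g x) ^ b ≤ ∫⁻ x, h x := by
  refine (ennreal_geom_mean_le_arith_mean ha hb hab _ _).trans ?_
  refine le_trans ?_ (lintegral_mono fun x => min_le_left (h x) 1)
  rw [lintegral_eq_lintegral_Ioo_volume_lt hf hf1, lintegral_eq_lintegral_Ioo_volume_lt hg hg1,
    lintegral_eq_lintegral_Ioo_volume_lt (hh.min measurable_const) fun x => min_le_right _ _,
    ← lintegral_const_mul' _ _ ofReal_ne_top, ← lintegral_const_mul' _ _ ofReal_ne_top]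
  refine (le_lintegral_add _ _).trans ?_
  refine setLIntegral_mono' measurableSet_Ioo fun t ht => ?_
  have ht1 : ENNReal.ofReal t < 1 := by simpa using ht.2
  have ht0 : ENNReal.ofReal t ≠ 0 := by simpa using ht.1
  refine volume_convexComb_le ha hb (measurableSet_lt measurable_const hf)
    (measurableSet_lt measurable_const hg) (hfs _ ht1) (hgs _ ht1) fun x hx y hy => ?_
  refine lt_min ?_ ht1
  refine lt_of_lt_of_le ?_ (H x y)
  calc ENNReal.ofReal t = ENNReal.ofReal t ^ a * ENNReal.ofReal t ^ b := by
        rw [← ENNReal.rpow_add _ _ ht0 ofReal_ne_top, hab, ENNReal.rpow_one]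
    _ < f x ^ a * g y ^ b :=
        ENNReal.mul_lt_mul (ENNReal.rpow_lt_rpow hx ha) (ENNReal.rpow_lt_rpow hy hb)

theorem prekopaLeindler_of_bounded {a b : ℝ} (ha : 0 < a) (hb : 0 < b) (hab : a + b = 1)
    {f g h : ℝ → ℝ≥0∞} (hf : Measurable f) (hg : Measurable g) (hh : Measurable h)
    {M : ℝ≥0∞} (hM : M ≠ ∞) (hfM : ∀ x, f x ≤ M) (hgM : ∀ x, g x ≤ M)
    (H : ∀ x y, f x ^ a * g y ^ b ≤ h (a * x + b * y)) :
    (∫⁻ x, f x) ^ a * (∫⁻ x, g x) ^ b ≤ ∫⁻ x, h x := by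
  set F := ⨆ x, f x with hF
  set G := ⨆ x, g x with hG
  have hFt : F ≠ ∞ := ((iSup_le hfM).trans_lt hM.lt_top).ne
  have hGt : G ≠ ∞ := ((iSup_le hgM).trans_lt hM.lt_top).ne
  rcases eq_or_ne F 0 with hF0 | hF0
  · have : ∀ x, f x = 0 := fun x => le_antisymm (hF0 ▸ le_iSup f x) bot_le
    simp [this, ha]
  rcases eq_or_ne G 0 with hG0 | hG0
  · have : ∀ x, g x = 0 := fun x => le_antisymm (hG0 ▸ le_iSup g x) bot_le
    simp [this, hb]
  have hc : ∀ {u : ℝ → ℝ≥0∞} {U : ℝ≥0∞}, U = ⨆ x, u x → U ≠ 0 → U ≠ ∞ →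
      ∀ t < 1, ∃ x, t < u x * U⁻¹ := by
    intro u U hU h0 h1 t ht
    have : t * U < ⨆ x, u x := by
      rw [← hU]
      calc t * U < 1 * U := by rw [ENNReal.mul_lt_mul_iff_left h0 h1]; exact ht
        _ = U := one_mul U
    obtain ⟨x, hx⟩ := lt_iSup_iff.1 this
    exact ⟨x, by rwa [← div_eq_mul_inv, ENNReal.lt_div_iff_mul_lt (Or.inl h0) (Or.inl h1)]⟩
  have key := prekopaLeindler_of_le_one ha hb hab (f := fun x => f x * F⁻¹)
    (g := fun x => g x * G⁻¹) (h := fun x => h x * (F⁻¹ ^ a * G⁻¹ ^ b))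
    (hf.mul_const _) (hg.mul_const _) (hh.mul_const _)
    (fun x => by
      rw [← div_eq_mul_inv]
      exact ENNReal.div_le_of_le_mul (by rw [one_mul]; exact le_iSup f x))
    (fun x => by
      rw [← div_eq_mul_inv]
      exact ENNReal.div_le_of_le_mul (by rw [one_mul]; exact le_iSup g x))
    (hc hF hF0 hFt) (hc hG hG0 hGt)
    (fun x y => by
      rw [ENNReal.mul_rpow_of_nonneg _ _ ha.le, ENNReal.mul_rpow_of_nonneg _ _ hb.le,
        mul_mul_mul_comm]
      gcongr
      exact H x y)
  rw [lintegral_mul_const _ hf, lintegral_mul_const _ hg, lintegral_mul_const _ hh,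
    ENNReal.mul_rpow_of_nonneg _ _ ha.le, ENNReal.mul_rpow_of_nonneg _ _ hb.le,
    mul_mul_mul_comm] at key
  refine (ENNReal.mul_le_mul_iff_left ?_ ?_).1 key
  · simp [hFt, hGt, ha, hb, ENNReal.rpow_eq_zero_iff, ha.not_gt, hb.not_gt]
  · apply ENNReal.mul_ne_top <;> apply ENNReal.rpow_ne_top_of_nonneg <;>
      simp [ha.le, hb.le, hF0, hG0]

/-- The one-dimensional Prékopa–Leindler inequality. -/
theorem prekopaLeindler {a b : ℝ} (ha : 0 < a) (hb : 0 < b) (hab : a + b = 1)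
    {f g h : ℝ → ℝ≥0∞} (hf : Measurable f) (hg : Measurable g) (hh : Measurable h)
    (H : ∀ x y, f x ^ a * g y ^ b ≤ h (a * x + b * y)) :
    (∫⁻ x, f x) ^ a * (∫⁻ x, g x) ^ b ≤ ∫⁻ x, h x := by
  have htr : ∀ {u : ℝ → ℝ≥0∞}, Measurable u →
      Filter.Tendsto (fun n : ℕ => ∫⁻ x, min (u x) n) Filter.atTop (nhds (∫⁻ x, u x)) := by
    intro u hu
    refine lintegral_tendsto_of_tendsto_of_monotone
      (fun n => (hu.min measurable_const).aemeasurable) ?_ ?_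
    · exact Filter.Eventually.of_forall fun x m n hmn => min_le_min_left _ (by exact_mod_cast hmn)
    · refine Filter.Eventually.of_forall fun x => ?_
      have := (tendsto_const_nhds (x := u x)).min ENNReal.tendsto_nat_nhds_top
      simpa using this
  rcases eq_or_ne (∫⁻ x, f x) 0 with h0 | h0
  · simp [h0, ha]
  rcases eq_or_ne (∫⁻ x, g x) 0 with h1 | h1
  · simp [h1, hb]
  refine le_of_tendsto (ENNReal.Tendsto.mul
    ((ENNReal.continuous_rpow_const (y := a)).tendsto _ |>.comp (htr hf)) (Or.inl ?_)
    ((ENNReal.continuous_rpow_const (y := b)).tendsto _ |>.comp (htr hg)) (Or.inl ?_))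
    (Filter.Eventually.of_forall fun n => ?_)
  · simp [ENNReal.rpow_eq_zero_iff, h0, ha.not_gt, ha]
  · simp [ENNReal.rpow_eq_zero_iff, h1, hb.not_gt, hb]
  · refine prekopaLeindler_of_bounded ha hb hab (hf.min measurable_const) (hg.min measurable_const)
      hh (M := n) (natCast_ne_top n) (fun x => min_le_right _ _) (fun x => min_le_right _ _)
      fun x y => ?_
    refine le_trans ?_ (H x y)
    gcongr
    · exact min_le_left _ _
    · exact min_le_left _ _

/-- The Prékopa–Leindler inequality on `ι → ℝ`. -/
theorem prekopaLeindler_pi {ι : Type*} [Fintype ι] {a b : ℝ} (ha : 0 < a) (hb : 0 < b)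
    (hab : a + b = 1) {f g h : (ι → ℝ) → ℝ≥0∞} (hf : Measurable f) (hg : Measurable g)
    (hh : Measurable h) (H : ∀ x y, f x ^ a * g y ^ b ≤ h (a • x + b • y)) :
    (∫⁻ x, f x) ^ a * (∫⁻ x, g x) ^ b ≤ ∫⁻ x, h x := by
  classical
  have key : ∀ (s : Finset ι) (x y : ι → ℝ),
      lmarginal (fun _ => volume) s f x ^ a * lmarginal (fun _ => volume) s g y ^ b ≤
        lmarginal (fun _ => volume) s h (a • x + b • y) := by
    intro s
    induction s using Finset.induction_on with
    | empty => simpa using H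
    | insert i s hi ih =>
      intro x y
      rw [lmarginal_insert _ hf hi, lmarginal_insert _ hg hi, lmarginal_insert _ hh hi]
      refine prekopaLeindler ha hb hab
        ((hf.lmarginal _).comp (measurable_update x)) ((hg.lmarginal _).comp (measurable_update y))
        ((hh.lmarginal _).comp (measurable_update _)) fun t t' => ?_
      refine (ih _ _).trans_eq ?_
      congr 1
      ext j
      by_cases hj : j = i
      · subst hj; simp
      · simp [hj]
  simpa [lmarginal_univ, volume_pi] using key Finset.univ 0 0

end PrekopaLeindler

/-- A nonnegative log-concave sequence with support an initial segment of `ℕ`. -/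
structure IsLogConcaveSeq (a : ℕ → ℝ) : Prop where
  zero_pos : 0 < a 0
  nonneg : ∀ k, 0 ≤ a k
  eq_zero_succ : ∀ k, a k = 0 → a (k + 1) = 0
  mul_le_sq : ∀ k, a k * a (k + 2) ≤ a (k + 1) ^ 2

namespace IsLogConcaveSeq

variable {a : ℕ → ℝ}

theorem mul_succ_le (h : IsLogConcaveSeq a) {j k : ℕ} (hjk : j ≤ k) :
    a j * a (k + 1) ≤ a (j + 1) * a k := by
  induction k, hjk using Nat.le_induction with
  | base => rw [mul_comm]
  | succ k hjk ih =>
    rcases eq_or_lt_of_le (h.nonneg (k + 1)) with h0 | h0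
    · rw [h.eq_zero_succ (k + 1) h0.symm, ← h0]; simp
    · have hk : 0 < a k := (h.nonneg k).lt_of_ne fun e => h0.ne' (h.eq_zero_succ k e.symm)
      refine le_of_mul_le_mul_right ?_ (mul_pos hk h0)
      calc a j * a (k + 1 + 1) * (a k * a (k + 1))
          = (a j * a (k + 1)) * (a k * a (k + 2)) := by ring
        _ ≤ (a (j + 1) * a k) * (a (k + 1) ^ 2) :=
          mul_le_mul ih (h.mul_le_sq k) (mul_nonneg (h.nonneg _) (h.nonneg _))
            (mul_nonneg (h.nonneg _) (h.nonneg _))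
        _ = a (j + 1) * a (k + 1) * (a k * a (k + 1)) := by ring

theorem pos_of_le (h : IsLogConcaveSeq a) {j k : ℕ} (hjk : j ≤ k) (hk : 0 < a k) : 0 < a j := by
  induction k, hjk using Nat.le_induction with
  | base => exact hk
  | succ k hjk ih =>
    exact ih ((h.nonneg k).lt_of_ne fun e => hk.ne' (h.eq_zero_succ k e.symm))

/-- Tilting by the ratio `a r / a (r + 1)` makes the term of index `r + 1` maximal. -/
theorem mul_pow_le (h : IsLogConcaveSeq a) {r : ℕ} (hr : 0 < a (r + 1)) (j : ℕ) :
    a j * (a r / a (r + 1)) ^ j ≤ a (r + 1) * (a r / a (r + 1)) ^ (r + 1) := by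
  have hr0 : 0 < a r := h.pos_of_le r.le_succ hr
  set t := a r / a (r + 1) with ht
  have htp : 0 < t := div_pos hr0 hr
  have har : a (r + 1) * t = a r := by rw [ht]; field_simp
  rcases le_total j (r + 1) with hj | hj
  · induction hj using Nat.decreasingInduction with
    | self => exact le_rfl
    | of_succ j hj ih =>
      refine le_trans ?_ ih
      rw [pow_succ', ← mul_assoc]
      refine mul_le_mul_of_nonneg_right ?_ (pow_nonneg htp.le _)
      rw [ht, ← mul_div_assoc, le_div_iff₀ hr]
      exact h.mul_succ_le (Nat.lt_succ_iff.1 hj)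
  · induction j, hj using Nat.le_induction with
    | base => exact le_rfl
    | succ j hj ih =>
      refine le_trans ?_ ih
      rw [pow_succ', ← mul_assoc]
      refine mul_le_mul_of_nonneg_right ?_ (pow_nonneg htp.le _)
      rw [ht, ← mul_div_assoc, div_le_iff₀ hr, mul_comm, mul_comm (a j)]
      exact h.mul_succ_le (by omega)

end IsLogConcaveSeq

open Polynomial in
theorem isLogConcaveSeq_coeff_of_roots_neg (d : ℕ) (g : ℝ[X]) (hd : g.natDegree = d)
    (hlead : 0 < g.leadingCoeff)
    (hroot : ∀ ζ : ℂ, aeval ζ g = 0 → ∃ x : ℝ, 0 < x ∧ ζ = -(x : ℂ)) :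
    IsLogConcaveSeq g.coeff := by
  induction d generalizing g with
  | zero =>
    have hg : g = C (g.coeff 0) := eq_C_of_natDegree_eq_zero hd
    have h0 : 0 < g.coeff 0 := by rwa [leadingCoeff, hd] at hlead
    have hs : ∀ k, g.coeff (k + 1) = 0 := fun k =>
      coeff_eq_zero_of_natDegree_lt (by omega)
    refine ⟨h0, fun k => ?_, fun k _ => hs k, fun k => by simp [hs]⟩
    cases k with
    | zero => exact h0.le
    | succ k => exact (hs k).ge
  | succ d ih =>
    have hdeg : (g.map (algebraMap ℝ ℂ)).degree ≠ 0 := by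
      rw [degree_map]
      intro h
      have := natDegree_eq_zero_iff_degree_le_zero.2 h.le
      omega
    obtain ⟨ζ, hζ⟩ := IsAlgClosed.exists_root _ hdeg
    rw [IsRoot, eval_map_algebraMap] at hζ
    obtain ⟨x, hx, rfl⟩ := hroot ζ hζ
    have hr : g.IsRoot (-x) := by
      have : aeval ((algebraMap ℝ ℂ) (-x)) g = 0 := by simpa using hζ
      rw [aeval_algebraMap_apply] at this
      simpa using this
    obtain ⟨f, rfl⟩ := dvd_iff_isRoot.2 hr
    have hX : (X - C (-x)) = X + C x := by simp
    rw [hX] at hd hlead hroot ⊢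
    have hf0 : f ≠ 0 := by rintro rfl; simp at hd
    rw [natDegree_mul (X_add_C_ne_zero x) hf0, natDegree_X_add_C] at hd
    rw [leadingCoeff_mul, leadingCoeff_X_add_C, one_mul] at hlead
    have hf := ih f (by omega) hlead fun ζ h => hroot ζ (by simp [h])
    have c0 : ((X + C x) * f).coeff 0 = x * f.coeff 0 := by simp [add_mul]
    have cs : ∀ k, ((X + C x) * f).coeff (k + 1) = f.coeff k + x * f.coeff (k + 1) := by
      intro k; simp [add_mul, coeff_X_mul]
    have hn := hf.nonneg
    refine ⟨?_, ?_, ?_, ?_⟩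
    · rw [c0]; exact mul_pos hx hf.zero_pos
    · rintro (_ | k)
      · rw [c0]; exact mul_nonneg hx.le (hn 0)
      · rw [cs]; exact add_nonneg (hn _) (mul_nonneg hx.le (hn _))
    · rintro (_ | k) h
      · rw [c0] at h
        exact absurd h (mul_pos hx hf.zero_pos).ne'
      · rw [cs] at h ⊢
        have h1 := mul_nonneg hx.le (hn (k + 1))
        have h2 : f.coeff (k + 1) = 0 := hf.eq_zero_succ k (by linarith [hn k])
        rw [h2, hf.eq_zero_succ _ h2]; simp
    · rintro (_ | k)
      · rw [c0, cs, cs]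
        nlinarith [hf.mul_le_sq 0, hn 0, hn 1, mul_nonneg hx.le (mul_nonneg (hn 0) (hn 1)),
          mul_le_mul_of_nonneg_left (hf.mul_le_sq 0) (sq_nonneg x), sq_nonneg (f.coeff 0)]
      · rw [cs, cs, cs]
        have h1 := hf.mul_le_sq k
        have h2 := mul_le_mul_of_nonneg_left (hf.mul_le_sq (k + 1)) (sq_nonneg x)
        have h3 := mul_le_mul_of_nonneg_left (hf.mul_succ_le (j := k) (k := k + 2) (by omega)) hx.le
        nlinarith

open Polynomial in
theorem coeff_ne_zero_of_roots_re_neg {g : ℂ[X]} (hg : g ≠ 0)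
    (hroot : ∀ ζ : ℂ, g.eval ζ = 0 → ζ.re < 0) {k : ℕ} (hk : k ≤ g.natDegree) :
    g.coeff k ≠ 0 := by
  have key : ∀ k ≤ g.natDegree, (derivative^[k] g).natDegree = g.natDegree - k ∧
      derivative^[k] g ≠ 0 ∧ ∀ ζ : ℂ, (derivative^[k] g).eval ζ = 0 → ζ.re < 0 := by
    intro k
    induction k with
    | zero => intro _; exact ⟨by simp, by simpa using hg, by simpa using hroot⟩
    | succ k ih =>
      intro hk
      obtain ⟨h1, h2, h3⟩ := ih (by omega)
      set f := derivative^[k] g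
      have hpos : 0 < f.natDegree := by omega
      have hn : (derivative f).natDegree = f.natDegree - 1 := natDegree_derivative f
      have hne : derivative f ≠ 0 := by
        intro h
        exact hpos.ne' (derivative_eq_zero.1 h)
      rw [Function.iterate_succ_apply']
      refine ⟨by change (derivative f).natDegree = _; omega, hne, fun ζ hζ => ?_⟩
      have hmem : ζ ∈ f.derivative.rootSet ℂ := by
        rw [mem_rootSet]; exact ⟨hne, by simpa using hζ⟩
      have := rootSet_derivative_subset_convexHull_rootSet
        (natDegree_pos_iff_degree_pos.1 hpos) hmem
      refine convexHull_min (t := {z : ℂ | z.re < 0}) ?_ (convex_halfSpace_re_lt 0) this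
      intro z hz
      rw [mem_rootSet] at hz
      exact h3 z (by simpa using hz.2)
  obtain ⟨-, -, h3⟩ := key k hk
  intro h0
  have := h3 0 (by
    rw [← coeff_zero_eq_eval_zero, coeff_iterate_derivative]
    simp [h0])
  simp at this

/-- A real polynomial with no complex zero in the closed right half-space away from the purely
imaginary points. -/
def HalfPlaneStable {n : ℕ} (p : MvPolynomial (Fin n) ℝ) : Prop :=
  ∀ z : Fin n → ℂ, (∀ j, 0 ≤ (z j).re) → (∃ j, 0 < (z j).re) → MvPolynomial.aeval z p ≠ 0

open MvPolynomial in
theorem aeval_cons_eq_eval_map {A : Type*} [CommRing A] [Algebra ℝ A] {n : ℕ} (z : Fin n → A)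
    (t : A) (p : MvPolynomial (Fin (n + 1)) ℝ) :
    aeval (Fin.cons t z : Fin (n + 1) → A) p =
      ((finSuccEquiv ℝ n p).map (aeval z : MvPolynomial (Fin n) ℝ →ₐ[ℝ] A).toRingHom).eval t := by
  induction p using MvPolynomial.induction_on with
  | C a => simp [finSuccEquiv_apply]
  | add p q hp hq => simp only [map_add, hp, hq, Polynomial.map_add, Polynomial.eval_add]
  | mul_X p i hp =>
    rw [map_mul, map_mul, hp, Polynomial.map_mul, Polynomial.eval_mul, aeval_X]
    congr 1
    refine Fin.cases ?_ (fun j => ?_) i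
    · simp [finSuccEquiv_X_zero]
    · simp [finSuccEquiv_X_succ]

open MvPolynomial in
theorem HalfPlaneStable.coeff_single_ne_zero {n d : ℕ} {p : MvPolynomial (Fin (n + 1)) ℝ}
    (hp : HalfPlaneStable p) (hd : p.IsHomogeneous d) : coeff (Finsupp.single 0 d) p ≠ 0 := by
  intro h0
  refine hp (Pi.single 0 1) (fun j => ?_) ⟨0, by simp⟩ ?_
  · by_cases hj : j = 0
    · subst hj; simp
    · simp [hj]
  · refine aeval_eq_zero _ _ fun m hm => ?_
    by_contra! hcon
    refine hm ?_
    have hm0 : m = Finsupp.single 0 (m 0) := by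
      ext i
      by_cases hi : i = 0
      · subst hi; simp
      · rw [Finsupp.single_eq_of_ne hi]
        by_contra hne
        exact hcon i (Finsupp.mem_support_iff.2 hne) (by simp [hi])
    have hdeg := hd hm
    rw [hm0] at hdeg ⊢
    simp only [Finsupp.weight_single, Pi.one_apply, smul_eq_mul, mul_one] at hdeg
    rw [hdeg, h0]

open MvPolynomial in
theorem natDegree_map_finSuccEquiv {A : Type*} [CommRing A] [Nontrivial A] [Algebra ℝ A] {n d : ℕ}
    {p : MvPolynomial (Fin (n + 1)) ℝ} (hp : HalfPlaneStable p) (hd : p.IsHomogeneous d)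
    (z : Fin n → A) :
    ((finSuccEquiv ℝ n p).map (aeval z : MvPolynomial (Fin n) ℝ →ₐ[ℝ] A).toRingHom).natDegree = d ∧
    ((finSuccEquiv ℝ n p).map (aeval z : MvPolynomial (Fin n) ℝ →ₐ[ℝ] A).toRingHom).coeff d =
      algebraMap ℝ A (coeff (Finsupp.single 0 d) p) := by
  have hc : ((finSuccEquiv ℝ n p).map
      (aeval z : MvPolynomial (Fin n) ℝ →ₐ[ℝ] A).toRingHom).coeff d =
      algebraMap ℝ A (coeff (Finsupp.single 0 d) p) := by
    have h := hd.finSuccEquiv_coeff_isHomogeneous d 0 (by simp)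
    rw [← totalDegree_zero_iff_isHomogeneous, totalDegree_eq_zero_iff_eq_C] at h
    rw [Polynomial.coeff_map, h, finSuccEquiv_coeff_coeff]
    have : Finsupp.cons d (0 : Fin n →₀ ℕ) = Finsupp.single 0 d := by
      ext i
      refine Fin.cases ?_ (fun j => ?_) i <;> simp
    simp [this]
  refine ⟨le_antisymm ?_ (Polynomial.le_natDegree_of_ne_zero ?_), hc⟩
  · refine Polynomial.natDegree_map_le.trans ?_
    rw [natDegree_finSuccEquiv]
    exact (degreeOf_le_totalDegree _ _).trans hd.totalDegree_le
  · rw [hc]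
    simpa using hp.coeff_single_ne_zero hd

open MvPolynomial in
theorem HalfPlaneStable.finSuccEquiv_coeff {n d : ℕ} {p : MvPolynomial (Fin (n + 1)) ℝ}
    (hp : HalfPlaneStable p) (hd : p.IsHomogeneous d) {k : ℕ} (hk : k ≤ d) :
    HalfPlaneStable ((finSuccEquiv ℝ n p).coeff k) := by
  intro z hz ⟨j, hj⟩
  obtain ⟨h1, h2⟩ := natDegree_map_finSuccEquiv hp hd z
  set g := (finSuccEquiv ℝ n p).map (aeval z : MvPolynomial (Fin n) ℝ →ₐ[ℝ] ℂ).toRingHom with hg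
  have hne : g ≠ 0 := by
    intro h
    rw [h, Polynomial.coeff_zero] at h2
    exact hp.coeff_single_ne_zero hd (by simpa using h2.symm)
  have := coeff_ne_zero_of_roots_re_neg hne (k := k) (fun ζ hζ => ?_) (by omega)
  · rw [hg, Polynomial.coeff_map] at this
    exact this
  · by_contra! hre
    rw [hg, ← aeval_cons_eq_eval_map] at hζ
    refine hp _ (fun i => ?_) ⟨j.succ, by simpa using hj⟩ hζ
    refine Fin.cases ?_ (fun i => ?_) i
    · simpa using hre
    · simpa using hz i

open MvPolynomial in
theorem aeval_smul_of_isHomogeneous {n d : ℕ} {p : MvPolynomial (Fin n) ℝ}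
    (hd : p.IsHomogeneous d) (u : ℂ) (z : Fin n → ℂ) :
    aeval (u • z) p = u ^ d * aeval z p := by
  simp only [aeval_def, eval₂_eq', Finset.mul_sum]
  refine Finset.sum_congr rfl fun m hm => ?_
  have hw := hd (mem_support_iff.1 hm)
  have : ∑ i, m i = d := by
    rw [← hw, Finsupp.weight_apply, Finsupp.sum_fintype _ _ (by simp)]; simp
  simp only [Pi.smul_apply, smul_eq_mul, mul_pow, Finset.prod_mul_distrib,
    Finset.prod_pow_eq_pow_sum, this]
  ring

open MvPolynomial in
/-- Coefficients of homogeneous half-plane stable polynomials are bounded below by their capacity,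
up to a polynomial factor. -/
theorem HalfPlaneStable.le_coeff {n d D : ℕ} (hdD : d ≤ D) {p : MvPolynomial (Fin (n + 1)) ℝ}
    (hp : HalfPlaneStable p) (hd : p.IsHomogeneous d) (hnn : ∀ m, 0 ≤ coeff m p)
    (c : Fin (n + 1) → ℕ) (hc : ∀ j, 0 < c j) (hcd : ∑ j, c j = d) {L : ℝ}
    (hL : ∀ y : Fin (n + 1) → ℝ, (∀ j, 0 < y j) → L * ∏ j, y j ^ c j ≤ aeval y p) :
    L ≤ ((D : ℝ) + 1) ^ n * coeff (Finsupp.equivFunOnFinite.symm c) p := by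
  induction n generalizing d L with
  | zero =>
    have h := hL 1 (by simp)
    have e : Finsupp.equivFunOnFinite.symm c = Finsupp.single 0 d := by
      ext i
      have : i = 0 := Fin.fin_one_eq_zero i
      subst this
      simpa using hcd
    have e2 : aeval (1 : Fin (0 + 1) → ℝ) p = coeff (Finsupp.single 0 d) p := by
      rw [aeval_def, eval₂_eq']
      rw [Finset.sum_eq_single (Finsupp.single 0 d)]
      · simp
      · intro m hm hne
        refine absurd ?_ hne
        have hw := hd (mem_support_iff.1 hm)
        rw [Finsupp.weight_apply, Finsupp.sum_fintype _ _ (by simp)] at hw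
        ext i
        have : i = 0 := Fin.fin_one_eq_zero i
        subst this
        simpa using hw
      · intro hm
        simp [notMem_support_iff.1 hm]
    rw [e2] at h
    simpa [e] using h
  | succ n ih =>
    obtain ⟨r, hr⟩ : ∃ r, c 0 = r + 1 := ⟨c 0 - 1, by have := hc 0; omega⟩
    rw [Fin.sum_univ_succ] at hcd
    set q := (finSuccEquiv ℝ (n + 1) p).coeff (c 0) with hq
    have hqcoeff : ∀ m, coeff m q = coeff (Finsupp.cons (c 0) m) p := fun m =>
      finSuccEquiv_coeff_coeff m p (c 0)
    have hD1 : (0 : ℝ) < (D : ℝ) + 1 := by positivity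
    have key := ih (d := ∑ j : Fin (n + 1), c j.succ) (by omega) (p := q)
      (hp.finSuccEquiv_coeff hd (by omega)) (hd.finSuccEquiv_coeff_isHomogeneous _ _ hcd)
      (fun m => by rw [hqcoeff]; exact hnn _) (fun j => c j.succ) (fun j => hc _) rfl
      (L := L / ((D : ℝ) + 1)) (fun y hy => ?_)
    · rw [div_le_iff₀ hD1, hqcoeff] at key
      have e : Finsupp.cons (c 0) (Finsupp.equivFunOnFinite.symm fun j => c (Fin.succ j)) =
          Finsupp.equivFunOnFinite.symm c := by
        ext i
        refine Fin.cases ?_ (fun j => ?_) i <;> simp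
      rw [e] at key
      calc L ≤ _ := key
        _ = _ := by ring
    · obtain ⟨h1, h2⟩ := natDegree_map_finSuccEquiv hp hd y
      set g := (finSuccEquiv ℝ (n + 1) p).map
        (aeval y : MvPolynomial (Fin (n + 1)) ℝ →ₐ[ℝ] ℝ).toRingHom with hg
      have hlead : 0 < coeff (Finsupp.single 0 d) p :=
        (hnn _).lt_of_ne (hp.coeff_single_ne_zero hd).symm
      have hmap : ∀ ζ : ℂ, Polynomial.aeval ζ g =
          aeval (Fin.cons ζ fun j => (y j : ℂ) : Fin (n + 2) → ℂ) p := by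
        intro ζ
        rw [aeval_cons_eq_eval_map, ← Polynomial.eval_map_algebraMap, hg, Polynomial.map_map]
        congr 2
        refine MvPolynomial.ringHom_ext (fun a => ?_) fun i => ?_ <;> simp
      have hlc := isLogConcaveSeq_coeff_of_roots_neg d g h1
        (by rw [Polynomial.leadingCoeff, h1, h2]; exact hlead) (fun ζ hζ => ?_)
      · have hcoef : ∀ k ≤ d, 0 < g.coeff k := fun k hk =>
          hlc.pos_of_le hk (by rw [h2]; exact hlead)
        have hr1 : 0 < g.coeff (r + 1) := hcoef _ (by omega)
        have hr0 : 0 < g.coeff r := hcoef _ (by omega)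
        set t := g.coeff r / g.coeff (r + 1) with ht
        have htp : 0 < t := div_pos hr0 hr1
        have hgt : g.eval t ≤ ((D : ℝ) + 1) * (g.coeff (r + 1) * t ^ (r + 1)) := by
          rw [Polynomial.eval_eq_sum_range, h1]
          refine (Finset.sum_le_card_nsmul _ _ _ fun j _ => hlc.mul_pow_le hr1 j).trans ?_
          rw [Finset.card_range, nsmul_eq_mul]
          refine mul_le_mul_of_nonneg_right ?_ (by positivity)
          push_cast
          have : (d : ℝ) ≤ D := by exact_mod_cast hdD
          linarith
        have h := hL (Fin.cons t y) (fun j => by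
          refine Fin.cases ?_ (fun j => ?_) j
          · simpa using htp
          · simpa using hy j)
        rw [aeval_cons_eq_eval_map, ← hg, Fin.prod_univ_succ] at h
        simp only [Fin.cons_zero, Fin.cons_succ, hr] at h
        have e : aeval y q = g.coeff (r + 1) := by
          rw [hg, Polynomial.coeff_map, hq, hr]; rfl
        rw [e, div_mul_eq_mul_div, div_le_iff₀ hD1]
        refine le_of_mul_le_mul_right ?_ (pow_pos htp (r + 1))
        calc _ = L * (t ^ (r + 1) * ∏ j, y j ^ c j.succ) := by ring
          _ ≤ _ := h.trans hgt
          _ = _ := by ring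
      · rw [hmap] at hζ
        by_contra! hcon
        have hre : 0 < ζ.re + ‖ζ‖ := by
          have h1 : -‖ζ‖ ≤ ζ.re := (abs_le.1 (Complex.abs_re_le_norm ζ)).1
          rcases h1.lt_or_eq with h | h
          · linarith
          · exfalso
            have him : ζ.im = 0 := by
              have := Complex.sq_norm_sub_sq_re ζ
              rw [← h] at this
              have : ζ.im ^ 2 = 0 := by linarith
              simpa using this
            rcases (norm_nonneg ζ).lt_or_eq with h0 | h0
            · exact hcon ‖ζ‖ h0 (Complex.ext (by simp [h]) (by simp [him]))
            · have : ζ = 0 := norm_eq_zero.1 h0.symm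
              subst this
              refine hp _ (fun j => ?_) ⟨Fin.succ 0, ?_⟩ hζ
              · refine Fin.cases ?_ (fun j => ?_) j
                · simp
                · simpa using (hy j).le
              · simpa using hy 0
        set u : ℂ := ‖ζ‖ + (starRingEnd ℂ) ζ with hu
        have hz : aeval (u • (Fin.cons ζ fun j => (y j : ℂ) : Fin (n + 2) → ℂ)) p = 0 := by
          rw [aeval_smul_of_isHomogeneous hd, hζ, mul_zero]
        have hure : u.re = ζ.re + ‖ζ‖ := by simp [hu, add_comm]
        refine hp _ (fun j => ?_) ⟨Fin.succ 0, ?_⟩ hz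
        · refine Fin.cases ?_ (fun j => ?_) j
          · have : u * ζ = ‖ζ‖ * (ζ + ‖ζ‖) := by
              rw [hu, add_mul, mul_comm ((starRingEnd ℂ) ζ), Complex.mul_conj,
                Complex.normSq_eq_norm_sq]
              push_cast; ring
            simp only [Pi.smul_apply, Fin.cons_zero, smul_eq_mul, this, Complex.re_ofReal_mul,
              Complex.add_re, Complex.ofReal_re]
            positivity
          · simp only [Pi.smul_apply, Fin.cons_succ, smul_eq_mul, Complex.re_mul_ofReal, hure]
            exact (mul_pos hre (hy j)).le
        · simp only [Pi.smul_apply, Fin.cons_succ, smul_eq_mul, Complex.re_mul_ofReal, hure]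
          exact mul_pos hre (hy 0)

/-- The complete homogeneous symmetric sum of degree `k` of the values of `v` on `s`. -/
def completeHomog {ι : Type*} [DecidableEq ι] (s : Finset ι) (v : ι → ℝ) (k : ℕ) : ℝ :=
  ∑ κ ∈ s.piAntidiag k, ∏ i ∈ s, v i ^ κ i

theorem sum_antidiagonal_pow_mul_succ (a : ℕ → ℝ) (v : ℝ) (k : ℕ) :
    ∑ p ∈ Finset.HasAntidiagonal.antidiagonal (k + 1), v ^ p.1 * a p.2 =
      a (k + 1) + v * ∑ p ∈ Finset.HasAntidiagonal.antidiagonal k, v ^ p.1 * a p.2 := by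
  rw [Finset.Nat.sum_antidiagonal_succ, Finset.mul_sum]
  simp [pow_succ', mul_assoc]

theorem IsLogConcaveSeq.of_recurrence {a b : ℕ → ℝ} {v : ℝ} (ha : IsLogConcaveSeq a) (hv : 0 < v)
    (h0 : b 0 = a 0) (hs : ∀ k, b (k + 1) = a (k + 1) + v * b k) : IsLogConcaveSeq b := by
  have hpos : ∀ k, 0 < b k := by
    intro k
    induction k with
    | zero => rw [h0]; exact ha.zero_pos
    | succ k ih => rw [hs]; have := ha.nonneg (k + 1); positivity
  have key : ∀ k i, i ≤ k → b i * a (k + 1) ≤ b (i + 1) * a k := by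
    intro k i
    induction i with
    | zero =>
      intro _
      rw [h0, hs, h0]
      have := ha.mul_succ_le (Nat.zero_le k)
      nlinarith [mul_nonneg hv.le (mul_nonneg (ha.nonneg 0) (ha.nonneg k))]
    | succ i ih =>
      intro hi
      have h1 := mul_le_mul_of_nonneg_left (ih (by omega)) hv.le
      have h2 := ha.mul_succ_le hi
      have e1 : b (i + 1) * a (k + 1) = a (i + 1) * a (k + 1) + v * (b i * a (k + 1)) := by
        rw [hs]; ring
      have e2 : b (i + 1 + 1) * a k = a (i + 1 + 1) * a k + v * (b (i + 1) * a k) := by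
        rw [hs (i + 1)]; ring
      rw [e1, e2]
      exact add_le_add h2 h1
  refine ⟨hpos 0, fun k => (hpos k).le, fun k h => absurd h (hpos k).ne', fun k => ?_⟩
  have h1 := key (k + 1) k (by omega)
  have e : b (k + 1) ^ 2 - b k * b (k + 2) = b (k + 1) * a (k + 1) - b k * a (k + 2) := by
    rw [hs (k + 1)]
    have := hs k
    rw [sq]
    nth_rewrite 1 [this]
    ring
  have e' : b k * a (k + 1 + 1) = b k * a (k + 2) := rfl
  linarith

section completeHomog

variable {ι : Type*} [DecidableEq ι] {s : Finset ι} {v : ι → ℝ}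

theorem completeHomog_cons {i : ι} (hi : i ∉ s) (k : ℕ) :
    completeHomog (Finset.cons i s hi) v k =
      ∑ p ∈ Finset.HasAntidiagonal.antidiagonal k, v i ^ p.1 * completeHomog s v p.2 := by
  rw [completeHomog, Finset.piAntidiag_cons, Finset.sum_disjiUnion]
  refine Finset.sum_congr rfl fun p _ => ?_
  rw [Finset.sum_map, completeHomog, Finset.mul_sum]
  refine Finset.sum_congr rfl fun κ hκ => ?_
  rw [Finset.prod_cons]
  have h0 : κ i = 0 := by
    by_contra h
    exact hi ((Finset.mem_piAntidiag.1 hκ).2 i h)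
  congr 1
  · simp [h0]
  · refine Finset.prod_congr rfl fun j hj => ?_
    have : j ≠ i := by rintro rfl; exact hi hj
    simp [this]

theorem completeHomog_cons_zero {i : ι} (hi : i ∉ s) :
    completeHomog (Finset.cons i s hi) v 0 = completeHomog s v 0 := by
  rw [completeHomog_cons]; simp

theorem completeHomog_cons_succ {i : ι} (hi : i ∉ s) (k : ℕ) :
    completeHomog (Finset.cons i s hi) v (k + 1) =
      completeHomog s v (k + 1) + v i * completeHomog (Finset.cons i s hi) v k := by
  rw [completeHomog_cons, sum_antidiagonal_pow_mul_succ, completeHomog_cons]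

theorem isLogConcaveSeq_completeHomog (hv : ∀ i, 0 < v i) (s : Finset ι) :
    IsLogConcaveSeq (completeHomog s v) := by
  induction s using Finset.cons_induction with
  | empty =>
    have h : ∀ k, completeHomog (∅ : Finset ι) v (k + 1) = 0 := fun k => by simp [completeHomog]
    have h0 : completeHomog (∅ : Finset ι) v 0 = 1 := by simp [completeHomog]
    refine ⟨by simp [h0], fun k => ?_, fun k _ => h k, fun k => by simp [h]⟩
    cases k <;> simp [h, h0]
  | cons i s hi ih =>
    exact ih.of_recurrence (hv i) (completeHomog_cons_zero hi) (completeHomog_cons_succ hi)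

theorem mul_completeHomog_le (hv : ∀ i, 0 < v i) {s : Finset ι} {i : ι} (hi : i ∈ s) (k : ℕ) :
    v i * completeHomog s v k ≤ completeHomog s v (k + 1) := by
  obtain ⟨t, ht, rfl⟩ : ∃ t, ∃ h : i ∉ t, s = Finset.cons i t h :=
    ⟨s.erase i, Finset.notMem_erase i s, by simp [Finset.insert_erase hi]⟩
  rw [completeHomog_cons_succ]
  linarith [(isLogConcaveSeq_completeHomog hv t).nonneg (k + 1)]

theorem hasSum_completeHomog (hv : ∀ i, 0 < v i) {x : ℝ} (hx : 0 < x) (s : Finset ι)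
    (h : ∀ i ∈ s, v i * x < 1) :
    HasSum (fun k => completeHomog s v k * x ^ k) (∏ i ∈ s, (1 - v i * x)⁻¹) := by
  induction s using Finset.cons_induction with
  | empty =>
    have h : ∀ k ≠ 0, completeHomog (∅ : Finset ι) v k * x ^ k = 0 := fun k hk => by
      simp [completeHomog, hk]
    simpa [completeHomog] using hasSum_single 0 h
  | cons i s hi ih =>
    have hs := ih fun j hj => h j (Finset.mem_cons_of_mem hj)
    have h0 : 0 ≤ v i * x := (mul_pos (hv i) hx).le
    have hg := hasSum_geometric_of_lt_one h0 (h i (Finset.mem_cons_self i s))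
    have hn1 : ∀ k, 0 ≤ (v i * x) ^ k := fun k => pow_nonneg h0 k
    have hn2 : ∀ k, 0 ≤ completeHomog s v k * x ^ k := fun k =>
      mul_nonneg ((isLogConcaveSeq_completeHomog hv s).nonneg k) (pow_nonneg hx.le k)
    have hprod := hg.summable.mul_of_nonneg hs.summable hn1 hn2
    have e : ∀ k, completeHomog (Finset.cons i s hi) v k * x ^ k =
        ∑ p ∈ Finset.HasAntidiagonal.antidiagonal k,
          (v i * x) ^ p.1 * (completeHomog s v p.2 * x ^ p.2) := by
      intro k
      rw [completeHomog_cons, Finset.sum_mul]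
      refine Finset.sum_congr rfl fun p hp => ?_
      rw [← Finset.HasAntidiagonal.mem_antidiagonal.1 hp, mul_pow, pow_add]
      ring
    simp only [e, Finset.prod_cons]
    rw [← hg.tsum_eq, ← hs.tsum_eq,
      hg.summable.tsum_mul_tsum_eq_tsum_sum_antidiagonal hs.summable hprod]
    exact (summable_sum_mul_antidiagonal_of_summable_mul
      (f := fun k => (v i * x) ^ k) (g := fun k => completeHomog s v k * x ^ k) hprod).hasSum

theorem exists_prod_inv_le_completeHomog (hv : ∀ i, 0 < v i) {s : Finset ι} (hs : s.Nonempty)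
    {r : ℕ} (hr : 0 < r) :
    ∃ x : ℝ, 0 < x ∧ (∀ i ∈ s, v i * x < 1) ∧
      x ^ (-(r : ℤ)) * ∏ i ∈ s, (1 - v i * x)⁻¹ ≤
        Real.exp 1 * (r + 1) * completeHomog s v r := by
  obtain ⟨r, rfl⟩ : ∃ q, r = q + 1 := ⟨r - 1, by omega⟩
  have hl := isLogConcaveSeq_completeHomog hv s
  set H := completeHomog s v with hH
  have hpos : ∀ k, 0 < H k := by
    obtain ⟨i, hi⟩ := hs
    intro k
    induction k with
    | zero => exact hl.zero_pos
    | succ k ih => exact (mul_pos (hv i) ih).trans_le (mul_completeHomog_le hv hi k)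
  set t := H r / H (r + 1) with ht
  have htp : 0 < t := div_pos (hpos _) (hpos _)
  have hvt : ∀ i ∈ s, v i * t ≤ 1 := fun i hi => by
    rw [ht, ← mul_div_assoc, div_le_one (hpos _)]
    exact mul_completeHomog_le hv hi r
  set q : ℝ := ((r + 1 : ℕ) : ℝ) with hq
  have hqp : 0 < q := by positivity
  set σ : ℝ := q / (q + 1) with hσ
  have hσp : 0 < σ := by positivity
  have hσ1 : σ < 1 := by rw [hσ, div_lt_one (by positivity)]; linarith
  have hσ2 : (1 - σ)⁻¹ = q + 1 := by rw [hσ]; field_simp; ring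
  have hlt : ∀ i ∈ s, v i * (σ * t) < 1 := fun i hi => by
    nlinarith [hvt i hi, mul_pos (hv i) htp]
  refine ⟨σ * t, by positivity, hlt, ?_⟩
  have hsum := hasSum_completeHomog hv (x := σ * t) (by positivity) s hlt
  have hgeo := (hasSum_geometric_of_lt_one hσp.le hσ1).mul_left (H (r + 1) * t ^ (r + 1))
  have hle := hasSum_le (fun k => ?_) hsum hgeo
  · rw [hσ2] at hle
    have hσe : (σ ^ (r + 1))⁻¹ ≤ Real.exp 1 := by
      have e : (σ ^ (r + 1))⁻¹ = (1 + q⁻¹) ^ (r + 1) := by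
        rw [← inv_pow, hσ]; congr 1; field_simp
      rw [e]
      calc (1 + q⁻¹) ^ (r + 1) ≤ Real.exp q⁻¹ ^ (r + 1) := by
            gcongr; linarith [Real.add_one_le_exp q⁻¹]
        _ = Real.exp 1 := by
            rw [← Real.exp_nat_mul, ← hq, mul_inv_cancel₀ hqp.ne']
    have hx : 0 < σ * t := by positivity
    rw [zpow_neg, zpow_natCast]
    calc ((σ * t) ^ (r + 1))⁻¹ * ∏ i ∈ s, (1 - v i * (σ * t))⁻¹
        ≤ ((σ * t) ^ (r + 1))⁻¹ * (H (r + 1) * t ^ (r + 1) * (q + 1)) := by gcongr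
      _ = (σ ^ (r + 1))⁻¹ * ((q + 1) * H (r + 1)) := by
          rw [mul_pow]; field_simp
      _ ≤ Real.exp 1 * ((q + 1) * H (r + 1)) := by
          have := hpos (r + 1)
          gcongr
      _ = _ := by ring
  · change H k * (σ * t) ^ k ≤ H (r + 1) * t ^ (r + 1) * σ ^ k
    rw [mul_pow, mul_comm (σ ^ k), ← mul_assoc]
    exact mul_le_mul_of_nonneg_right (hl.mul_pow_le (hpos _) k) (by positivity)

end completeHomog

section tables

variable {m n : ℕ}

/-- The nonnegative integer matrices with row sums `r`. -/
def rowTables (n : ℕ) {m : ℕ} (r : Fin m → ℕ) : Finset (Fin m → Fin n → ℕ) :=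
  Fintype.piFinset fun i => Finset.univ.piAntidiag (r i)

/-- The vector of column sums of a matrix. -/
def colSum (D : Fin m → Fin n → ℕ) (j : Fin n) : ℕ := ∑ i, D i j

/-- The weighted count of the matrices with row sums `r` and column sums `α`. -/
def tableSum (w : Fin m → Fin n → ℝ) (r : Fin m → ℕ) (α : Fin n → ℕ) : ℝ :=
  ∑ D ∈ rowTables n r with colSum D = α, ∏ i, ∏ j, w i j ^ D i j

theorem mem_rowTables {r : Fin m → ℕ} {D : Fin m → Fin n → ℕ} :
    D ∈ rowTables n r ↔ ∀ i, ∑ j, D i j = r i := by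
  simp [rowTables, Fintype.mem_piFinset]

theorem sum_colSum {r : Fin m → ℕ} {D : Fin m → Fin n → ℕ} (hD : D ∈ rowTables n r) :
    ∑ j, colSum D j = ∑ i, r i := by
  simp only [colSum]
  rw [Finset.sum_comm]
  exact Finset.sum_congr rfl fun i _ => mem_rowTables.1 hD i

theorem prod_prod_mul_pow {R : Type*} [CommSemiring R] (v : Fin m → Fin n → R) (z : Fin n → R)
    (D : Fin m → Fin n → ℕ) :
    ∏ i, ∏ j, (v i j * z j) ^ D i j = (∏ i, ∏ j, v i j ^ D i j) * ∏ j, z j ^ colSum D j := by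
  simp only [mul_pow, Finset.prod_mul_distrib]
  congr 1
  rw [Finset.prod_comm]
  exact Finset.prod_congr rfl fun j _ => Finset.prod_pow_eq_pow_sum _ _ _

theorem prod_completeHomog_eq (w : Fin m → Fin n → ℝ) (r : Fin m → ℕ) (y : Fin n → ℝ) :
    ∏ i, completeHomog Finset.univ (fun j => w i j * y j) (r i) =
      ∑ α ∈ (rowTables n r).image colSum, tableSum w r α * ∏ j, y j ^ α j := by
  simp only [completeHomog]
  rw [Finset.prod_univ_sum]
  simp only [prod_prod_mul_pow]
  change ∑ D ∈ rowTables n r, _ = _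
  rw [← Finset.sum_fiberwise_of_maps_to (g := colSum)
    (fun D hD => Finset.mem_image_of_mem colSum hD)]
  refine Finset.sum_congr rfl fun α _ => ?_
  rw [tableSum, Finset.sum_mul]
  refine Finset.sum_congr rfl fun D hD => ?_
  rw [(Finset.mem_filter.1 hD).2]

theorem tableSum_pos {w : Fin m → Fin n → ℝ} (hw : ∀ i j, 0 < w i j) {r : Fin m → ℕ}
    {α : Fin n → ℕ} (hα : α ∈ (rowTables n r).image colSum) : 0 < tableSum w r α := by
  obtain ⟨D, hD, rfl⟩ := Finset.mem_image.1 hα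
  exact Finset.sum_pos
    (fun D _ => Finset.prod_pos fun i _ => Finset.prod_pos fun j _ => pow_pos (hw i j) _)
    ⟨D, Finset.mem_filter.2 ⟨hD, rfl⟩⟩

theorem single_mem_image_colSum (r : Fin m → ℕ) (j : Fin n) :
    Pi.single j (∑ i, r i) ∈ (rowTables n r).image colSum := by
  refine Finset.mem_image.2 ⟨fun i => Pi.single j (r i), mem_rowTables.2 fun i => by simp, ?_⟩
  ext k
  by_cases hk : k = j
  · subst hk; simp [colSum]
  · simp [colSum, hk]

theorem card_image_colSum_le (r : Fin m → ℕ) :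
    ((rowTables n r).image colSum).card ≤ ((∑ i, r i) + 1) ^ n := by
  have h : (rowTables n r).image colSum ⊆
      Fintype.piFinset fun _ : Fin n => Finset.range ((∑ i, r i) + 1) := by
    intro α hα
    obtain ⟨D, hD, rfl⟩ := Finset.mem_image.1 hα
    rw [Fintype.mem_piFinset]
    intro j
    rw [Finset.mem_range, Nat.lt_succ_iff, ← sum_colSum hD]
    exact Finset.single_le_sum (f := colSum D) (fun _ _ => Nat.zero_le _) (Finset.mem_univ j)
  simpa using Finset.card_le_card h

/-- The contribution of `D` to the expansion of `∏ i, (∑ j, v i j) ^ r i`. -/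
def multinomialWeight (v : Fin m → Fin n → ℝ) (D : Fin m → Fin n → ℕ) : ℝ :=
  (∏ i, (Nat.multinomial Finset.univ (D i) : ℝ)) * ∏ i, ∏ j, v i j ^ D i j

theorem multinomialWeight_nonneg {v : Fin m → Fin n → ℝ} (hv : ∀ i j, 0 ≤ v i j)
    (D : Fin m → Fin n → ℕ) : 0 ≤ multinomialWeight v D :=
  mul_nonneg (Finset.prod_nonneg fun _ _ => Nat.cast_nonneg _)
    (Finset.prod_nonneg fun i _ => Finset.prod_nonneg fun j _ => pow_nonneg (hv i j) _)

/-- The product of powers of linear forms with coefficient matrix `v`. -/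
noncomputable def rowPoly (v : Fin m → Fin n → ℝ) (r : Fin m → ℕ) : MvPolynomial (Fin n) ℝ :=
  ∏ i, (∑ j, MvPolynomial.C (v i j) * MvPolynomial.X j) ^ r i

theorem aeval_rowPoly {A : Type*} [CommRing A] [Algebra ℝ A] (v : Fin m → Fin n → ℝ)
    (r : Fin m → ℕ) (z : Fin n → A) :
    MvPolynomial.aeval z (rowPoly v r) = ∏ i, (∑ j, algebraMap ℝ A (v i j) * z j) ^ r i := by
  simp [rowPoly]

theorem rowPoly_eq_sum (v : Fin m → Fin n → ℝ) (r : Fin m → ℕ) :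
    rowPoly v r = ∑ D ∈ rowTables n r,
      MvPolynomial.monomial (Finsupp.equivFunOnFinite.symm (colSum D)) (multinomialWeight v D) := by
  rw [rowPoly]
  simp only [Finset.sum_pow_eq_sum_piAntidiag]
  rw [Finset.prod_univ_sum]
  refine Finset.sum_congr rfl fun D _ => ?_
  rw [Finset.prod_mul_distrib, prod_prod_mul_pow, MvPolynomial.monomial_eq, multinomialWeight,
    Finsupp.prod_fintype _ _ (by simp)]
  simp [mul_assoc]

theorem coeff_rowPoly (v : Fin m → Fin n → ℝ) (r : Fin m → ℕ) (α : Fin n → ℕ) :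
    MvPolynomial.coeff (Finsupp.equivFunOnFinite.symm α) (rowPoly v r) =
      ∑ D ∈ rowTables n r with colSum D = α, multinomialWeight v D := by
  rw [rowPoly_eq_sum, MvPolynomial.coeff_sum, Finset.sum_filter]
  refine Finset.sum_congr rfl fun D _ => ?_
  rw [MvPolynomial.coeff_monomial]
  simp

theorem aeval_rowPoly_real (v : Fin m → Fin n → ℝ) (r : Fin m → ℕ) (y : Fin n → ℝ) :
    MvPolynomial.aeval y (rowPoly v r) =
      ∑ D ∈ rowTables n r, multinomialWeight v D * ∏ j, y j ^ colSum D j := by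
  rw [rowPoly_eq_sum, map_sum]
  refine Finset.sum_congr rfl fun D _ => ?_
  rw [MvPolynomial.aeval_monomial, Finsupp.prod_fintype _ _ (by simp)]
  simp

theorem coeff_rowPoly_nonneg {v : Fin m → Fin n → ℝ} (hv : ∀ i j, 0 ≤ v i j) (r : Fin m → ℕ)
    (d : Fin n →₀ ℕ) : 0 ≤ MvPolynomial.coeff d (rowPoly v r) := by
  have := coeff_rowPoly v r d
  rw [Finsupp.equivFunOnFinite_symm_coe] at this
  rw [this]
  exact Finset.sum_nonneg fun D _ => multinomialWeight_nonneg hv D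

theorem coeff_rowPoly_mul_le {v : Fin m → Fin n → ℝ} (hv : ∀ i j, 0 ≤ v i j) (r : Fin m → ℕ)
    (α : Fin n → ℕ) {y : Fin n → ℝ} (hy : ∀ j, 0 < y j) :
    MvPolynomial.coeff (Finsupp.equivFunOnFinite.symm α) (rowPoly v r) * ∏ j, y j ^ α j ≤
      MvPolynomial.aeval y (rowPoly v r) := by
  rw [coeff_rowPoly, aeval_rowPoly_real, Finset.sum_mul]
  calc _ = ∑ D ∈ rowTables n r with colSum D = α,
        multinomialWeight v D * ∏ j, y j ^ colSum D j :=
        Finset.sum_congr rfl fun D hD => by rw [(Finset.mem_filter.1 hD).2]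
    _ ≤ _ := Finset.sum_le_sum_of_subset_of_nonneg (Finset.filter_subset _ _) fun D _ _ =>
        mul_nonneg (multinomialWeight_nonneg hv D)
          (Finset.prod_nonneg fun j _ => pow_nonneg (hy j).le _)

theorem isHomogeneous_rowPoly (v : Fin m → Fin n → ℝ) (r : Fin m → ℕ) :
    (rowPoly v r).IsHomogeneous (∑ i, r i) := by
  refine MvPolynomial.IsHomogeneous.prod _ _ _ fun i _ => ?_
  have h : (∑ j, MvPolynomial.C (v i j) * MvPolynomial.X j :
      MvPolynomial (Fin n) ℝ).IsHomogeneous 1 :=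
    MvPolynomial.IsHomogeneous.sum _ _ _ fun j _ => by
      simpa using (MvPolynomial.isHomogeneous_C (Fin n) (v i j)).mul
        (MvPolynomial.isHomogeneous_X ℝ j)
  simpa using h.pow (r i)

theorem halfPlaneStable_rowPoly {v : Fin m → Fin n → ℝ} (hv : ∀ i j, 0 < v i j)
    (r : Fin m → ℕ) : HalfPlaneStable (rowPoly v r) := by
  rintro z hz ⟨k, hk⟩
  rw [aeval_rowPoly, Finset.prod_ne_zero_iff]
  intro i _
  refine pow_ne_zero _ fun h => ?_
  have h1 := congrArg Complex.re h
  rw [Complex.re_sum] at h1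
  have h2 : 0 < ∑ j, (algebraMap ℝ ℂ (v i j) * z j).re := by
    refine Finset.sum_pos' (fun j _ => ?_) ⟨k, Finset.mem_univ k, ?_⟩
    · simpa using mul_nonneg (hv i j).le (hz j)
    · simpa using mul_pos (hv i k) hk
  rw [h1] at h2
  simp at h2

end tables

open MeasureTheory in
theorem lintegral_orthant_prod_pow_mul_exp {ι : Type*} [Fintype ι] (d : ι → ℕ) :
    ∫⁻ x in Set.univ.pi fun _ : ι => Set.Ioi (0 : ℝ),
      ENNReal.ofReal (∏ i, x i ^ d i * Real.exp (-x i)) =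
      ENNReal.ofReal (∏ i, ((d i).factorial : ℝ)) := by
  have hint : ∀ k : ℕ, IntegrableOn (fun t : ℝ => t ^ k * Real.exp (-t)) (Set.Ioi 0) ∧
      ∫ t in Set.Ioi (0 : ℝ), t ^ k * Real.exp (-t) = (k.factorial : ℝ) := by
    intro k
    have hk : (0 : ℝ) < k + 1 := by positivity
    have h1 := Real.GammaIntegral_convergent hk
    have h2 := Real.Gamma_eq_integral hk
    rw [Real.Gamma_nat_eq_factorial] at h2
    have e : (fun x : ℝ => Real.exp (-x) * x ^ ((k : ℝ) + 1 - 1)) =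
        fun t : ℝ => t ^ k * Real.exp (-t) := by
      ext t
      rw [add_sub_cancel_right, Real.rpow_natCast, mul_comm]
    rw [e] at h1 h2
    exact ⟨h1, h2.symm⟩
  have hnn : ∀ᵐ x ∂(volume.restrict (Set.univ.pi fun _ : ι => Set.Ioi (0 : ℝ))),
      0 ≤ ∏ i, x i ^ d i * Real.exp (-x i) := by
    refine ae_restrict_of_forall_mem (MeasurableSet.univ_pi fun _ => measurableSet_Ioi)
      fun x hx => Finset.prod_nonneg fun i _ => ?_
    exact mul_nonneg (pow_nonneg (hx i (Set.mem_univ i)).le _) (Real.exp_pos _).le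
  rw [volume_pi, Measure.restrict_pi_pi] at hnn ⊢
  have hI : Integrable (fun x : ι → ℝ => ∏ i, x i ^ d i * Real.exp (-x i))
      (Measure.pi fun _ => volume.restrict (Set.Ioi (0 : ℝ))) :=
    Integrable.fintype_prod (f := fun i t => t ^ d i * Real.exp (-t)) fun i => (hint (d i)).1
  rw [← ofReal_integral_eq_lintegral_ofReal hI hnn,
    integral_fintype_prod_eq_prod (fun i t => t ^ d i * Real.exp (-t))]
  simp only [(hint _).2]

theorem concaveOn_log_of_geom_mean_le {E : Type*} [AddCommGroup E] [Module ℝ E] {g : E → ℝ}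
    (h : ∀ x y : E, ∀ a b : ℝ, 0 < a → 0 < b → a + b = 1 →
      g x ^ a * g y ^ b ≤ g (a • x + b • y)) :
    ConcaveOn ℝ {x | 0 < g x} fun x => Real.log (g x) := by
  have hc : Convex ℝ {x | 0 < g x} := convex_iff_forall_pos.2 fun x hx y hy a b ha hb hab =>
    (mul_pos (Real.rpow_pos_of_pos hx a) (Real.rpow_pos_of_pos hy b)).trans_le
      (h x y a b ha hb hab)
  refine concaveOn_iff_forall_pos.2 ⟨hc, fun x hx y hy a b ha hb hab => ?_⟩
  have h1 := Real.log_le_log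
    (mul_pos (Real.rpow_pos_of_pos hx a) (Real.rpow_pos_of_pos hy b)) (h x y a b ha hb hab)
  rw [Real.log_mul (Real.rpow_pos_of_pos hx a).ne' (Real.rpow_pos_of_pos hy b).ne',
    Real.log_rpow hx, Real.log_rpow hy] at h1
  simpa using h1

/-- The entropy of a probability vector is at most the logarithm of the size of its support. -/
theorem neg_log_card_le_sum_mul_log {ι : Type*} {s : Finset ι} {μ : ι → ℝ}
    (hμ : ∀ i ∈ s, 0 < μ i) (hs : ∑ i ∈ s, μ i = 1) :
    -Real.log s.card ≤ ∑ i ∈ s, μ i * Real.log (μ i) := by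
  have hne : s.Nonempty := by
    rw [Finset.nonempty_iff_ne_empty]; rintro rfl; simp at hs
  have hk : (0 : ℝ) < s.card := by exact_mod_cast hne.card_pos
  have h : ∀ i ∈ s, μ i * -Real.log s.card - μ i * Real.log (μ i) ≤ (s.card : ℝ)⁻¹ - μ i := by
    intro i hi
    have hp := hμ i hi
    have h1 := Real.log_le_sub_one_of_pos (x := (s.card * μ i)⁻¹) (by positivity)
    rw [Real.log_inv, Real.log_mul hk.ne' hp.ne'] at h1
    have h2 := mul_le_mul_of_nonneg_left h1 hp.le
    have h3 : μ i * ((s.card * μ i)⁻¹ - 1) = (s.card : ℝ)⁻¹ - μ i := by field_simp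
    linarith
  have h2 := Finset.sum_le_sum h
  rw [Finset.sum_sub_distrib, Finset.sum_sub_distrib, ← Finset.sum_mul, hs] at h2
  simp only [Finset.sum_const, nsmul_eq_mul, mul_inv_cancel₀ hk.ne'] at h2
  linarith

section tilt

variable {n N : ℕ} {A : Finset (Fin n → ℕ)} {T : (Fin n → ℕ) → ℝ} {c : Fin n → ℕ}

theorem exists_isMinOn_exp_sum (hT : ∀ α ∈ A, 0 < T α) (hA : ∀ α ∈ A, ∑ j, α j = N)
    (hc : ∀ j, 0 < c j) (hcN : ∑ j, c j = N) (hN : 0 < N) (hAc : ∀ j, Pi.single j N ∈ A) :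
    ∃ s : Fin n → ℝ, ∀ s' : Fin n → ℝ, ∑ α ∈ A, T α * Real.exp (∑ j, ((α j : ℝ) - c j) * s j) ≤
      ∑ α ∈ A, T α * Real.exp (∑ j, ((α j : ℝ) - c j) * s' j) := by
  set f : (Fin n → ℝ) → ℝ :=
    fun s => ∑ α ∈ A, T α * Real.exp (∑ j, ((α j : ℝ) - c j) * s j) with hf
  have hNR : (0 : ℝ) < N := by exact_mod_cast hN
  have hcR : ∑ j, (c j : ℝ) = N := by exact_mod_cast hcN
  have hcont : Continuous f := by fun_prop
  set S : Set (Fin n → ℝ) := {s | f s ≤ f 0 ∧ ∑ j, (c j : ℝ) * s j = 0} with hS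
  have hSc : IsClosed S :=
    (isClosed_le hcont continuous_const).inter
      (isClosed_eq (by fun_prop) continuous_const)
  have hlow : ∀ s ∈ S, ∀ j, T (Pi.single j N) * Real.exp (N * s j) ≤ f 0 := by
    intro s hs j
    refine le_trans ?_ hs.1
    have h1 := Finset.single_le_sum
      (f := fun α => T α * Real.exp (∑ j, ((α j : ℝ) - c j) * s j))
      (fun α hα => (mul_pos (hT α hα) (Real.exp_pos _)).le) (hAc j)
    refine le_trans (le_of_eq ?_) h1
    have : ∑ k, (((Pi.single j N : Fin n → ℕ) k : ℝ) - c k) * s k = N * s j := by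
      simp only [sub_mul, Finset.sum_sub_distrib, hs.2, sub_zero]
      rw [Finset.sum_eq_single j]
      · simp
      · intro k _ hk; simp [hk]
      · simp
    simp only [this]
  obtain ⟨B, hB0, hB⟩ : ∃ B : ℝ, 0 ≤ B ∧ ∀ s ∈ S, ∀ j, s j ≤ B := by
    refine ⟨∑ j, |Real.log (f 0 / T (Pi.single j N)) / N|,
      Finset.sum_nonneg fun _ _ => abs_nonneg _, fun s hs j => ?_⟩
    have h0 := hT _ (hAc j)
    have h1 : Real.exp (N * s j) ≤ f 0 / T (Pi.single j N) := by
      rw [le_div_iff₀ h0, mul_comm]; exact hlow s hs j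
    have h2 := Real.log_le_log (Real.exp_pos _) h1
    rw [Real.log_exp] at h2
    have h3 : s j ≤ Real.log (f 0 / T (Pi.single j N)) / N := by
      rw [le_div_iff₀ hNR]; linarith
    exact (h3.trans (le_abs_self _)).trans
      (Finset.single_le_sum (f := fun j => |Real.log (f 0 / T (Pi.single j N)) / N|)
        (fun _ _ => abs_nonneg _) (Finset.mem_univ j))
  have hSub : S ⊆ Set.Icc (fun _ => -(N * B)) (fun _ => B) := by
    intro s hs
    refine ⟨fun j => ?_, fun j => hB s hs j⟩
    have h1 : ∑ k ∈ Finset.univ.erase j, (c k : ℝ) * s k ≤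
        ∑ k ∈ Finset.univ.erase j, (c k : ℝ) * B :=
      Finset.sum_le_sum fun k _ => mul_le_mul_of_nonneg_left (hB s hs k) (Nat.cast_nonneg _)
    have h2 : ∑ k ∈ Finset.univ.erase j, (c k : ℝ) * B ≤ N * B := by
      rw [← Finset.sum_mul, ← hcR]
      exact mul_le_mul_of_nonneg_right
        (Finset.sum_le_sum_of_subset_of_nonneg (Finset.erase_subset _ _)
          fun _ _ _ => Nat.cast_nonneg _) hB0
    have h3 := Finset.add_sum_erase Finset.univ (fun k => (c k : ℝ) * s k) (Finset.mem_univ j)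
    have h4 : ∑ j, (c j : ℝ) * s j = 0 := hs.2
    have h5 : (1 : ℝ) ≤ c j := by exact_mod_cast hc j
    have h6 : -(N * B) ≤ c j * s j := by linarith
    have h7 : 0 ≤ N * B := by positivity
    change -(N * B) ≤ s j
    by_contra! h
    nlinarith
  have hcomp : IsCompact S := isCompact_Icc.of_isClosed_subset hSc hSub
  obtain ⟨s, hs, hmin⟩ := hcomp.exists_isMinOn ⟨0, le_rfl, by simp⟩ hcont.continuousOn
  refine ⟨s, fun s' => ?_⟩
  change f s ≤ f s'
  set τ := (∑ j, (c j : ℝ) * s' j) / N with hτ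
  have hshift : f (fun j => s' j - τ) = f s' := by
    simp only [hf]
    refine Finset.sum_congr rfl fun α hα => ?_
    have : ∑ j, ((α j : ℝ) - c j) * (s' j - τ) = ∑ j, ((α j : ℝ) - c j) * s' j := by
      have hα' : ∑ j, (α j : ℝ) = N := by exact_mod_cast hA α hα
      simp only [mul_sub, Finset.sum_sub_distrib, ← Finset.sum_mul, hα', hcR]
      ring
    rw [this]
  rw [← hshift]
  by_cases h : f (fun j => s' j - τ) ≤ f 0
  · refine hmin ⟨h, ?_⟩
    simp only [mul_sub, Finset.sum_sub_distrib, ← Finset.sum_mul, hcR, hτ]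
    field_simp
    ring
  · exact (hmin (show (0 : Fin n → ℝ) ∈ S from ⟨le_rfl, by simp⟩)).trans (not_le.1 h).le

/-- At a minimizer of the exponential sum, the induced probability vector has mean `c`. -/
theorem sum_mul_exp_eq_zero_of_isMin {s : Fin n → ℝ}
    (hs : ∀ s' : Fin n → ℝ, ∑ α ∈ A, T α * Real.exp (∑ j, ((α j : ℝ) - c j) * s j) ≤
      ∑ α ∈ A, T α * Real.exp (∑ j, ((α j : ℝ) - c j) * s' j)) (k : Fin n) :
    ∑ α ∈ A, T α * Real.exp (∑ j, ((α j : ℝ) - c j) * s j) * ((α k : ℝ) - c k) = 0 := by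
  have e : ∀ (α : Fin n → ℕ) (t : ℝ),
      ∑ j, ((α j : ℝ) - c j) * (s + t • (Pi.single k 1 : Fin n → ℝ)) j =
      ∑ j, ((α j : ℝ) - c j) * s j + t * ((α k : ℝ) - c k) := by
    intro α t
    simp only [Pi.add_apply, Pi.smul_apply, smul_eq_mul, mul_add, Finset.sum_add_distrib]
    congr 1
    rw [Finset.sum_eq_single k]
    · simp; ring
    · intro j _ hj; simp [hj]
    · simp
  have hder : HasDerivAt (fun t : ℝ => ∑ α ∈ A, T α *
      Real.exp (∑ j, ((α j : ℝ) - c j) * s j + t * ((α k : ℝ) - c k)))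
      (∑ α ∈ A, T α * Real.exp (∑ j, ((α j : ℝ) - c j) * s j) * ((α k : ℝ) - c k)) 0 := by
    refine HasDerivAt.fun_sum fun α _ => ?_
    have h1 : HasDerivAt (fun t : ℝ => ∑ j, ((α j : ℝ) - c j) * s j + t * ((α k : ℝ) - c k))
        ((α k : ℝ) - c k) 0 := by
      simpa using ((hasDerivAt_id (0 : ℝ)).mul_const ((α k : ℝ) - c k)).const_add
        (∑ j, ((α j : ℝ) - c j) * s j)
    have h2 := (h1.exp).const_mul (T α)
    simpa [mul_assoc] using h2
  refine IsLocalMin.hasDerivAt_eq_zero (Filter.Eventually.of_forall fun t => ?_) hder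
  have := hs (s + t • Pi.single k 1)
  simp only [e] at this
  simpa using this

/-- If the coefficients of a positive homogeneous polynomial are dominated by a log-concave
function `g`, its capacity at `c` is controlled by `g c`. -/
theorem exists_sum_le_card_mul (hT : ∀ α ∈ A, 0 < T α) (hA : ∀ α ∈ A, ∑ j, α j = N)
    (hc : ∀ j, 0 < c j) (hcN : ∑ j, c j = N) (hN : 0 < N) (hAc : ∀ j, Pi.single j N ∈ A)
    {g : (Fin n → ℝ) → ℝ} (hg : ∀ x y : Fin n → ℝ, ∀ a b : ℝ, 0 < a → 0 < b → a + b = 1 →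
      g x ^ a * g y ^ b ≤ g (a • x + b • y))
    {p : ℝ} (hp : 0 < p) (hgT : ∀ α ∈ A, T α * p ≤ g (fun j => (α j : ℝ))) :
    ∃ y : Fin n → ℝ, (∀ j, 0 < y j) ∧
      p * ∑ α ∈ A, T α * ∏ j, y j ^ α j ≤
        A.card * g (fun j => (c j : ℝ)) * ∏ j, y j ^ c j := by
  obtain ⟨s, hs⟩ := exists_isMinOn_exp_sum hT hA hc hcN hN hAc
  have hmean := sum_mul_exp_eq_zero_of_isMin hs
  set E : (Fin n → ℕ) → ℝ := fun α => ∑ j, ((α j : ℝ) - c j) * s j with hE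
  set F := ∑ α ∈ A, T α * Real.exp (E α) with hF
  have hcR : ∑ j, (c j : ℝ) = N := by exact_mod_cast hcN
  have hNR : (0 : ℝ) < N := by exact_mod_cast hN
  have hne : A.Nonempty := by
    have : Nonempty (Fin n) := by
      by_contra h
      rw [not_nonempty_iff] at h
      simp at hcN; omega
    exact ⟨_, hAc this.some⟩
  have hk : (0 : ℝ) < A.card := by exact_mod_cast hne.card_pos
  have hFpos : 0 < F := Finset.sum_pos (fun α hα => mul_pos (hT α hα) (Real.exp_pos _)) hne
  set μ : (Fin n → ℕ) → ℝ := fun α => T α * Real.exp (E α) / F with hμ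
  have hμpos : ∀ α ∈ A, 0 < μ α := fun α hα =>
    div_pos (mul_pos (hT α hα) (Real.exp_pos _)) hFpos
  have hμ1 : ∑ α ∈ A, μ α = 1 := by
    rw [hμ, ← Finset.sum_div, div_self hFpos.ne']
  have hμ0 : ∀ k, ∑ α ∈ A, μ α * ((α k : ℝ) - c k) = 0 := by
    intro k
    have : ∑ α ∈ A, μ α * ((α k : ℝ) - c k) =
        (∑ α ∈ A, T α * Real.exp (E α) * ((α k : ℝ) - c k)) / F := by
      rw [Finset.sum_div]; exact Finset.sum_congr rfl fun α _ => by rw [hμ]; ring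
    rw [this, hmean k, zero_div]
  have hμc : ∑ α ∈ A, μ α • (fun j => (α j : ℝ)) = fun j => (c j : ℝ) := by
    ext k
    have := hμ0 k
    simp only [mul_sub, Finset.sum_sub_distrib, ← Finset.sum_mul, hμ1, one_mul] at this
    simp only [Finset.sum_apply, Pi.smul_apply, smul_eq_mul]
    linarith
  have hgpos : ∀ α ∈ A, 0 < g (fun j => (α j : ℝ)) := fun α hα =>
    (mul_pos (hT α hα) hp).trans_le (hgT α hα)
  have hcc := concaveOn_log_of_geom_mean_le hg
  have hgc : 0 < g (fun j => (c j : ℝ)) := by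
    rw [← hμc]
    exact hcc.1.sum_mem (fun α hα => (hμpos α hα).le) hμ1 fun α hα => hgpos α hα
  have hJ := hcc.le_map_sum (t := A) (w := μ) (p := fun α j => (α j : ℝ))
    (fun α hα => (hμpos α hα).le) hμ1 fun α hα => hgpos α hα
  rw [hμc] at hJ
  have hent := neg_log_card_le_sum_mul_log hμpos hμ1
  have hterm : ∀ α ∈ A, μ α * Real.log (μ α) + μ α * (Real.log F + Real.log p) - μ α * E α ≤
      μ α • Real.log (g fun j => (α j : ℝ)) := by
    intro α hα
    have h1 := Real.log_le_log (mul_pos (hT α hα) hp) (hgT α hα)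
    have h2 : T α * p = μ α * F * p * Real.exp (-E α) := by
      rw [hμ, Real.exp_neg]
      field_simp
    rw [h2, Real.log_mul (by have := hμpos α hα; positivity) (Real.exp_pos _).ne', Real.log_exp,
      Real.log_mul (by have := hμpos α hα; positivity) hp.ne',
      Real.log_mul (hμpos α hα).ne' hFpos.ne'] at h1
    have h3 := mul_le_mul_of_nonneg_left h1 (hμpos α hα).le
    rw [smul_eq_mul]
    linarith
  have hEsum : ∑ α ∈ A, μ α * E α = 0 := by
    simp only [hE, Finset.mul_sum]
    rw [Finset.sum_comm]
    refine Finset.sum_eq_zero fun j _ => ?_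
    have := hμ0 j
    calc _ = (∑ α ∈ A, μ α * ((α j : ℝ) - c j)) * s j := by
          rw [Finset.sum_mul]; exact Finset.sum_congr rfl fun _ _ => by ring
      _ = 0 := by rw [this, zero_mul]
  have hsum := Finset.sum_le_sum hterm
  rw [Finset.sum_sub_distrib, Finset.sum_add_distrib, hEsum, ← Finset.sum_mul, hμ1] at hsum
  have hlog : Real.log (F * p) ≤ Real.log (A.card * g fun j => (c j : ℝ)) := by
    rw [Real.log_mul hFpos.ne' hp.ne', Real.log_mul hk.ne' hgc.ne']
    linarith
  have hfin := (Real.log_le_log_iff (by positivity) (by positivity)).1 hlog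
  have hexp : ∀ α : Fin n → ℕ, ∏ j, Real.exp (s j) ^ α j = Real.exp (∑ j, (α j : ℝ) * s j) := by
    intro α
    rw [Real.exp_sum]
    exact Finset.prod_congr rfl fun j _ => by rw [← Real.exp_nat_mul]
  refine ⟨fun j => Real.exp (s j), fun j => Real.exp_pos _, ?_⟩
  have hFe : ∑ α ∈ A, T α * ∏ j, Real.exp (s j) ^ α j = F * ∏ j, Real.exp (s j) ^ c j := by
    rw [hF, Finset.sum_mul]
    refine Finset.sum_congr rfl fun α _ => ?_
    rw [hexp, hexp, mul_assoc, ← Real.exp_add, hE]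
    simp only [sub_mul, Finset.sum_sub_distrib, sub_add_cancel]
  rw [hFe, ← mul_assoc, mul_comm p]
  exact mul_le_mul_of_nonneg_right hfin (Finset.prod_nonneg fun j _ => by positivity)

end tilt

section capacity

open MeasureTheory ENNReal

variable {m n : ℕ} {w : Fin m → Fin n → ℝ} {r : Fin m → ℕ}

/-- The positive orthant. -/
def orthant (ι : Type*) : Set (ι → ℝ) := Set.univ.pi fun _ => Set.Ioi 0

theorem mem_orthant {ι : Type*} {γ : ι → ℝ} : γ ∈ orthant ι ↔ ∀ p, 0 < γ p := by
  simp [orthant]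

theorem measurableSet_orthant (ι : Type*) [Finite ι] : MeasurableSet (orthant ι) :=
  MeasurableSet.univ_pi fun _ => measurableSet_Ioi

/-- The matrix `w` with entries rescaled by `γ`. -/
def scaleMatrix (w : Fin m → Fin n → ℝ) (γ : Fin m × Fin n → ℝ) : Fin m → Fin n → ℝ :=
  fun i j => w i j * γ (i, j)

theorem lintegral_sum_multinomialWeight (hw : ∀ i j, 0 ≤ w i j)
    {S : Finset (Fin m → Fin n → ℕ)} (hS : S ⊆ rowTables n r) :
    ∫⁻ γ in orthant (Fin m × Fin n),
      ENNReal.ofReal ((∑ D ∈ S, multinomialWeight (scaleMatrix w γ) D) * Real.exp (-∑ p, γ p)) =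
      ENNReal.ofReal ((∑ D ∈ S, ∏ i, ∏ j, w i j ^ D i j) * ∏ i, ((r i).factorial : ℝ)) := by
  have hcoef : ∀ D : Fin m → Fin n → ℕ, 0 ≤ (∏ i, (Nat.multinomial Finset.univ (D i) : ℝ)) *
      ∏ i, ∏ j, w i j ^ D i j := fun D => multinomialWeight_nonneg hw D
  have hexp : ∀ (D : Fin m → Fin n → ℕ) (γ : Fin m × Fin n → ℝ),
      multinomialWeight (scaleMatrix w γ) D * Real.exp (-∑ p, γ p) =
        ((∏ i, (Nat.multinomial Finset.univ (D i) : ℝ)) * ∏ i, ∏ j, w i j ^ D i j) *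
          ∏ p : Fin m × Fin n, γ p ^ D p.1 p.2 * Real.exp (-γ p) := by
    intro D γ
    rw [multinomialWeight, Finset.prod_mul_distrib, ← Real.exp_sum, Finset.sum_neg_distrib,
      Fintype.prod_prod_type]
    simp only [scaleMatrix, mul_pow, Finset.prod_mul_distrib]
    ring
  have hfac : ∀ D ∈ S, ((∏ i, (Nat.multinomial Finset.univ (D i) : ℝ)) *
      ∏ i, ∏ j, w i j ^ D i j) * ∏ p : Fin m × Fin n, ((D p.1 p.2).factorial : ℝ) =
      (∏ i, ∏ j, w i j ^ D i j) * ∏ i, ((r i).factorial : ℝ) := by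
    intro D hD
    rw [Fintype.prod_prod_type, mul_right_comm, ← Finset.prod_mul_distrib, mul_comm]
    congr 1
    refine Finset.prod_congr rfl fun i _ => ?_
    rw [← mem_rowTables.1 (hS hD) i, ← Nat.multinomial_spec]
    push_cast
    ring
  have hpt : ∀ γ ∈ orthant (Fin m × Fin n),
      ENNReal.ofReal ((∑ D ∈ S, multinomialWeight (scaleMatrix w γ) D) * Real.exp (-∑ p, γ p)) =
      ∑ D ∈ S, ENNReal.ofReal ((∏ i, (Nat.multinomial Finset.univ (D i) : ℝ)) *
        ∏ i, ∏ j, w i j ^ D i j) *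
        ENNReal.ofReal (∏ p : Fin m × Fin n, γ p ^ D p.1 p.2 * Real.exp (-γ p)) := by
    intro γ hγ
    rw [Finset.sum_mul, ENNReal.ofReal_sum_of_nonneg]
    · refine Finset.sum_congr rfl fun D _ => ?_
      rw [hexp, ENNReal.ofReal_mul (hcoef D)]
    · intro D _
      exact mul_nonneg (multinomialWeight_nonneg
        (fun i j => mul_nonneg (hw i j) (mem_orthant.1 hγ (i, j)).le) D) (Real.exp_pos _).le
  rw [setLIntegral_congr_fun (measurableSet_orthant _) hpt, lintegral_finsetSum _ fun D _ => by
    fun_prop, Finset.sum_mul, ENNReal.ofReal_sum_of_nonneg fun D _ => by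
      have := hw
      exact mul_nonneg (Finset.prod_nonneg fun i _ => Finset.prod_nonneg fun j _ =>
        pow_nonneg (hw i j) _) (Finset.prod_nonneg fun i _ => Nat.cast_nonneg _)]
  refine Finset.sum_congr rfl fun D hD => ?_
  rw [lintegral_const_mul _ (by fun_prop), orthant,
    lintegral_orthant_prod_pow_mul_exp (fun p : Fin m × Fin n => D p.1 p.2),
    ← ENNReal.ofReal_mul (hcoef D), hfac D hD]

/-- The exponentially weighted value at `exp s` of the row polynomial, divided by the monomial of
exponent `C`. -/
noncomputable def tiltedRow (w : Fin m → Fin n → ℝ) (r : Fin m → ℕ) (s C : Fin n → ℝ)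
    (γ : Fin m × Fin n → ℝ) : ℝ :=
  (∏ i, (∑ j, scaleMatrix w γ i j * Real.exp (s j)) ^ r i) * Real.exp (-∑ j, C j * s j) *
    Real.exp (-∑ p, γ p)

theorem tiltedRow_pos [NeZero n] (hw : ∀ i j, 0 < w i j) (s C : Fin n → ℝ)
    {γ : Fin m × Fin n → ℝ} (hγ : γ ∈ orthant (Fin m × Fin n)) : 0 < tiltedRow w r s C γ := by
  have h : ∀ i, 0 < ∑ j, scaleMatrix w γ i j * Real.exp (s j) := fun i =>
    Finset.sum_pos (fun j _ => mul_pos (mul_pos (hw i j) (mem_orthant.1 hγ (i, j)))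
      (Real.exp_pos _)) Finset.univ_nonempty
  exact mul_pos (mul_pos (Finset.prod_pos fun i _ => pow_pos (h i) _) (Real.exp_pos _))
    (Real.exp_pos _)

theorem tiltedRow_rpow_mul_le [NeZero n] (hw : ∀ i j, 0 < w i j) (s C₀ C₁ : Fin n → ℝ)
    {γ₀ γ₁ : Fin m × Fin n → ℝ} (h₀ : γ₀ ∈ orthant (Fin m × Fin n))
    (h₁ : γ₁ ∈ orthant (Fin m × Fin n)) {a b : ℝ} (ha : 0 < a) (hb : 0 < b) (hab : a + b = 1) :
    tiltedRow w r s C₀ γ₀ ^ a * tiltedRow w r s C₁ γ₁ ^ b ≤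
      tiltedRow w r s (a • C₀ + b • C₁) (a • γ₀ + b • γ₁) := by
  have hpos : ∀ γ ∈ orthant (Fin m × Fin n), ∀ i,
      0 < ∑ j, scaleMatrix w γ i j * Real.exp (s j) := fun γ hγ i =>
    Finset.sum_pos (fun j _ => mul_pos (mul_pos (hw i j) (mem_orthant.1 hγ (i, j)))
      (Real.exp_pos _)) Finset.univ_nonempty
  have hlin : ∀ i, ∑ j, scaleMatrix w (a • γ₀ + b • γ₁) i j * Real.exp (s j) =
      a * ∑ j, scaleMatrix w γ₀ i j * Real.exp (s j) +
        b * ∑ j, scaleMatrix w γ₁ i j * Real.exp (s j) := by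
    intro i
    rw [Finset.mul_sum, Finset.mul_sum, ← Finset.sum_add_distrib]
    refine Finset.sum_congr rfl fun j _ => ?_
    simp only [scaleMatrix, Pi.add_apply, Pi.smul_apply, smul_eq_mul]
    ring
  have hC : -∑ j, (a • C₀ + b • C₁) j * s j =
      (-∑ j, C₀ j * s j) * a + (-∑ j, C₁ j * s j) * b := by
    simp only [Pi.add_apply, Pi.smul_apply, smul_eq_mul, add_mul, Finset.sum_add_distrib,
      mul_assoc, ← Finset.mul_sum]
    ring
  have hγ : -∑ p, (a • γ₀ + b • γ₁) p = (-∑ p, γ₀ p) * a + (-∑ p, γ₁ p) * b := by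
    simp only [Pi.add_apply, Pi.smul_apply, smul_eq_mul, Finset.sum_add_distrib,
      ← Finset.mul_sum]
    ring
  have hprod : (∏ i, (∑ j, scaleMatrix w γ₀ i j * Real.exp (s j)) ^ r i) ^ a *
      (∏ i, (∑ j, scaleMatrix w γ₁ i j * Real.exp (s j)) ^ r i) ^ b ≤
      ∏ i, (∑ j, scaleMatrix w (a • γ₀ + b • γ₁) i j * Real.exp (s j)) ^ r i := by
    rw [← Real.finsetProd_rpow _ _ fun i _ => pow_nonneg (hpos _ h₀ i).le _,
      ← Real.finsetProd_rpow _ _ fun i _ => pow_nonneg (hpos _ h₁ i).le _,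
      ← Finset.prod_mul_distrib]
    refine Finset.prod_le_prod (fun i _ => mul_nonneg
      (Real.rpow_nonneg (pow_nonneg (hpos _ h₀ i).le _) _)
      (Real.rpow_nonneg (pow_nonneg (hpos _ h₁ i).le _) _)) fun i _ => ?_
    rw [hlin, ← Real.rpow_natCast, ← Real.rpow_natCast, ← Real.rpow_mul (hpos _ h₀ i).le,
      ← Real.rpow_mul (hpos _ h₁ i).le, mul_comm _ a, mul_comm _ b,
      Real.rpow_mul (hpos _ h₀ i).le, Real.rpow_mul (hpos _ h₁ i).le, Real.rpow_natCast,
      Real.rpow_natCast, ← mul_pow]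
    exact pow_le_pow_left₀ (mul_nonneg (Real.rpow_nonneg (hpos _ h₀ i).le _)
      (Real.rpow_nonneg (hpos _ h₁ i).le _))
      (Real.geom_mean_le_arith_mean2_weighted ha.le hb.le (hpos _ h₀ i).le (hpos _ h₁ i).le hab) _
  have hp0 : 0 ≤ ∏ i, (∑ j, scaleMatrix w γ₀ i j * Real.exp (s j)) ^ r i :=
    Finset.prod_nonneg fun i _ => pow_nonneg (hpos _ h₀ i).le _
  have hp1 : 0 ≤ ∏ i, (∑ j, scaleMatrix w γ₁ i j * Real.exp (s j)) ^ r i :=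
    Finset.prod_nonneg fun i _ => pow_nonneg (hpos _ h₁ i).le _
  simp only [tiltedRow]
  rw [Real.mul_rpow (by positivity) (by positivity), Real.mul_rpow hp0 (by positivity),
    Real.mul_rpow (by positivity) (by positivity), Real.mul_rpow hp1 (by positivity),
    ← Real.exp_mul, ← Real.exp_mul, ← Real.exp_mul, ← Real.exp_mul, hC, hγ, Real.exp_add,
    Real.exp_add]
  refine le_trans (le_of_eq ?_) (mul_le_mul_of_nonneg_right hprod (by positivity :
    (0 : ℝ) ≤ Real.exp ((-∑ j, C₀ j * s j) * a) * Real.exp ((-∑ j, C₁ j * s j) * b) *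
      (Real.exp ((-∑ p, γ₀ p) * a) * Real.exp ((-∑ p, γ₁ p) * b)))) |>.trans (le_of_eq ?_)
  · ring
  · ring

/-- The capacity of the row polynomial of the rescaled matrix, as a density on the orthant. -/
noncomputable def capDensity (w : Fin m → Fin n → ℝ) (r : Fin m → ℕ) (C : Fin n → ℝ) :
    (Fin m × Fin n → ℝ) → ℝ≥0∞ :=
  (orthant (Fin m × Fin n)).indicator fun γ => ⨅ s, ENNReal.ofReal (tiltedRow w r s C γ)

theorem measurable_capDensity (w : Fin m → Fin n → ℝ) (r : Fin m → ℕ) (C : Fin n → ℝ) :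
    Measurable (capDensity w r C) := by
  refine Measurable.indicator ?_ (measurableSet_orthant _)
  refine (upperSemicontinuous_iInf fun s => Continuous.upperSemicontinuous ?_).measurable
  refine ENNReal.continuous_ofReal.comp ?_
  unfold tiltedRow scaleMatrix
  fun_prop

theorem capDensity_le {C : Fin n → ℝ} {γ : Fin m × Fin n → ℝ}
    (hγ : γ ∈ orthant (Fin m × Fin n)) (s : Fin n → ℝ) :
    capDensity w r C γ ≤ ENNReal.ofReal (tiltedRow w r s C γ) := by
  rw [capDensity, Set.indicator_of_mem hγ]
  exact iInf_le _ s

theorem capDensity_rpow_mul_le [NeZero n] (hw : ∀ i j, 0 < w i j) (C₀ C₁ : Fin n → ℝ)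
    (γ₀ γ₁ : Fin m × Fin n → ℝ) {a b : ℝ} (ha : 0 < a) (hb : 0 < b) (hab : a + b = 1) :
    capDensity w r C₀ γ₀ ^ a * capDensity w r C₁ γ₁ ^ b ≤
      capDensity w r (a • C₀ + b • C₁) (a • γ₀ + b • γ₁) := by
  by_cases h₀ : γ₀ ∈ orthant (Fin m × Fin n)
  swap
  · rw [capDensity, Set.indicator_of_notMem h₀, ENNReal.zero_rpow_of_pos ha, zero_mul]
    exact zero_le
  by_cases h₁ : γ₁ ∈ orthant (Fin m × Fin n)
  swap
  · rw [capDensity, capDensity, Set.indicator_of_notMem h₁, ENNReal.zero_rpow_of_pos hb, mul_zero]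
    exact zero_le
  have h₂ : a • γ₀ + b • γ₁ ∈ orthant (Fin m × Fin n) := mem_orthant.2 fun p => by
    have := mem_orthant.1 h₀ p
    have := mem_orthant.1 h₁ p
    simp only [Pi.add_apply, Pi.smul_apply, smul_eq_mul]
    positivity
  rw [capDensity.eq_1 w r (a • C₀ + b • C₁), Set.indicator_of_mem h₂]
  refine le_iInf fun s => ?_
  calc capDensity w r C₀ γ₀ ^ a * capDensity w r C₁ γ₁ ^ b
      ≤ ENNReal.ofReal (tiltedRow w r s C₀ γ₀) ^ a * ENNReal.ofReal (tiltedRow w r s C₁ γ₁) ^ b :=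
        mul_le_mul' (ENNReal.rpow_le_rpow (capDensity_le h₀ s) ha.le)
          (ENNReal.rpow_le_rpow (capDensity_le h₁ s) hb.le)
    _ = ENNReal.ofReal (tiltedRow w r s C₀ γ₀ ^ a * tiltedRow w r s C₁ γ₁ ^ b) := by
        rw [ENNReal.ofReal_rpow_of_pos (tiltedRow_pos hw s C₀ h₀),
          ENNReal.ofReal_rpow_of_pos (tiltedRow_pos hw s C₁ h₁), ← ENNReal.ofReal_mul
            (Real.rpow_nonneg (tiltedRow_pos hw s C₀ h₀).le _)]
    _ ≤ _ := ENNReal.ofReal_le_ofReal (tiltedRow_rpow_mul_le hw s C₀ C₁ h₀ h₁ ha hb hab)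

theorem tiltedRow_eq (w : Fin m → Fin n → ℝ) (r : Fin m → ℕ) (s C : Fin n → ℝ)
    (γ : Fin m × Fin n → ℝ) : tiltedRow w r s C γ =
      MvPolynomial.aeval (fun j => Real.exp (s j)) (rowPoly (scaleMatrix w γ) r) *
        Real.exp (-∑ j, C j * s j) * Real.exp (-∑ p, γ p) := by
  rw [aeval_rowPoly]; rfl

theorem exp_neg_sum_eq_inv_prod (c : Fin n → ℕ) (s : Fin n → ℝ) :
    Real.exp (-∑ j, (c j : ℝ) * s j) = (∏ j, Real.exp (s j) ^ c j)⁻¹ := by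
  rw [Real.exp_neg, Real.exp_sum]
  congr 1
  exact Finset.prod_congr rfl fun j _ => by rw [← Real.exp_nat_mul]

theorem lintegral_capDensity (C : Fin n → ℝ) :
    ∫⁻ γ, capDensity w r C γ = ∫⁻ γ in orthant (Fin m × Fin n), capDensity w r C γ := by
  rw [← lintegral_indicator (measurableSet_orthant _), capDensity, Set.indicator_indicator,
    Set.inter_self]

theorem lintegral_capDensity_lt_top (hw : ∀ i j, 0 ≤ w i j) (C : Fin n → ℝ) :
    ∫⁻ γ, capDensity w r C γ < ∞ := by
  rw [lintegral_capDensity]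
  refine lt_of_le_of_lt (setLIntegral_mono' (measurableSet_orthant _) fun γ hγ => ?_)
    ((lintegral_sum_multinomialWeight hw (Finset.Subset.refl (rowTables n r))).trans_lt
      ENNReal.ofReal_lt_top)
  refine (capDensity_le hγ 0).trans (le_of_eq ?_)
  rw [tiltedRow_eq, aeval_rowPoly_real]
  simp

theorem ofReal_tableSum_mul_le_lintegral_capDensity (hw : ∀ i j, 0 ≤ w i j) (α : Fin n → ℕ) :
    ENNReal.ofReal (tableSum w r α * ∏ i, ((r i).factorial : ℝ)) ≤
      ∫⁻ γ, capDensity w r (fun j => (α j : ℝ)) γ := by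
  rw [lintegral_capDensity, tableSum,
    ← lintegral_sum_multinomialWeight hw (Finset.filter_subset _ (rowTables n r))]
  refine setLIntegral_mono' (measurableSet_orthant _) fun γ hγ => ?_
  rw [capDensity, Set.indicator_of_mem hγ]
  refine le_iInf fun s => ENNReal.ofReal_le_ofReal ?_
  rw [tiltedRow_eq, exp_neg_sum_eq_inv_prod, ← coeff_rowPoly]
  refine mul_le_mul_of_nonneg_right ?_ (Real.exp_pos _).le
  rw [← div_eq_mul_inv, le_div_iff₀ (Finset.prod_pos fun j _ => pow_pos (Real.exp_pos _) _)]
  exact coeff_rowPoly_mul_le (fun i j => mul_nonneg (hw i j) (mem_orthant.1 hγ (i, j)).le) r α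
    fun j => Real.exp_pos _

theorem lintegral_capDensity_le_tableSum {n : ℕ} {w : Fin m → Fin (n + 1) → ℝ}
    (hw : ∀ i j, 0 < w i j) {c : Fin (n + 1) → ℕ}
    (hc : ∀ j, 0 < c j) (hrc : ∑ j, c j = ∑ i, r i) :
    ∫⁻ γ, capDensity w r (fun j => (c j : ℝ)) γ ≤
      ENNReal.ofReal (((∑ i, r i : ℕ) + 1 : ℝ) ^ n *
        (tableSum w r c * ∏ i, ((r i).factorial : ℝ))) := by
  rw [lintegral_capDensity, ENNReal.ofReal_mul (by positivity), tableSum,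
    ← lintegral_sum_multinomialWeight (fun i j => (hw i j).le)
      (Finset.filter_subset _ (rowTables (n + 1) r)),
    ← lintegral_const_mul' _ _ ENNReal.ofReal_ne_top]
  refine setLIntegral_mono' (measurableSet_orthant _) fun γ hγ => ?_
  have hsc : ∀ i j, 0 < scaleMatrix w γ i j := fun i j =>
    mul_pos (hw i j) (mem_orthant.1 hγ (i, j))
  rw [← ENNReal.ofReal_mul (by positivity), ← coeff_rowPoly, ← mul_assoc]
  have hfin : capDensity w r (fun j => (c j : ℝ)) γ ≠ ∞ :=
    ((capDensity_le hγ 0).trans_lt ENNReal.ofReal_lt_top).ne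
  rw [ENNReal.le_ofReal_iff_toReal_le hfin (mul_nonneg (mul_nonneg (by positivity)
    (coeff_rowPoly_nonneg (fun i j => (hsc i j).le) r _)) (Real.exp_pos _).le)]
  have key := (halfPlaneStable_rowPoly hsc r).le_coeff le_rfl (isHomogeneous_rowPoly _ r)
    (coeff_rowPoly_nonneg (fun i j => (hsc i j).le) r) c hc hrc
    (L := (capDensity w r (fun j => (c j : ℝ)) γ).toReal * Real.exp (∑ p, γ p)) (fun y hy => ?_)
  · rw [Real.exp_neg, ← div_eq_mul_inv, le_div_iff₀ (Real.exp_pos _)]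
    exact key
  · have h1 := capDensity_le (w := w) (r := r) (C := fun j => (c j : ℝ)) hγ
      (fun j => Real.log (y j))
    have hs : ∀ j, Real.exp (Real.log (y j)) = y j := fun j => Real.exp_log (hy j)
    have hpos := tiltedRow_pos (r := r) hw (fun j => Real.log (y j)) (fun j => (c j : ℝ)) hγ
    have h2 := ENNReal.toReal_le_of_le_ofReal hpos.le h1
    rw [tiltedRow_eq, exp_neg_sum_eq_inv_prod] at h2
    simp only [hs] at h2
    have hyp : 0 < ∏ j, y j ^ c j := Finset.prod_pos fun j _ => pow_pos (hy j) _
    rw [Real.exp_neg, ← div_eq_mul_inv, ← div_eq_mul_inv, le_div_iff₀ (Real.exp_pos _),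
      le_div_iff₀ hyp] at h2
    exact h2

end capacity

section bound

variable {m n : ℕ}

theorem exists_prod_completeHomog_le {w : Fin m → Fin (n + 1) → ℝ} (hw : ∀ i j, 0 < w i j)
    {r : Fin m → ℕ} {c : Fin (n + 1) → ℕ} (hc : ∀ j, 0 < c j) (hrc : ∑ j, c j = ∑ i, r i) :
    ∃ y : Fin (n + 1) → ℝ, (∀ j, 0 < y j) ∧
      ∏ i, completeHomog Finset.univ (fun j => w i j * y j) (r i) ≤
        ((∑ i, r i : ℕ) + 1 : ℝ) ^ (2 * n + 1) * tableSum w r c * ∏ j, y j ^ c j := by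
  set g : (Fin (n + 1) → ℝ) → ℝ := fun C => (∫⁻ γ, capDensity w r C γ).toReal with hg
  have hlt : ∀ C, ∫⁻ γ, capDensity w r C γ < ⊤ := fun C =>
    lintegral_capDensity_lt_top (fun i j => (hw i j).le) C
  set p : ℝ := ∏ i, ((r i).factorial : ℝ) with hp
  have hp0 : 0 < p := Finset.prod_pos fun i _ => by positivity
  have hN : 0 < ∑ i, r i := by
    rw [← hrc]
    exact Finset.sum_pos (fun j _ => hc j) Finset.univ_nonempty
  obtain ⟨y, hy, hle⟩ := exists_sum_le_card_mul (A := (rowTables (n + 1) r).image colSum)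
    (T := tableSum w r) (c := c) (N := ∑ i, r i) (g := g) (p := p)
    (fun α hα => tableSum_pos hw hα)
    (fun α hα => by
      obtain ⟨D, hD, rfl⟩ := Finset.mem_image.1 hα
      exact sum_colSum hD)
    hc hrc hN (single_mem_image_colSum r)
    (fun x y a b ha hb hab => by
      have h := prekopaLeindler_pi ha hb hab (measurable_capDensity w r x)
        (measurable_capDensity w r y) (measurable_capDensity w r (a • x + b • y))
        fun γ₀ γ₁ => capDensity_rpow_mul_le hw x y γ₀ γ₁ ha hb hab
      have h' := ENNReal.toReal_mono (hlt _).ne h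
      rwa [ENNReal.toReal_mul, ← ENNReal.toReal_rpow, ← ENNReal.toReal_rpow] at h')
    hp0
    (fun α _ => (ENNReal.ofReal_le_iff_le_toReal (hlt _).ne).1
      (ofReal_tableSum_mul_le_lintegral_capDensity (fun i j => (hw i j).le) α))
  refine ⟨y, hy, ?_⟩
  have hT : 0 ≤ tableSum w r c := Finset.sum_nonneg fun D _ =>
    Finset.prod_nonneg fun i _ => Finset.prod_nonneg fun j _ => pow_nonneg (hw i j).le _
  have hgc : g (fun j => (c j : ℝ)) ≤ ((∑ i, r i : ℕ) + 1 : ℝ) ^ n * (tableSum w r c * p) :=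
    ENNReal.toReal_le_of_le_ofReal (by positivity) (lintegral_capDensity_le_tableSum hw hc hrc)
  have hcard : ((((rowTables (n + 1) r).image colSum).card : ℕ) : ℝ) ≤
      ((∑ i, r i : ℕ) + 1 : ℝ) ^ (n + 1) := by
    exact_mod_cast card_image_colSum_le r
  rw [prod_completeHomog_eq]
  refine le_of_mul_le_mul_left (hle.trans ?_) hp0
  have hyp : 0 ≤ ∏ j, y j ^ c j := Finset.prod_nonneg fun j _ => pow_nonneg (hy j).le _
  calc _ ≤ ((∑ i, r i : ℕ) + 1 : ℝ) ^ (n + 1) *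
        (((∑ i, r i : ℕ) + 1 : ℝ) ^ n * (tableSum w r c * p)) * ∏ j, y j ^ c j := by
        gcongr
    _ = _ := by ring

/-- A lower bound for the weighted count in terms of any lower bound of the dual objective,
for positive weights. -/
theorem le_mul_tableSum_of_pos {w : Fin m → Fin (n + 1) → ℝ} (hw : ∀ i j, 0 < w i j)
    {r : Fin m → ℕ} {c : Fin (n + 1) → ℕ} (hr : ∀ i, 0 < r i) (hc : ∀ j, 0 < c j)
    (hrc : ∑ j, c j = ∑ i, r i) {ρ : ℝ}
    (hρ : ∀ (x : Fin m → ℝ) (y : Fin (n + 1) → ℝ), (∀ i, 0 < x i) → (∀ j, 0 < y j) →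
      (∀ i j, w i j * x i * y j < 1) →
      ρ ≤ (∏ i, x i ^ (-(r i : ℤ))) * (∏ j, y j ^ (-(c j : ℤ))) *
        (∏ i, ∏ j, (1 - w i j * x i * y j)⁻¹)) :
    ρ ≤ (∏ i, (Real.exp 1 * ((r i : ℝ) + 1))) *
      (((∑ i, r i : ℕ) + 1 : ℝ) ^ (2 * n + 1) * tableSum w r c) := by
  obtain ⟨y, hy, hle⟩ := exists_prod_completeHomog_le hw hc hrc
  have hv : ∀ i j, 0 < w i j * y j := fun i j => mul_pos (hw i j) (hy j)
  choose x hx hx1 hxle using fun i => exists_prod_inv_le_completeHomog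
    (v := fun j => w i j * y j) (hv i) Finset.univ_nonempty (hr i)
  have hsw : ∀ i j, w i j * x i * y j = w i j * y j * x i := fun i j => by ring
  refine (hρ x y hx hy fun i j => by rw [hsw]; exact hx1 i j (Finset.mem_univ j)).trans ?_
  simp only [hsw]
  have hyp : 0 < ∏ j, y j ^ c j := Finset.prod_pos fun j _ => pow_pos (hy j) _
  have hyz : ∏ j, y j ^ (-(c j : ℤ)) = (∏ j, y j ^ c j)⁻¹ := by
    rw [← Finset.prod_inv_distrib]
    exact Finset.prod_congr rfl fun j _ => by rw [zpow_neg, zpow_natCast]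
  have hrow : ∏ i, (x i ^ (-(r i : ℤ)) * ∏ j, (1 - w i j * y j * x i)⁻¹) ≤
      ∏ i, (Real.exp 1 * ((r i : ℝ) + 1) *
        completeHomog Finset.univ (fun j => w i j * y j) (r i)) :=
    Finset.prod_le_prod (fun i _ => mul_nonneg (zpow_nonneg (hx i).le _)
      (Finset.prod_nonneg fun j _ => inv_nonneg.2 (sub_nonneg.2 (hx1 i j (Finset.mem_univ j)).le)))
      fun i _ => hxle i
  rw [Finset.prod_mul_distrib, Finset.prod_mul_distrib] at hrow
  rw [hyz, mul_right_comm, ← div_eq_mul_inv, div_le_iff₀ hyp]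
  refine hrow.trans ((mul_le_mul_of_nonneg_left hle
    (Finset.prod_nonneg fun i _ => by positivity)).trans (le_of_eq ?_))
  ring

theorem continuous_tableSum (r : Fin m → ℕ) (c : Fin n → ℕ) :
    Continuous fun w : Fin m → Fin n → ℝ => tableSum w r c := by
  unfold tableSum
  fun_prop

/-- A lower bound for the weighted count in terms of any nonnegative lower bound of the dual
objective. -/
theorem le_mul_tableSum {w : Fin m → Fin (n + 1) → ℝ} (hw : ∀ i j, 0 ≤ w i j)
    {r : Fin m → ℕ} {c : Fin (n + 1) → ℕ} (hr : ∀ i, 0 < r i) (hc : ∀ j, 0 < c j)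
    (hrc : ∑ j, c j = ∑ i, r i) {ρ : ℝ}
    (hρ : ∀ (x : Fin m → ℝ) (y : Fin (n + 1) → ℝ), (∀ i, 0 < x i) → (∀ j, 0 < y j) →
      (∀ i j, w i j * x i * y j < 1) →
      ρ ≤ (∏ i, x i ^ (-(r i : ℤ))) * (∏ j, y j ^ (-(c j : ℤ))) *
        (∏ i, ∏ j, (1 - w i j * x i * y j)⁻¹)) :
    ρ ≤ (∏ i, (Real.exp 1 * ((r i : ℝ) + 1))) *
      (((∑ i, r i : ℕ) + 1 : ℝ) ^ (2 * n + 1) * tableSum w r c) := by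
  have hcont : Continuous fun ε : ℝ => (∏ i, (Real.exp 1 * ((r i : ℝ) + 1))) *
      (((∑ i, r i : ℕ) + 1 : ℝ) ^ (2 * n + 1) * tableSum (fun i j => w i j + ε) r c) :=
    continuous_const.mul (continuous_const.mul ((continuous_tableSum r c).comp (by fun_prop)))
  have hlim := (hcont.tendsto 0).mono_left (nhdsWithin_le_nhds (s := Set.Ioi (0 : ℝ)))
  simp only [add_zero] at hlim
  refine ge_of_tendsto hlim (Filter.eventually_of_mem self_mem_nhdsWithin fun ε hε => ?_)
  have hε0 : (0 : ℝ) < ε := hε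
  refine le_mul_tableSum_of_pos (fun i j => add_pos_of_nonneg_of_pos (hw i j) hε0) hr hc hrc
    fun x y hx hy h => ?_
  have hmono : ∀ i j, w i j * x i * y j ≤ (w i j + ε) * x i * y j := fun i j => by
    have := hx i
    have := hy j
    gcongr
    linarith
  refine (hρ x y hx hy fun i j => (hmono i j).trans_lt (h i j)).trans ?_
  refine mul_le_mul_of_nonneg_left ?_ (mul_nonneg
    (Finset.prod_nonneg fun i _ => zpow_nonneg (hx i).le _)
    (Finset.prod_nonneg fun j _ => zpow_nonneg (hy j).le _))
  have hinv : ∀ i j, (1 - w i j * x i * y j)⁻¹ ≤ (1 - (w i j + ε) * x i * y j)⁻¹ := fun i j =>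
    inv_anti₀ (sub_pos.2 (h i j)) (sub_le_sub_left (hmono i j) 1)
  have hnn : ∀ i j, 0 ≤ (1 - w i j * x i * y j)⁻¹ := fun i j =>
    inv_nonneg.2 (sub_nonneg.2 ((hmono i j).trans (h i j).le))
  exact Finset.prod_le_prod (fun i _ => Finset.prod_nonneg fun j _ => hnn i j) fun i _ =>
    Finset.prod_le_prod (fun j _ => hnn i j) fun j _ => hinv i j

theorem tsum_eq_tableSum (w : Fin m → Fin n → ℝ) (r : Fin m → ℕ) (c : Fin n → ℕ) :
    (∑' D : {D : Matrix (Fin m) (Fin n) ℕ //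
        (∀ i, ∑ j, D i j = r i) ∧ (∀ j, ∑ i, D i j = c j)},
        ∏ i, ∏ j, w i j ^ ((D : Matrix (Fin m) (Fin n) ℕ) i j)) = tableSum w r c := by
  have h : {D : Fin m → Fin n → ℕ | (∀ i, ∑ j, D i j = r i) ∧ (∀ j, ∑ i, D i j = c j)} =
      ((rowTables n r).filter fun D => colSum D = c : Finset (Fin m → Fin n → ℕ)) := by
    ext D
    simp [mem_rowTables, colSum, funext_iff]
  change ∑' D : ({D : Fin m → Fin n → ℕ |
      (∀ i, ∑ j, D i j = r i) ∧ (∀ j, ∑ i, D i j = c j)} : Set (Fin m → Fin n → ℕ)),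
      ∏ i, ∏ j, w i j ^ ((D : Fin m → Fin n → ℕ) i j) = _
  rw [h]
  exact Finset.tsum_subtype ((rowTables n r).filter fun D => colSum D = c)
    fun D : Fin m → Fin n → ℕ => ∏ i, ∏ j, w i j ^ D i j

end bound

theorem factorial_mul_exp_le (N : ℕ) (hN : 0 < N) :
    (N.factorial : ℝ) * Real.exp N ≤ Real.exp 1 * N * (N : ℝ) ^ N := by
  induction N, hN using Nat.le_induction with
  | base => simp
  | succ k hk ih =>
    have hk0 : (0 : ℝ) < k := by exact_mod_cast hk
    have h1 : (k : ℝ) / (k + 1) ≤ Real.exp (-(1 / (k + 1))) := by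
      have h := Real.add_one_le_exp (-(1 / ((k : ℝ) + 1)))
      refine le_trans (le_of_eq ?_) h
      field_simp
      ring
    have h2 : ((k : ℝ) / (k + 1)) ^ (k + 1) ≤ (Real.exp 1)⁻¹ := by
      refine (pow_le_pow_left₀ (by positivity) h1 _).trans (le_of_eq ?_)
      rw [← Real.exp_nat_mul, ← Real.exp_neg]
      congr 1
      push_cast
      field_simp
    have h3 : Real.exp 1 * (k : ℝ) ^ (k + 1) ≤ ((k : ℝ) + 1) ^ (k + 1) := by
      rw [div_pow, div_le_iff₀ (by positivity), inv_mul_eq_div, le_div_iff₀ (Real.exp_pos 1)] at h2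
      linarith
    rw [Nat.factorial_succ]
    push_cast
    rw [Real.exp_add]
    calc ((k : ℝ) + 1) * k.factorial * (Real.exp k * Real.exp 1)
        = ((k + 1) * Real.exp 1) * (k.factorial * Real.exp k) := by ring
      _ ≤ ((k + 1) * Real.exp 1) * (Real.exp 1 * k * (k : ℝ) ^ k) := by gcongr
      _ = (Real.exp 1 * (k + 1)) * (Real.exp 1 * (k : ℝ) ^ (k + 1)) := by ring
      _ ≤ (Real.exp 1 * (k + 1)) * ((k : ℝ) + 1) ^ (k + 1) := by gcongr

theorem factorial_div_pow_le (N : ℕ) (hN : 0 < N) :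
    (N.factorial : ℝ) / (N : ℝ) ^ N ≤ Real.exp 1 * N / Real.exp N := by
  have : (0 : ℝ) < N := by exact_mod_cast hN
  rw [div_le_div_iff₀ (by positivity) (Real.exp_pos _)]
  exact factorial_mul_exp_le N hN

theorem pow_self_div_factorial_le_exp (k : ℕ) : (k : ℝ) ^ k / k.factorial ≤ Real.exp k :=
  Real.pow_div_factorial_le_exp _ (Nat.cast_nonneg k) k

theorem prod_pow_self_div_factorial_le_exp {ι : Type*} [Fintype ι] (r : ι → ℕ) :
    ∏ i, (r i : ℝ) ^ r i / (r i).factorial ≤ Real.exp (∑ i, r i : ℕ) := by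
  push_cast
  rw [Real.exp_sum]
  exact Finset.prod_le_prod (fun i _ => by positivity) fun i _ => pow_self_div_factorial_le_exp _

theorem factorial_ratio_le {N K : ℕ} (hN : 0 < N) :
    (N.factorial : ℝ) * (N + K).factorial * (K : ℝ) ^ K /
        ((N : ℝ) ^ N * ((N : ℝ) + K) ^ (N + K) * K.factorial) ≤
      Real.exp 1 ^ 2 * N * (N + K) / Real.exp N ^ 2 := by
  have h1 := factorial_div_pow_le N hN
  have h2 := factorial_div_pow_le (N + K) (by omega)
  have h3 := pow_self_div_factorial_le_exp K
  push_cast at h2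
  calc _ = ((N.factorial : ℝ) / (N : ℝ) ^ N) *
        (((N + K).factorial : ℝ) / ((N : ℝ) + K) ^ (N + K)) * ((K : ℝ) ^ K / K.factorial) := by
        rw [div_mul_div_comm, div_mul_div_comm]
    _ ≤ (Real.exp 1 * N / Real.exp N) * (Real.exp 1 * (N + K) / Real.exp (N + K)) *
        Real.exp K := by gcongr
    _ = _ := by
        rw [Real.exp_add]
        have := Real.exp_pos (N : ℝ)
        have := Real.exp_pos (K : ℝ)
        field_simp

theorem gamma_half_le (k : ℕ) (hk : 4 ≤ k) :
    Real.Gamma ((k : ℝ) / 2) ≤ (k : ℝ) ^ (k - 1) := by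
  have hk' : (4 : ℝ) ≤ k := by exact_mod_cast hk
  have h1 : Real.Gamma ((k : ℝ) / 2) ≤ Real.Gamma (k : ℝ) :=
    Real.Gamma_strictMonoOn_Ici.monotoneOn (Set.mem_Ici.2 (by linarith))
      (Set.mem_Ici.2 (by linarith)) (by linarith)
  refine h1.trans ?_
  have h2 : Real.Gamma (k : ℝ) = ((k - 1).factorial : ℝ) := by
    rw [← Real.Gamma_nat_eq_factorial]
    congr 1
    exact_mod_cast (by omega : k = k - 1 + 1)
  rw [h2]
  calc ((k - 1).factorial : ℝ) ≤ ((k - 1 : ℕ) : ℝ) ^ (k - 1) := by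
        exact_mod_cast Nat.factorial_le_pow (k - 1)
    _ ≤ _ := by
        gcongr
        omega

theorem prod_exp_mul_add_one_le {m : ℕ} (r : Fin m → ℕ) :
    ∏ i, (Real.exp 1 * ((r i : ℝ) + 1)) ≤
      Real.exp 1 ^ m * ((∑ i, r i : ℕ) + 1 : ℝ) ^ m := by
  rw [← mul_pow]
  refine (Finset.prod_le_prod (g := fun _ => Real.exp 1 * ((∑ i, r i : ℕ) + 1 : ℝ))
    (fun i _ => by positivity) fun i _ => ?_).trans (by simp)
  have : r i ≤ ∑ i, r i := Finset.single_le_sum (fun _ _ => Nat.zero_le _) (Finset.mem_univ i)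
  gcongr

theorem gamma_mul_exp_mul_pow_le_one {m n : ℕ} (hm : 1 < m) (hn : 1 < n) (hmn : 10 ≤ m + n) :
    Real.Gamma (((m : ℝ) + n) / 2) * Real.exp 1 ^ m *
      (2 / ((m : ℝ) * n) ^ 2) ^ (m + n - 1) ≤ 1 := by
  have hG := gamma_half_le (m + n) (by omega)
  have hm' : (2 : ℝ) ≤ m := by exact_mod_cast hm
  have hn' : (2 : ℝ) ≤ n := by exact_mod_cast hn
  have hmn' : (10 : ℝ) ≤ m + n := by exact_mod_cast hmn
  have hK : (m : ℝ) + n ≤ m * n := by nlinarith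
  push_cast at hG
  have he : Real.exp 1 ^ m ≤ 3 ^ (m + n - 1) :=
    (pow_le_pow_left₀ (Real.exp_pos 1).le Real.exp_one_lt_three.le m).trans
      (pow_le_pow_right₀ (by norm_num) (by omega))
  calc _ ≤ ((m : ℝ) + n) ^ (m + n - 1) * 3 ^ (m + n - 1) *
        (2 / ((m : ℝ) + n) ^ 2) ^ (m + n - 1) := by gcongr
    _ = (6 / ((m : ℝ) + n)) ^ (m + n - 1) := by
        rw [← mul_pow, ← mul_pow]
        congr 1
        field_simp
        norm_num
    _ ≤ 1 := pow_le_one₀ (by positivity) ((div_le_one (by positivity)).2 (by linarith))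

theorem constant_mul_le_one {m n N : ℕ} (hm : 1 < m) (hn : 1 < n) (hmn : 10 ≤ m + n)
    {r : Fin m → ℕ} {c : Fin n → ℕ} (hN : 0 < N)
    (hrN : ∑ i, r i = N) (hcN : ∑ j, c j = N) :
    (Real.Gamma (((m : ℝ) + n) / 2) /
          (2 * Real.exp 5 * Real.pi ^ (((m : ℝ) + n - 2) / 2) * m * n * ((N : ℝ) + m * n))) *
        (2 / (((m : ℝ) * n) ^ 2 * ((N : ℝ) + 1) * ((N : ℝ) + m * n))) ^ (m + n - 1) *
        (∏ i, (r i : ℝ) ^ (r i) / (Nat.factorial (r i) : ℝ)) *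
        (∏ j, (c j : ℝ) ^ (c j) / (Nat.factorial (c j) : ℝ)) *
        ((Nat.factorial N : ℝ) * (Nat.factorial (N + m * n) : ℝ) * ((m : ℝ) * n) ^ (m * n) /
          ((N : ℝ) ^ N * ((N : ℝ) + m * n) ^ (N + m * n) * (Nat.factorial (m * n) : ℝ))) *
        ((∏ i, (Real.exp 1 * ((r i : ℝ) + 1))) * ((N : ℝ) + 1) ^ (2 * (n - 1) + 1)) ≤ 1 := by
  have hm' : (2 : ℝ) ≤ m := by exact_mod_cast hm
  have hn' : (2 : ℝ) ≤ n := by exact_mod_cast hn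
  have hN' : (1 : ℝ) ≤ N := by exact_mod_cast hN
  have hK : (1 : ℝ) ≤ m * n := by nlinarith
  have hr := prod_pow_self_div_factorial_le_exp r
  have hc := prod_pow_self_div_factorial_le_exp c
  have hF := factorial_ratio_le (K := m * n) hN
  have hM := prod_exp_mul_add_one_le r
  have hG := gamma_mul_exp_mul_pow_le_one hm hn hmn
  rw [hrN] at hr hM
  rw [hcN] at hc
  push_cast at hF
  set G := Real.Gamma (((m : ℝ) + n) / 2)
  have hG0 : 0 ≤ G := Real.Gamma_nonneg_of_nonneg (by positivity)
  have hpi : (1 : ℝ) ≤ Real.pi ^ (((m : ℝ) + n - 2) / 2) :=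
    Real.one_le_rpow (by linarith [Real.pi_gt_three]) (by linarith)
  have hpre : Real.exp 1 ^ 2 * ((N : ℝ) + m * n) ≤
      2 * Real.exp 5 * Real.pi ^ (((m : ℝ) + n - 2) / 2) * m * n * ((N : ℝ) + m * n) := by
    have he : Real.exp 1 ^ 2 ≤ Real.exp 5 := by
      rw [← Real.exp_nat_mul]
      exact Real.exp_le_exp.2 (by norm_num)
    gcongr
    have h5 := Real.exp_pos 5
    calc Real.exp 1 ^ 2 ≤ 1 * Real.exp 5 * 1 * 1 := by linarith
      _ ≤ 2 * Real.exp 5 * Real.pi ^ (((m : ℝ) + n - 2) / 2) * (m * n) := by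
        gcongr
        norm_num
      _ = _ := by ring
  have hdec : (2 / (((m : ℝ) * n) ^ 2 * ((N : ℝ) + 1) * ((N : ℝ) + m * n))) ≤
      2 / ((m : ℝ) * n) ^ 2 * (1 / ((N : ℝ) + 1) ^ 2) := by
    rw [div_mul_div_comm, mul_one, pow_two ((N : ℝ) + 1), mul_assoc (((m : ℝ) * n) ^ 2)]
    gcongr
  have hNpow : (N : ℝ) * ((N : ℝ) + 1) ^ m * ((N : ℝ) + 1) ^ (2 * (n - 1) + 1) *
      (1 / ((N : ℝ) + 1) ^ 2) ^ (m + n - 1) ≤ 1 := by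
    rw [one_div, inv_pow, ← div_eq_mul_inv, div_le_one (by positivity), ← pow_mul]
    calc _ ≤ ((N : ℝ) + 1) * ((N : ℝ) + 1) ^ m * ((N : ℝ) + 1) ^ (2 * (n - 1) + 1) := by
          gcongr
          linarith
      _ = ((N : ℝ) + 1) ^ (m + 2 * n) := by
          rw [← pow_succ', ← pow_add]
          congr 1
          omega
      _ ≤ _ := pow_le_pow_right₀ (by linarith) (by omega)
  calc _ ≤ (G / (Real.exp 1 ^ 2 * ((N : ℝ) + m * n))) *
        (2 / ((m : ℝ) * n) ^ 2 * (1 / ((N : ℝ) + 1) ^ 2)) ^ (m + n - 1) *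
        Real.exp N * Real.exp N *
        (Real.exp 1 ^ 2 * N * (N + m * n) / Real.exp N ^ 2) *
        (Real.exp 1 ^ m * ((N : ℝ) + 1) ^ m * ((N : ℝ) + 1) ^ (2 * (n - 1) + 1)) := by
        gcongr
    _ = (G * Real.exp 1 ^ m * (2 / ((m : ℝ) * n) ^ 2) ^ (m + n - 1)) *
        ((N : ℝ) * ((N : ℝ) + 1) ^ m * ((N : ℝ) + 1) ^ (2 * (n - 1) + 1) *
          (1 / ((N : ℝ) + 1) ^ 2) ^ (m + n - 1)) := by
        rw [mul_pow]
        have hE := (Real.exp_pos (N : ℝ)).ne'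
        have hE1 := (Real.exp_pos (1 : ℝ)).ne'
        have hP : (N : ℝ) + m * n ≠ 0 := by positivity
        generalize (2 / ((m : ℝ) * n) ^ 2) ^ (m + n - 1) = u
        generalize (1 / ((N : ℝ) + 1) ^ 2) ^ (m + n - 1) = v
        field_simp
    _ ≤ 1 := mul_le_one₀ hG (by positivity) hNpow

/-- Explicit lower bound for the weighted count `T(R,C;W)` in terms of
`ρ(R,C;W)`, valid when `m + n ≥ 10`. -/
theorem weighted_count_lower_bound
    (m n N : ℕ) (hm : 1 < m) (hn : 1 < n) (hmn : 10 ≤ m + n)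
    (r : Fin m → ℕ) (c : Fin n → ℕ)
    (hr : ∀ i, 0 < r i) (hc : ∀ j, 0 < c j)
    (hrN : ∑ i, r i = N) (hcN : ∑ j, c j = N)
    (w : Fin m → Fin n → ℝ) (hw : ∀ i j, 0 ≤ w i j)
    (ρ : ℝ)
    (hρ : IsGLB {z : ℝ | ∃ (x : Fin m → ℝ) (y : Fin n → ℝ),
      (∀ i, 0 < x i) ∧ (∀ j, 0 < y j) ∧ (∀ i j, w i j * x i * y j < 1) ∧
      (∏ i, x i ^ (-(r i : ℤ))) * (∏ j, y j ^ (-(c j : ℤ))) *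
        (∏ i, ∏ j, (1 - w i j * x i * y j)⁻¹) = z} ρ) :
    (∑' D : {D : Matrix (Fin m) (Fin n) ℕ //
        (∀ i, ∑ j, D i j = r i) ∧ (∀ j, ∑ i, D i j = c j)},
        ∏ i, ∏ j, w i j ^ ((D : Matrix (Fin m) (Fin n) ℕ) i j)) ≥
      (Real.Gamma (((m : ℝ) + n) / 2) /
          (2 * Real.exp 5 * Real.pi ^ (((m : ℝ) + n - 2) / 2) * m * n * ((N : ℝ) + m * n))) *
        (2 / (((m : ℝ) * n) ^ 2 * ((N : ℝ) + 1) * ((N : ℝ) + m * n))) ^ (m + n - 1) *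
        (∏ i, (r i : ℝ) ^ (r i) / (Nat.factorial (r i) : ℝ)) *
        (∏ j, (c j : ℝ) ^ (c j) / (Nat.factorial (c j) : ℝ)) *
        ((Nat.factorial N : ℝ) * (Nat.factorial (N + m * n) : ℝ) * ((m : ℝ) * n) ^ (m * n) /
          ((N : ℝ) ^ N * ((N : ℝ) + m * n) ^ (N + m * n) * (Nat.factorial (m * n) : ℝ))) *
        ρ := by
  obtain ⟨k, rfl⟩ : ∃ k, n = k + 1 := ⟨n - 1, by omega⟩
  have hN : 0 < N := by
    rw [← hcN]
    exact Finset.sum_pos (fun j _ => hc j) Finset.univ_nonempty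
  have hρ0 : 0 ≤ ρ := by
    refine hρ.2 ?_
    rintro z ⟨x, y, hx, hy, hxy, rfl⟩
    exact mul_nonneg (mul_nonneg (Finset.prod_nonneg fun i _ => zpow_nonneg (hx i).le _)
      (Finset.prod_nonneg fun j _ => zpow_nonneg (hy j).le _))
      (Finset.prod_nonneg fun i _ => Finset.prod_nonneg fun j _ =>
        inv_nonneg.2 (sub_nonneg.2 (hxy i j).le))
  have hle := le_mul_tableSum hw hr hc (hcN.trans hrN.symm) (ρ := ρ)
    fun x y hx hy hxy => hρ.1 ⟨x, y, hx, hy, hxy, rfl⟩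
  have hconst := constant_mul_le_one hm hn hmn hN hrN hcN
  rw [tsum_eq_tableSum, ge_iff_le]
  have hT : 0 ≤ tableSum w r c := Finset.sum_nonneg fun D _ =>
    Finset.prod_nonneg fun i _ => Finset.prod_nonneg fun j _ => pow_nonneg (hw i j) _
  rw [hrN, ← mul_assoc] at hle
  refine (mul_le_mul_of_nonneg_left hle ?_).trans ?_
  · have hG : 0 ≤ Real.Gamma (((m : ℝ) + (k + 1 : ℕ)) / 2) :=
      Real.Gamma_nonneg_of_nonneg (by positivity)
    have := Real.pi_pos
    positivity
  · rw [← mul_assoc]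
    exact mul_le_of_le_one_left hT hconst
end

section
/- Let m, n > 1 be integers, let R = (r_1, …, r_m) and C = (c_1, …, c_n) be positive integer vectors with r_1 + … + r_m = c_1 + … + c_n = N, let P(R, C) be the transportation polytope, and let W = (w_{ij}) be an m × n matrix with strictly positive real entries. Define g(X; W) = Σ_{i,j} [(x_{ij}+1) ln(x_{ij}+1) − x_{ij} ln x_{ij} + x_{ij} ln w_{ij}] for nonnegative matrices X = (x_{ij}). Then: (a) g(·; W) is strictly concave on P(R, C) and attains its maximum on P(R, C) at a unique matrix Z = (z_{ij}), and all entries z_{ij} are strictly positive; (b) there exist positive numbers ξ_1, …, ξ_m and η_1, …, η_n with w_{ij} ξ_i η_j < 1 for all i, j such that z_{ij} = w_{ij} ξ_i η_j / (1 − w_{ij} ξ_i η_j) for all i, j, the infimum ρ(R, C; W) of F(·, ·; W) is attained at x* = (ξ_1, …, ξ_m), y* = (η_1, …, η_n), and ρ(R, C; W) = F(x*, y*; W) = exp{g(Z; W)}. -/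
open Finset Real

/-- The entropy of the geometric distribution of mean `z` is strictly concave in `z ≥ 0`. -/
theorem strictConcaveOn_geometricEntropy :
    StrictConcaveOn ℝ (Set.Ici (0 : ℝ)) fun z => (z + 1) * log (z + 1) - z * log z := by
  have hderiv : ∀ z : ℝ, 0 < z →
      HasDerivAt (fun z => (z + 1) * log (z + 1) - z * log z) (log (z + 1) - log z) z := by
    intro z hz
    have h1 : HasDerivAt (fun z : ℝ => (z + 1) * log (z + 1)) (log (z + 1) + 1) z :=
      HasDerivAt.comp_add_const z 1 (hasDerivAt_mul_log (by positivity))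
    exact (h1.sub (hasDerivAt_mul_log hz.ne')).congr_deriv (by ring)
  refine StrictAntiOn.strictConcaveOn_of_deriv (convex_Ici 0) ?_ ?_
  · exact ((continuous_mul_log.comp (continuous_add_const 1)).sub
      continuous_mul_log).continuousOn
  · rw [interior_Ici]
    intro y hy z hz hyz
    have hy0 : 0 < y := hy
    have hz0 : 0 < z := hz
    rw [(hderiv y hy0).deriv, (hderiv z hz0).deriv, ← log_div (by positivity) hz0.ne',
      ← log_div (by positivity) hy0.ne']
    apply log_lt_log (by positivity)
    rw [div_lt_div_iff₀ hz0 hy0]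
    nlinarith

/-- The Fenchel inequality for the entropy of the geometric distribution. -/
theorem geometricEntropy_le {z t : ℝ} (hz : 0 ≤ z) (ht0 : 0 < t) (ht1 : t < 1) :
    (z + 1) * log (z + 1) - z * log z ≤ -(z * log t) - log (1 - t) := by
  have ht : 0 < 1 - t := by linarith
  rcases hz.eq_or_lt with rfl | hz
  · have := log_le_sub_one_of_pos ht
    simp
    linarith
  · have h1 := log_le_sub_one_of_pos (show 0 < t * (z + 1) / z by positivity)
    have h2 := log_le_sub_one_of_pos (show 0 < (1 - t) * (z + 1) by positivity)
    rw [log_div (by positivity) hz.ne', log_mul ht0.ne' (by positivity)] at h1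
    rw [log_mul ht.ne' (by positivity)] at h2
    have h3 := mul_le_mul_of_nonneg_left h1 hz.le
    have h4 : z * (t * (z + 1) / z - 1) = t * (z + 1) - z := by field_simp
    rw [h4] at h3
    linarith

/-- Equality case of `geometricEntropy_le`. -/
theorem geometricEntropy_eq {t : ℝ} (ht0 : 0 < t) (ht1 : t < 1) :
    (t / (1 - t) + 1) * log (t / (1 - t) + 1) - t / (1 - t) * log (t / (1 - t)) =
      -(t / (1 - t) * log t) - log (1 - t) := by
  have ht : 0 < 1 - t := by linarith
  have h : t / (1 - t) + 1 = (1 - t)⁻¹ := by field_simp; ring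
  rw [log_div ht0.ne' ht.ne', h, log_inv]
  field_simp
  ring

/-- A matrix with positive entries can be replaced by one with the same row and column sums
whose entries `t / (1 - t)` come from a product form `t = exp (a i + b j + L i j)`. -/
theorem exists_scaling_same_marginals {ι κ : Type*} [Fintype ι] [Fintype κ] [Nonempty ι]
    [Nonempty κ] (Y L : ι → κ → ℝ) (hY : ∀ i j, 0 < Y i j) :
    ∃ (a : ι → ℝ) (b : κ → ℝ), (∀ i j, a i + b j + L i j < 0) ∧
      (∀ i, ∑ j, exp (a i + b j + L i j) / (1 - exp (a i + b j + L i j)) = ∑ j, Y i j) ∧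
      (∀ j, ∑ i, exp (a i + b j + L i j) / (1 - exp (a i + b j + L i j)) = ∑ i, Y i j) := by
  classical
  obtain ⟨i₀⟩ := ‹Nonempty ι›
  obtain ⟨j₀⟩ := ‹Nonempty κ›
  let f : ι → κ → ℝ → ℝ := fun i j s => Y i j * s - log (1 - exp (-s))
  let S : (ι → ℝ) × (κ → ℝ) → ι → κ → ℝ := fun p i j => -(p.1 i + p.2 j + L i j)
  let φ : (ι → ℝ) × (κ → ℝ) → ℝ := fun p => ∑ i, ∑ j, f i j (S p i j)
  have hexp : ∀ s : ℝ, 0 < s → 0 < 1 - exp (-s) := fun s hs => by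
    have : exp (-s) < 1 := exp_lt_one_iff.2 (by linarith)
    linarith
  have hlog : ∀ s : ℝ, 0 < s → log (1 - exp (-s)) ≤ 0 := fun s hs =>
    log_nonpos (hexp s hs).le (by linarith [exp_pos (-s)])
  have hf0 : ∀ i j s, 0 < s → 0 ≤ f i j s := fun i j s hs => by
    have := hlog s hs
    have := mul_pos (hY i j) hs
    simp only [f]
    linarith
  have hφ : ∀ p, (∀ i j, 0 < S p i j) → ∀ i j, f i j (S p i j) ≤ φ p := fun p hp i j =>
    (single_le_sum (f := fun j => f i j (S p i j)) (fun j _ => hf0 i j _ (hp i j))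
      (mem_univ j)).trans
      (single_le_sum (f := fun i => ∑ j, f i j (S p i j))
        (fun i _ => sum_nonneg fun j _ => hf0 i j _ (hp i j)) (mem_univ i))
  let p₀ : (ι → ℝ) × (κ → ℝ) := (0, fun _ => -(1 + ∑ i, ∑ j, |L i j|))
  have hp₀ : ∀ i j, 0 < S p₀ i j := fun i j => by
    have h : |L i j| ≤ ∑ i, ∑ j, |L i j| :=
      (single_le_sum (f := fun j => |L i j|) (fun j _ => abs_nonneg _) (mem_univ j)).trans
        (single_le_sum (f := fun i => ∑ j, |L i j|)
          (fun i _ => sum_nonneg fun j _ => abs_nonneg _) (mem_univ i))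
    have := le_abs_self (L i j)
    simp only [S, p₀, Pi.zero_apply]
    linarith
  let K : Set ((ι → ℝ) × (κ → ℝ)) :=
    {p | p.1 i₀ = 0 ∧ ∀ i j, exp (-φ p₀) ≤ S p i j ∧ S p i j ≤ φ p₀ / Y i j}
  have hmemK : ∀ p, p.1 i₀ = 0 → (∀ i j, 0 < S p i j) → φ p ≤ φ p₀ → p ∈ K := by
    intro p hp hpos hle
    refine ⟨hp, fun i j => ?_⟩
    have h1 := (hφ p hpos i j).trans hle
    have h2 := hlog _ (hpos i j)
    have h3 := mul_pos (hY i j) (hpos i j)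
    simp only [f] at h1
    constructor
    · have h4 : exp (-φ p₀) ≤ 1 - exp (-S p i j) := by
        rw [← le_log_iff_exp_le (hexp _ (hpos i j))]
        linarith
      have := add_one_le_exp (-S p i j)
      linarith
    · rw [le_div_iff₀ (hY i j)]
      linarith
  have hS : ∀ i j, Continuous fun p => S p i j := fun i j => by
    simp only [S]
    fun_prop
  have hKclosed : IsClosed K := by
    have : K = {p | p.1 i₀ = 0} ∩
        ⋂ i, ⋂ j, {p | exp (-φ p₀) ≤ S p i j} ∩ {p | S p i j ≤ φ p₀ / Y i j} := by
      ext p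
      simp [K]
    rw [this]
    refine (isClosed_eq (by fun_prop) continuous_const).inter
      (isClosed_iInter fun i => isClosed_iInter fun j => ?_)
    exact (isClosed_le continuous_const (hS i j)).inter (isClosed_le (hS i j) continuous_const)
  have hKcompact : IsCompact K := by
    let G : (ι → κ → ℝ) → (ι → ℝ) × (κ → ℝ) := fun s =>
      (fun i => s i₀ j₀ + L i₀ j₀ - s i j₀ - L i j₀, fun j => -s i₀ j - L i₀ j)
    have hG : Continuous G := by
      simp only [G]
      fun_prop
    have hbox : IsCompact (Set.univ.pi fun i => Set.univ.pi fun j =>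
        Set.Icc (exp (-φ p₀)) (φ p₀ / Y i j)) :=
      isCompact_univ_pi fun i => isCompact_univ_pi fun j => isCompact_Icc
    refine (hbox.image hG).of_isClosed_subset hKclosed fun p hp => ⟨S p, ?_, ?_⟩
    · exact fun i _ j _ => hp.2 i j
    · have h0 : p.1 i₀ = 0 := hp.1
      ext k
      · simp only [G, S, h0]
        ring
      · simp [G, S, h0]
  have hKpos : ∀ p ∈ K, ∀ i j, 0 < S p i j := fun p hp i j =>
    (exp_pos _).trans_le (hp.2 i j).1
  have hp₀K : p₀ ∈ K := hmemK p₀ rfl hp₀ le_rfl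
  have hcont : ContinuousOn φ K := by
    refine continuousOn_finsetSum _ fun i _ => continuousOn_finsetSum _ fun j _ => ?_
    have h := (hS i j).continuousOn (s := K)
    exact (continuousOn_const.mul h).sub
      ((continuousOn_const.sub h.neg.rexp).log fun p hp => (hexp _ (hKpos p hp i j)).ne')
  obtain ⟨q, hqK, hq⟩ := hKcompact.exists_isMinOn ⟨p₀, hp₀K⟩ hcont
  have hqpos := hKpos q hqK
  have hmin : ∀ p, (∀ i j, 0 < S p i j) → φ q ≤ φ p := by
    intro p hp
    let p' : (ι → ℝ) × (κ → ℝ) := (fun i => p.1 i - p.1 i₀, fun j => p.2 j + p.1 i₀)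
    have hSp : S p' = S p := by
      ext i j
      simp only [S, p']
      ring
    have hφp : φ p' = φ p := by simp only [φ, hSp]
    rcases le_total (φ p) (φ p₀) with h | h
    · rw [← hφp]
      exact hq (hmemK p' (sub_self _) (by rwa [hSp]) (hφp.trans_le h))
    · exact (hq hp₀K).trans h
  have hcrit : ∀ (u : ι → ℝ) (v : κ → ℝ),
      ∑ i, ∑ j, (Y i j - exp (-S q i j) / (1 - exp (-S q i j))) * (u i + v j) = 0 := by
    intro u v
    let γ : ℝ → (ι → ℝ) × (κ → ℝ) := fun t => (fun i => q.1 i - t * u i, fun j => q.2 j - t * v j)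
    have hγ0 : γ 0 = q := by simp [γ]
    have hSd : ∀ i j, HasDerivAt (fun t => S (γ t) i j) (u i + v j) 0 := fun i j => by
      have h : (fun t => S (γ t) i j) = fun t => t * (u i + v j) + S q i j := by
        ext t
        simp only [S, γ]
        ring
      rw [h]
      simpa using ((hasDerivAt_id (0 : ℝ)).mul_const (u i + v j)).add_const (S q i j)
    have hlocal : IsLocalMin (φ ∘ γ) 0 := by
      have hev : ∀ᶠ t in nhds (0 : ℝ), ∀ i j, 0 < S (γ t) i j := by
        refine Filter.eventually_all.2 fun i => Filter.eventually_all.2 fun j => ?_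
        exact (hSd i j).continuousAt.eventually (lt_mem_nhds (by simpa [hγ0] using hqpos i j))
      filter_upwards [hev] with t ht
      simpa [hγ0] using hmin (γ t) ht
    refine hlocal.hasDerivAt_eq_zero ?_
    refine HasDerivAt.fun_sum fun i _ => HasDerivAt.fun_sum fun j _ => ?_
    have hne : 1 - exp (-S (γ 0) i j) ≠ 0 := by
      rw [hγ0]
      exact (hexp _ (hqpos i j)).ne'
    refine (((hSd i j).const_mul (Y i j)).sub
      (((hSd i j).fun_neg.exp.const_sub 1).log hne)).congr_deriv ?_
    rw [hγ0]
    ring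
  have hneg : ∀ i j, -S q i j = q.1 i + q.2 j + L i j := fun i j => neg_neg _
  simp only [hneg] at hcrit
  refine ⟨q.1, q.2, fun i j => ?_, fun i => ?_, fun j => ?_⟩
  · linarith [hqpos i j, hneg i j]
  · have h := hcrit (Pi.single i 1) 0
    rw [sum_eq_single i (by simp +contextual) (by simp)] at h
    simp only [Pi.single_eq_same, Pi.zero_apply, add_zero, mul_one, sum_sub_distrib] at h
    linarith
  · have h := hcrit 0 (Pi.single j 1)
    rw [sum_comm, sum_eq_single j (by simp +contextual) (by simp)] at h
    simp only [Pi.single_eq_same, Pi.zero_apply, zero_add, mul_one, sum_sub_distrib] at h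
    linarith


/-- Lemma 1.4. For a strictly positive weight matrix `W`, the function
`g(X;W) = Σ (x_{ij}+1) ln(x_{ij}+1) − x_{ij} ln x_{ij} + x_{ij} ln w_{ij}` is strictly
concave on the transportation polytope `P(R,C)` and attains its maximum there at a
unique matrix `Z`, which is strictly positive and of the form
`z_{ij} = w_{ij} ξ_i η_j / (1 − w_{ij} ξ_i η_j)`; moreover the infimum `ρ(R,C;W)` of
`F(·,·;W)` is attained at `(ξ, η)` and equals `exp g(Z;W)`. -/
theorem matrix_scaling_duality
    (m n N : ℕ) (hm : 1 < m) (hn : 1 < n)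
    (r : Fin m → ℕ) (c : Fin n → ℕ)
    (hr : ∀ i, 0 < r i) (hc : ∀ j, 0 < c j)
    (hrN : ∑ i, r i = N) (hcN : ∑ j, c j = N)
    (w : Fin m → Fin n → ℝ) (hw : ∀ i j, 0 < w i j)
    (P : Set (Matrix (Fin m) (Fin n) ℝ))
    (hP : P = {X | (∀ i, ∑ j, X i j = (r i : ℝ)) ∧
      (∀ j, ∑ i, X i j = (c j : ℝ)) ∧ ∀ i j, 0 ≤ X i j})
    (g : Matrix (Fin m) (Fin n) ℝ → ℝ)
    (hg : g = fun X => ∑ i, ∑ j,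
      ((X i j + 1) * Real.log (X i j + 1) - X i j * Real.log (X i j) +
        X i j * Real.log (w i j)))
    (F : (Fin m → ℝ) → (Fin n → ℝ) → ℝ)
    (hF : F = fun x y => (∏ i, x i ^ (-(r i : ℤ))) * (∏ j, y j ^ (-(c j : ℤ))) *
      (∏ i, ∏ j, (1 - w i j * x i * y j)⁻¹)) :
    StrictConcaveOn ℝ P g ∧
    ∃ Z ∈ P,
      (∀ i j, 0 < Z i j) ∧
      (∀ X ∈ P, g X ≤ g Z) ∧
      (∀ X ∈ P, g X = g Z → X = Z) ∧
      ∃ (ξ : Fin m → ℝ) (η : Fin n → ℝ),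
        (∀ i, 0 < ξ i) ∧ (∀ j, 0 < η j) ∧
        (∀ i j, w i j * ξ i * η j < 1) ∧
        (∀ i j, Z i j = w i j * ξ i * η j / (1 - w i j * ξ i * η j)) ∧
        IsLeast {z : ℝ | ∃ (x : Fin m → ℝ) (y : Fin n → ℝ),
          (∀ i, 0 < x i) ∧ (∀ j, 0 < y j) ∧ (∀ i j, w i j * x i * y j < 1) ∧
          F x y = z} (F ξ η) ∧
        F ξ η = Real.exp (g Z) := by
  have hdual : ∀ X ∈ P, ∀ x y, (∀ i, 0 < x i) → (∀ j, 0 < y j) →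
      (∀ i j, w i j * x i * y j < 1) →
      F x y = Real.exp (∑ i, ∑ j, (-(X i j * Real.log (w i j * x i * y j)) -
        Real.log (1 - w i j * x i * y j) + X i j * Real.log (w i j))) := by
    intro X hX x y hx hy hxy
    rw [hP] at hX
    obtain ⟨hrow, hcol, -⟩ := hX
    have hterm : ∀ i j, -(X i j * Real.log (w i j * x i * y j)) -
        Real.log (1 - w i j * x i * y j) + X i j * Real.log (w i j) =
        -(X i j * Real.log (x i)) + -(X i j * Real.log (y j)) +
          -Real.log (1 - w i j * x i * y j) := by
      intro i j
      rw [Real.log_mul (mul_pos (hw i j) (hx i)).ne' (hy j).ne',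
        Real.log_mul (hw i j).ne' (hx i).ne']
      ring
    simp only [hterm, sum_add_distrib]
    rw [Real.exp_add, Real.exp_add, sum_comm (f := fun i j => -(X i j * Real.log (y j)))]
    simp only [sum_neg_distrib, ← sum_mul, hrow, hcol]
    simp only [← sum_neg_distrib, Real.exp_sum, hF]
    congr 1
    · congr 1
      · refine prod_congr rfl fun i _ => ?_
        rw [Real.exp_neg, zpow_neg, zpow_natCast, Real.exp_nat_mul, Real.exp_log (hx i)]
      · refine prod_congr rfl fun j _ => ?_
        rw [Real.exp_neg, zpow_neg, zpow_natCast, Real.exp_nat_mul, Real.exp_log (hy j)]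
    · refine prod_congr rfl fun i _ => prod_congr rfl fun j _ => ?_
      rw [Real.exp_neg, Real.exp_log (by linarith [hxy i j])]
  have hweak : ∀ X ∈ P, ∀ x y, (∀ i, 0 < x i) → (∀ j, 0 < y j) →
      (∀ i j, w i j * x i * y j < 1) → Real.exp (g X) ≤ F x y := by
    intro X hX x y hx hy hxy
    rw [hdual X hX x y hx hy hxy, hg]
    rw [hP] at hX
    refine Real.exp_le_exp.2 (sum_le_sum fun i _ => sum_le_sum fun j _ => ?_)
    refine add_le_add_left ?_ _
    exact geometricEntropy_le (hX.2.2 i j) (mul_pos (mul_pos (hw i j) (hx i)) (hy j)) (hxy i j)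
  have hconc : StrictConcaveOn ℝ P g := by
    have hterm : ∀ i j, StrictConcaveOn ℝ (Set.Ici (0 : ℝ)) fun z =>
        (z + 1) * Real.log (z + 1) - z * Real.log z + z * Real.log (w i j) := fun i j =>
      strictConcaveOn_geometricEntropy.add_concaveOn
        ((LinearMap.mulRight ℝ (Real.log (w i j))).concaveOn (convex_Ici 0))
    refine ⟨?_, ?_⟩
    · rw [hP]
      rintro X ⟨hX1, hX2, hX3⟩ Y ⟨hY1, hY2, hY3⟩ a b ha hb hab
      refine ⟨fun i => ?_, fun j => ?_, fun i j => ?_⟩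
      · simp only [Matrix.add_apply, Matrix.smul_apply, smul_eq_mul, sum_add_distrib, ← mul_sum,
          hX1, hY1]
        rw [← add_mul, hab, one_mul]
      · simp only [Matrix.add_apply, Matrix.smul_apply, smul_eq_mul, sum_add_distrib, ← mul_sum,
          hX2, hY2]
        rw [← add_mul, hab, one_mul]
      · have := hX3 i j
        have := hY3 i j
        simp only [Matrix.add_apply, Matrix.smul_apply, smul_eq_mul]
        positivity
    · intro X hX Y hY hXY a b ha hb hab
      rw [hP] at hX hY
      have hne : ∃ i j, X i j ≠ Y i j := by
        by_contra! h
        exact hXY (Matrix.ext h)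
      obtain ⟨i, j, hij⟩ := hne
      rw [hg]
      simp only [smul_sum, ← sum_add_distrib]
      have hle : ∀ i j, _ := fun i j =>
        (hterm i j).concaveOn.2 (hX.2.2 i j) (hY.2.2 i j) ha.le hb.le hab
      exact sum_lt_sum (fun i _ => sum_le_sum fun j _ => hle i j)
        ⟨i, mem_univ i, sum_lt_sum (fun j _ => hle i j)
          ⟨j, mem_univ j, (hterm i j).2 (hX.2.2 i j) (hY.2.2 i j) hij ha hb hab⟩⟩
  have : Nonempty (Fin m) := ⟨⟨0, by omega⟩⟩
  have : Nonempty (Fin n) := ⟨⟨0, by omega⟩⟩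
  have hrN' : ∑ i, (r i : ℝ) = N := by exact_mod_cast hrN
  have hcN' : ∑ j, (c j : ℝ) = N := by exact_mod_cast hcN
  have hN : (0 : ℝ) < N := by
    rw [← hrN']
    exact sum_pos (fun i _ => Nat.cast_pos.2 (hr i)) univ_nonempty
  obtain ⟨a, b, hab, hrow, hcol⟩ := exists_scaling_same_marginals
    (fun i j => (r i : ℝ) * c j / N) (fun i j => Real.log (w i j)) (fun i j =>
      div_pos (mul_pos (Nat.cast_pos.2 (hr i)) (Nat.cast_pos.2 (hc j))) hN)
  have hexp : ∀ i j, Real.exp (a i + b j + Real.log (w i j)) =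
      w i j * Real.exp (a i) * Real.exp (b j) := fun i j => by
    rw [Real.exp_add, Real.exp_add, Real.exp_log (hw i j)]
    ring
  have hlt : ∀ i j, w i j * Real.exp (a i) * Real.exp (b j) < 1 := fun i j => by
    rw [← hexp]
    exact Real.exp_lt_one_iff.2 (hab i j)
  have hpos : ∀ i j, 0 < w i j * Real.exp (a i) * Real.exp (b j) := fun i j => by
    rw [← hexp]
    exact Real.exp_pos _
  simp only [hexp, ← sum_div, ← mul_sum, ← sum_mul, hrN', hcN'] at hrow hcol
  let Z : Matrix (Fin m) (Fin n) ℝ := fun i j =>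
    w i j * Real.exp (a i) * Real.exp (b j) / (1 - w i j * Real.exp (a i) * Real.exp (b j))
  have hZpos : ∀ i j, 0 < Z i j := fun i j => div_pos (hpos i j) (by linarith [hlt i j])
  have hZP : Z ∈ P := by
    rw [hP]
    refine ⟨fun i => ?_, fun j => ?_, fun i j => (hZpos i j).le⟩
    · exact (hrow i).trans (mul_div_cancel_right₀ _ hN.ne')
    · exact (hcol j).trans (mul_div_cancel_left₀ _ hN.ne')
  have hFZ : F (fun i => Real.exp (a i)) (fun j => Real.exp (b j)) = Real.exp (g Z) := by
    rw [hdual Z hZP _ _ (fun i => Real.exp_pos _) (fun j => Real.exp_pos _) hlt, hg]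
    congr 1
    refine sum_congr rfl fun i _ => sum_congr rfl fun j _ => ?_
    rw [← geometricEntropy_eq (hpos i j) (hlt i j)]
  have hmax : ∀ X ∈ P, g X ≤ g Z := fun X hX => by
    rw [← Real.exp_le_exp, ← hFZ]
    exact hweak X hX _ _ (fun i => Real.exp_pos _) (fun j => Real.exp_pos _) hlt
  refine ⟨hconc, Z, hZP, hZpos, hmax, fun X hX hXZ => ?_, fun i => Real.exp (a i),
    fun j => Real.exp (b j), fun i => Real.exp_pos _, fun j => Real.exp_pos _, hlt,
    fun i j => rfl, ⟨⟨_, _, fun i => Real.exp_pos _, fun j => Real.exp_pos _, hlt, rfl⟩, ?_⟩, hFZ⟩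
  · exact hconc.eq_of_isMaxOn (fun Y hY => (hmax Y hY).trans_eq hXZ.symm) hmax hX hZP
  · rintro _ ⟨x, y, hx, hy, hxy, rfl⟩
    rw [hFZ]
    exact hweak Z hZP x y hx hy hxy
end

section
/- Let A ⊂ R^d be the affine hyperplane defined by x_1 + … + x_d = 1, let Δ ⊂ A be the standard open (d−1)-dimensional simplex defined by x_i > 0 for all i, and let c = (1/d, …, 1/d) be its center. Let H ⊂ A be an affine hyperplane in A passing through c, and let H⁺ and H⁻ be the two open halfspaces of A bounded by H. Then vol(Δ ∩ H⁺)/vol(Δ) ≥ (1 − 1/d)^{d−1} > 1/e and vol(Δ ∩ H⁻)/vol(Δ) ≥ (1 − 1/d)^{d−1} > 1/e. -/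
open MeasureTheory
open Set Filter Topology
open scoped ENNReal Pointwise

theorem volume_add_le_of_isCompact {A B : Set ℝ} (hA : IsCompact A) (hB : IsCompact B)
    (hA' : A.Nonempty) (hB' : B.Nonempty) : volume A + volume B ≤ volume (A + B) := by
  set s := sSup A
  set i := sInf B
  have hs : s ∈ A := hA.sSup_mem hA'
  have hi : i ∈ B := hB.sInf_mem hB'
  have h1 : i +ᵥ A ⊆ A + B := by
    rintro _ ⟨x, hx, rfl⟩
    exact ⟨x, hx, i, hi, add_comm _ _⟩
  have h2 : s +ᵥ B ⊆ A + B := by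
    rintro _ ⟨x, hx, rfl⟩
    exact ⟨s, hs, x, hx, rfl⟩
  have h3 : (i +ᵥ A) ∩ (s +ᵥ B) ⊆ {s + i} := by
    rintro _ ⟨⟨x, hx, rfl⟩, ⟨y, hy, hxy⟩⟩
    have := le_csSup hA.bddAbove hx
    have := csInf_le hB.bddBelow hy
    simp only [vadd_eq_add, mem_singleton_iff] at *
    linarith
  calc volume A + volume B = volume (i +ᵥ A) + volume (s +ᵥ B) := by
        rw [measure_vadd, measure_vadd]
    _ = volume ((i +ᵥ A) ∪ (s +ᵥ B)) := by
        refine (measure_union₀ (hB.measurableSet.const_vadd s).nullMeasurableSet ?_).symm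
        exact measure_mono_null h3 Real.volume_singleton
    _ ≤ volume (A + B) := measure_mono (union_subset h1 h2)

theorem volume_add_le {A B : Set ℝ} (hA : MeasurableSet A) (hB : MeasurableSet B)
    (hA' : A.Nonempty) (hB' : B.Nonempty) : volume A + volume B ≤ volume (A + B) := by
  obtain ⟨x, hx⟩ := hA'
  obtain ⟨y, hy⟩ := hB'
  rw [hA.measure_eq_iSup_isCompact, hB.measure_eq_iSup_isCompact]
  simp only [iSup_and']
  refine ENNReal.biSup_add_biSup_le' (p := fun K => K ⊆ A ∧ IsCompact K)
    (q := fun K => K ⊆ B ∧ IsCompact K) ⟨∅, by simp⟩ ⟨∅, by simp⟩ ?_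
  rintro K ⟨hKA, hK⟩ L ⟨hLB, hL⟩
  calc volume K + volume L ≤ volume (insert x K) + volume (insert y L) := by
        gcongr <;> exact subset_insert _ _
    _ ≤ volume (insert x K + insert y L) :=
        volume_add_le_of_isCompact (hK.insert x) (hL.insert y) ⟨x, by simp⟩ ⟨y, by simp⟩
    _ ≤ volume (A + B) :=
        measure_mono (add_subset_add (insert_subset hx hKA) (insert_subset hy hLB))

theorem volume_smul_add_smul_le {A B : Set ℝ} (hA : MeasurableSet A) (hB : MeasurableSet B)
    (hA' : A.Nonempty) (hB' : B.Nonempty) {a b : ℝ} (ha : 0 < a) (hb : 0 < b) :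
    ENNReal.ofReal a * volume A + ENNReal.ofReal b * volume B ≤ volume (a • A + b • B) := by
  have := volume_add_le (hA.const_smul₀ a) (hB.const_smul₀ b) hA'.smul_set hB'.smul_set
  simpa [Measure.addHaar_smul, abs_of_pos, ha, hb] using this

/-- One-dimensional Prékopa–Leindler, for functions with supremum one. -/
theorem lintegral_add_lintegral_le_of_rpow_mul_rpow_le {f g h : ℝ → ℝ} (hf : Measurable f)
    (hg : Measurable g) (hh : Measurable h) (f0 : ∀ x, 0 ≤ f x) (g0 : ∀ x, 0 ≤ g x)
    (h0 : ∀ x, 0 ≤ h x) (f1 : ∀ x, f x ≤ 1) (g1 : ∀ x, g x ≤ 1)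
    (hf1 : ∀ t < 1, ∃ x, t < f x) (hg1 : ∀ t < 1, ∃ x, t < g x) {a b : ℝ} (ha : 0 < a)
    (hb : 0 < b) (hab : a + b = 1)
    (H : ∀ x y, f x ^ a * g y ^ b ≤ h (a * x + b * y)) :
    ENNReal.ofReal a * (∫⁻ x, ENNReal.ofReal (f x)) +
      ENNReal.ofReal b * (∫⁻ x, ENNReal.ofReal (g x)) ≤ ∫⁻ x, ENNReal.ofReal (h x) := by
  rw [lintegral_eq_lintegral_meas_lt _ (ae_of_all _ f0) hf.aemeasurable,
    lintegral_eq_lintegral_meas_lt _ (ae_of_all _ g0) hg.aemeasurable,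
    lintegral_eq_lintegral_meas_lt _ (ae_of_all _ h0) hh.aemeasurable,
    ← lintegral_const_mul' _ _ ENNReal.ofReal_ne_top,
    ← lintegral_const_mul' _ _ ENNReal.ofReal_ne_top]
  refine (le_lintegral_add _ _).trans (setLIntegral_mono' measurableSet_Ioi fun t ht => ?_)
  rcases le_or_gt 1 t with h1 | h1
  · have hf' : {x | t < f x} = ∅ := eq_empty_of_forall_notMem fun x hx => by
      linarith [f1 x, mem_ofPred.1 hx]
    have hg' : {x | t < g x} = ∅ := eq_empty_of_forall_notMem fun x hx => by
      linarith [g1 x, mem_ofPred.1 hx]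
    simp [hf', hg']
  · refine (volume_smul_add_smul_le (measurableSet_lt measurable_const hf)
      (measurableSet_lt measurable_const hg) (hf1 t h1) (hg1 t h1) ha hb).trans
      (measure_mono ?_)
    rintro _ ⟨_, ⟨x, hx, rfl⟩, _, ⟨y, hy, rfl⟩, rfl⟩
    have ht : 0 < t := ht
    calc t = t ^ a * t ^ b := by rw [← Real.rpow_add ht, hab, Real.rpow_one]
      _ < f x ^ a * g y ^ b := by
        have hx : t < f x := hx
        have hy : t < g y := hy
        gcongr
      _ ≤ h (a * x + b * y) := H x y

/-- The weighted inequality between the geometric and the arithmetic mean in `ℝ≥0∞`. -/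
theorem ENNReal.rpow_mul_rpow_le_add {a b : ℝ} (ha : 0 < a) (hb : 0 < b) (hab : a + b = 1)
    (x y : ℝ≥0∞) : x ^ a * y ^ b ≤ ENNReal.ofReal a * x + ENNReal.ofReal b * y := by
  rcases eq_or_ne x ∞ with rfl | hx
  · simp [ENNReal.mul_top, ha]
  rcases eq_or_ne y ∞ with rfl | hy
  · simp [ENNReal.mul_top, hb]
  lift x to NNReal using hx
  lift y to NNReal using hy
  lift a to NNReal using ha.le
  lift b to NNReal using hb.le
  rw [← ENNReal.coe_rpow_of_nonneg _ ha.le, ← ENNReal.coe_rpow_of_nonneg _ hb.le]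
  simp only [ENNReal.ofReal_coe_nnreal]
  exact_mod_cast NNReal.geom_mean_le_arith_mean2_weighted a b x y (by exact_mod_cast hab)

theorem exists_lt_toReal_div_iSup {f : ℝ → ℝ≥0∞} (h0 : ⨆ x, f x ≠ 0) (ht : ⨆ x, f x ≠ ∞)
    {t : ℝ} (h : t < 1) : ∃ x, t < (f x / ⨆ x, f x).toReal := by
  rcases lt_or_ge t 0 with h' | h'
  · exact ⟨0, h'.trans_le ENNReal.toReal_nonneg⟩
  have h1 : ENNReal.ofReal t * ⨆ x, f x < ⨆ x, f x := by
    conv_rhs => rw [← one_mul (⨆ x, f x)]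
    rw [ENNReal.mul_lt_mul_iff_left h0 ht]
    simpa using h
  obtain ⟨x, hx⟩ := lt_iSup_iff.1 h1
  refine ⟨x, (ENNReal.ofReal_lt_iff_lt_toReal h' ?_).1 ?_⟩
  · exact (ENNReal.div_lt_top ((le_iSup f x).trans_lt ht.lt_top).ne h0).ne
  · rwa [ENNReal.lt_div_iff_mul_lt (Or.inl h0) (Or.inl ht)]

theorem lintegral_rpow_mul_lintegral_rpow_le_of_iSup_ne_top {f g h : ℝ → ℝ≥0∞}
    (hf : Measurable f) (hg : Measurable g) (hh : Measurable h)
    (hf0 : ⨆ x, f x ≠ 0) (hg0 : ⨆ x, g x ≠ 0) (hft : ⨆ x, f x ≠ ∞) (hgt : ⨆ x, g x ≠ ∞)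
    {a b : ℝ} (ha : 0 < a) (hb : 0 < b) (hab : a + b = 1)
    (H : ∀ x y, f x ^ a * g y ^ b ≤ h (a * x + b * y)) :
    (∫⁻ x, f x) ^ a * (∫⁻ x, g x) ^ b ≤ ∫⁻ x, h x := by
  set S := ⨆ x, f x
  set T := ⨆ x, g x
  have hfS : ∀ x, f x ≤ S := le_iSup f
  have hgT : ∀ x, g x ≤ T := le_iSup g
  set R := S ^ a * T ^ b
  have hR0 : R ≠ 0 := by simp [R, hf0, hg0, hft, hgt]
  have hRt : R ≠ ∞ := by
    refine ENNReal.mul_ne_top ?_ ?_ <;> simp [*]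
  have hf1 : ∀ x, f x / S ≤ 1 := fun x => ENNReal.div_le_of_le_mul (by simpa using hfS x)
  have hg1 : ∀ x, g x / T ≤ 1 := fun x => ENNReal.div_le_of_le_mul (by simpa using hgT x)
  have key := lintegral_add_lintegral_le_of_rpow_mul_rpow_le
    (f := fun x => (f x / S).toReal) (g := fun x => (g x / T).toReal)
    (h := fun x => (min (h x / R) 1).toReal) (by fun_prop) (by fun_prop) (by fun_prop)
    (fun _ => ENNReal.toReal_nonneg) (fun _ => ENNReal.toReal_nonneg)
    (fun _ => ENNReal.toReal_nonneg)
    (fun x => ENNReal.toReal_le_of_le_ofReal zero_le_one (by simpa using hf1 x))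
    (fun x => ENNReal.toReal_le_of_le_ofReal zero_le_one (by simpa using hg1 x))
    (fun t ht => ?_) (fun t ht => ?_) ha hb hab (fun x y => ?_)
  · have e1 : ∀ x, ENNReal.ofReal (f x / S).toReal = f x * S⁻¹ := fun x =>
      ENNReal.ofReal_toReal ((hf1 x).trans_lt ENNReal.one_lt_top).ne
    have e2 : ∀ x, ENNReal.ofReal (g x / T).toReal = g x * T⁻¹ := fun x =>
      ENNReal.ofReal_toReal ((hg1 x).trans_lt ENNReal.one_lt_top).ne
    have e3 : ∀ x, ENNReal.ofReal (min (h x / R) 1).toReal ≤ h x * R⁻¹ := fun x =>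
      ENNReal.ofReal_toReal_le.trans (min_le_left _ _)
    simp only [e1, e2] at key
    replace key := key.trans (lintegral_mono e3)
    rw [lintegral_mul_const _ hf, lintegral_mul_const _ hg, lintegral_mul_const _ hh] at key
    replace key := (ENNReal.rpow_mul_rpow_le_add ha hb hab _ _).trans key
    rw [ENNReal.mul_rpow_of_nonneg _ _ ha.le, ENNReal.mul_rpow_of_nonneg _ _ hb.le,
      mul_mul_mul_comm, ENNReal.inv_rpow, ENNReal.inv_rpow,
      ← ENNReal.mul_inv (by simp [hf0, hft]) (by simp [hf0, hft])] at key
    exact (ENNReal.mul_le_mul_iff_left (ENNReal.inv_ne_zero.2 hRt) (ENNReal.inv_ne_top.2 hR0)).1 key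
  · exact exists_lt_toReal_div_iSup hf0 hft ht
  · exact exists_lt_toReal_div_iSup hg0 hgt ht
  · rw [ENNReal.toReal_rpow, ENNReal.toReal_rpow, ← ENNReal.toReal_mul]
    refine ENNReal.toReal_mono (by simp) (le_min ?_ ?_)
    · rw [ENNReal.div_rpow_of_nonneg _ _ ha.le, ENNReal.div_rpow_of_nonneg _ _ hb.le,
        div_eq_mul_inv, div_eq_mul_inv, mul_mul_mul_comm,
        ← ENNReal.mul_inv (by simp [hf0, hft]) (by simp [hf0, hft]), ← div_eq_mul_inv]
      exact ENNReal.div_le_div_right (H x y) _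
    · exact mul_le_one' (ENNReal.rpow_le_one (hf1 x) ha.le) (ENNReal.rpow_le_one (hg1 y) hb.le)

/-- The Prékopa–Leindler inequality holds for the measure `μ`. -/
def PrekopaLeindler {E : Type*} [AddCommGroup E] [Module ℝ E] [MeasurableSpace E]
    (μ : Measure E) : Prop :=
  ∀ ⦃f g h : E → ℝ≥0∞⦄, Measurable f → Measurable g → Measurable h →
    ∀ ⦃a b : ℝ⦄, 0 < a → 0 < b → a + b = 1 →
      (∀ x y, f x ^ a * g y ^ b ≤ h (a • x + b • y)) →
        (∫⁻ x, f x ∂μ) ^ a * (∫⁻ x, g x ∂μ) ^ b ≤ ∫⁻ x, h x ∂μ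

theorem tendsto_lintegral_min_natCast {f : ℝ → ℝ≥0∞} (hf : Measurable f) :
    Tendsto (fun n : ℕ => ∫⁻ x, min (f x) (n + 1 : ℕ)) atTop (𝓝 (∫⁻ x, f x)) := by
  refine lintegral_tendsto_of_tendsto_of_monotone (fun n => by fun_prop)
    (ae_of_all _ fun x m n hmn => by dsimp only; gcongr) (ae_of_all _ fun x => ?_)
  have h1 : Tendsto (fun n : ℕ => ((n + 1 : ℕ) : ℝ≥0∞)) atTop (𝓝 ∞) :=
    ENNReal.tendsto_nat_nhds_top.comp (tendsto_add_atTop_nat 1)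
  simpa using (tendsto_const_nhds (x := f x)).min h1

theorem prekopaLeindler_volume_real : PrekopaLeindler (volume : Measure ℝ) := by
  intro f g h hf hg hh a b ha hb hab H
  have zero : ∀ {f : ℝ → ℝ≥0∞}, ⨆ x, f x = 0 → ∫⁻ x, f x = 0 := fun {f} h => by
    have : f = 0 := funext fun x => by simpa using (le_iSup f x).trans h.le
    simp [this]
  rcases eq_or_ne (∫⁻ x, f x) 0 with hf0 | hf0
  · simp [hf0, ha]
  rcases eq_or_ne (∫⁻ x, g x) 0 with hg0 | hg0
  · simp [hg0, hb]
  refine le_of_tendsto (ENNReal.Tendsto.mul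
    ((ENNReal.continuous_rpow_const.tendsto _).comp (tendsto_lintegral_min_natCast hf)) ?_
    ((ENNReal.continuous_rpow_const.tendsto _).comp (tendsto_lintegral_min_natCast hg)) ?_)
    (Eventually.of_forall fun n => ?_)
  · left; simp [hf0, ha, ha.not_gt]
  · left; simp [hg0, hb, hb.not_gt]
  have ne_zero : ∀ {f : ℝ → ℝ≥0∞}, ∫⁻ x, f x ≠ 0 → ⨆ x, min (f x) (n + 1 : ℕ) ≠ 0 := by
    intro f h h'
    refine h (zero ?_)
    simpa [ENNReal.iSup_eq_zero] using h'
  have ne_top : ∀ {f : ℝ → ℝ≥0∞}, ⨆ x, min (f x) (n + 1 : ℕ) ≠ ∞ := fun {f} =>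
    ((iSup_le fun x => min_le_right _ _).trans_lt (ENNReal.natCast_lt_top (n + 1))).ne
  exact lintegral_rpow_mul_lintegral_rpow_le_of_iSup_ne_top (by fun_prop) (by fun_prop) hh
    (ne_zero hf0) (ne_zero hg0) ne_top ne_top ha hb hab fun x y =>
    le_trans (by gcongr <;> exact min_le_left _ _) (H x y)

namespace PrekopaLeindler

variable {E F : Type*} [AddCommGroup E] [Module ℝ E] [MeasurableSpace E]
  [AddCommGroup F] [Module ℝ F] [MeasurableSpace F] {μ : Measure E} {ν : Measure F}

theorem prod [SFinite ν] (hμ : PrekopaLeindler μ) (hν : PrekopaLeindler ν) :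
    PrekopaLeindler (μ.prod ν) := by
  intro f g h hf hg hh a b ha hb hab H
  rw [lintegral_prod _ hf.aemeasurable, lintegral_prod _ hg.aemeasurable,
    lintegral_prod _ hh.aemeasurable]
  refine hμ hf.lintegral_prod_right' hg.lintegral_prod_right' hh.lintegral_prod_right' ha hb hab
    fun x x' => ?_
  exact hν (by fun_prop) (by fun_prop) (by fun_prop) ha hb hab fun y y' => H (x, y) (x', y')

theorem map (hμ : PrekopaLeindler μ) (L : E →ₗ[ℝ] F) (hL : Measurable L) :
    PrekopaLeindler (μ.map L) := by
  intro f g h hf hg hh a b ha hb hab H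
  rw [lintegral_map hf hL, lintegral_map hg hL, lintegral_map hh hL]
  exact hμ (by fun_prop) (by fun_prop) (by fun_prop) ha hb hab fun y y' => by
    simpa using H (L y) (L y')

theorem smul (hμ : PrekopaLeindler μ) (c : ℝ≥0∞) : PrekopaLeindler (c • μ) := by
  intro f g h hf hg hh a b ha hb hab H
  simp only [lintegral_smul_measure, smul_eq_mul]
  rw [ENNReal.mul_rpow_of_nonneg _ _ ha.le, ENNReal.mul_rpow_of_nonneg _ _ hb.le,
      mul_mul_mul_comm, ← ENNReal.rpow_add_of_nonneg _ _ ha.le hb.le, hab, ENNReal.rpow_one]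
  gcongr
  exact hμ hf hg hh ha hb hab H

end PrekopaLeindler

theorem prekopaLeindler_volume_pi (n : ℕ) : PrekopaLeindler (volume : Measure (Fin n → ℝ)) := by
  induction n with
  | zero =>
    intro f g h hf hg hh a b ha hb hab H
    rw [volume_pi, Measure.pi_of_empty _ 0]
    simpa [lintegral_dirac] using H 0 0
  | succ n ih =>
    have h := volume_preserving_piFinSuccAbove (fun _ : Fin (n + 1) => ℝ) 0
    let L : ℝ × (Fin n → ℝ) →ₗ[ℝ] (Fin (n + 1) → ℝ) :=
      { toFun := (MeasurableEquiv.piFinSuccAbove (fun _ : Fin (n + 1) => ℝ) 0).symm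
        map_add' := fun x y => by
          ext i; refine Fin.cases ?_ (fun j => ?_) i <;> simp
        map_smul' := fun c x => by
          ext i; refine Fin.cases ?_ (fun j => ?_) i <;> simp }
    have := (prekopaLeindler_volume_real.prod ih).map L (MeasurableEquiv.measurable _)
    rwa [← Measure.volume_eq_prod,
      show Measure.map L volume = volume from (h.symm _).map_eq] at this

/-- The **Prékopa–Leindler inequality**. -/
theorem prekopaLeindler_of_isAddHaarMeasure {E : Type*} [NormedAddCommGroup E] [NormedSpace ℝ E]
    [FiniteDimensional ℝ E] [MeasurableSpace E] [BorelSpace E] (μ : Measure E)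
    [μ.IsAddHaarMeasure] : PrekopaLeindler μ := by
  let L : (Fin (Module.finrank ℝ E) → ℝ) ≃L[ℝ] E := (Module.finBasis ℝ E).equivFunL.symm
  have hL : (Measure.map L volume).IsAddHaarMeasure := L.isAddHaarMeasure_map _
  rw [Measure.isAddLeftInvariant_eq_smul μ (Measure.map L volume)]
  exact ((prekopaLeindler_volume_pi _).map L.toLinearMap L.continuous.measurable).smul _

/-- The multiplicative form of the Brunn–Minkowski inequality. -/
theorem measure_rpow_mul_measure_rpow_le {E : Type*} [NormedAddCommGroup E] [NormedSpace ℝ E]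
    [FiniteDimensional ℝ E] [MeasurableSpace E] [BorelSpace E] (μ : Measure E)
    [μ.IsAddHaarMeasure] {A B C : Set E} (hA : MeasurableSet A) (hB : MeasurableSet B)
    (hC : MeasurableSet C) {a b : ℝ} (ha : 0 < a) (hb : 0 < b) (hab : a + b = 1)
    (h : ∀ x ∈ A, ∀ y ∈ B, a • x + b • y ∈ C) : μ A ^ a * μ B ^ b ≤ μ C := by
  have := prekopaLeindler_of_isAddHaarMeasure μ (f := A.indicator 1) (g := B.indicator 1)
    (h := C.indicator 1) (measurable_one.indicator hA) (measurable_one.indicator hB)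
    (measurable_one.indicator hC) ha hb hab fun x y => by
      by_cases hx : x ∈ A
      · by_cases hy : y ∈ B
        · simp [hx, hy, h x hx y hy]
        · simp [hy, hb]
      · simp [hx, ha]
  simpa [lintegral_indicator_one, hA, hB, hC] using this

/-- The **Brunn–Minkowski inequality**. -/
theorem ofReal_pow_le_measure {E : Type*} [NormedAddCommGroup E] [NormedSpace ℝ E]
    [FiniteDimensional ℝ E] [MeasurableSpace E] [BorelSpace E] (μ : Measure E)
    [μ.IsAddHaarMeasure] {A B C : Set E} (hA : MeasurableSet A) (hB : MeasurableSet B)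
    (hC : MeasurableSet C) {a b : ℝ} (ha : 0 < a) (hb : 0 < b)
    (h : ∀ x ∈ A, ∀ y ∈ B, a • x + b • y ∈ C) {α β : ℝ} (hα : 0 < α) (hβ : 0 < β)
    (hAα : μ A = ENNReal.ofReal (α ^ Module.finrank ℝ E))
    (hBβ : μ B = ENNReal.ofReal (β ^ Module.finrank ℝ E)) :
    ENNReal.ofReal ((a * α + b * β) ^ Module.finrank ℝ E) ≤ μ C := by
  set M := a * α + b * β
  have hM : 0 < M := by positivity
  have key := measure_rpow_mul_measure_rpow_le μ (hA.const_smul₀ α⁻¹) (hB.const_smul₀ β⁻¹)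
    (hC.const_smul₀ M⁻¹) (a := a * α / M) (b := b * β / M) (by positivity) (by positivity)
    (by rw [← add_div, div_self hM.ne']) (by
      rintro _ ⟨x, hx, rfl⟩ _ ⟨y, hy, rfl⟩
      refine ⟨_, h x hx y hy, ?_⟩
      simp only [smul_add, smul_smul]
      congr 2 <;> field_simp)
  have e : ∀ {r : ℝ}, 0 < r → ENNReal.ofReal |r⁻¹ ^ Module.finrank ℝ E| *
      ENNReal.ofReal (r ^ Module.finrank ℝ E) = 1 := fun {r} hr => by
    rw [abs_of_pos (by positivity), ← ENNReal.ofReal_mul (by positivity), ← mul_pow,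
      inv_mul_cancel₀ hr.ne']
    simp
  rw [Measure.addHaar_smul, Measure.addHaar_smul, Measure.addHaar_smul, hAα, hBβ, e hα, e hβ,
    ENNReal.one_rpow, ENNReal.one_rpow, one_mul] at key
  calc ENNReal.ofReal (M ^ Module.finrank ℝ E)
      = ENNReal.ofReal (M ^ Module.finrank ℝ E) * 1 := (mul_one _).symm
    _ ≤ ENNReal.ofReal (M ^ Module.finrank ℝ E) *
        (ENNReal.ofReal |M⁻¹ ^ Module.finrank ℝ E| * μ C) := by gcongr
    _ = μ C := by rw [← mul_assoc, mul_comm (ENNReal.ofReal _), e hM, one_mul]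

theorem ConcaveOn.exists_le_add_mul {S : Set ℝ} {G : ℝ → ℝ} (hG : ConcaveOn ℝ S G) {x : ℝ}
    (hx : x ∈ interior S) : ∃ g, ∀ y ∈ S, G y ≤ G x + g * (y - x) := by
  have hG' := hG.neg
  refine ⟨-derivWithin (-G) (Ioi x) x, fun y hy => ?_⟩
  rcases lt_trichotomy y x with h | rfl | h
  · have h1 := hG'.slope_le_leftDeriv_of_mem_interior hy hx h
    have h2 := hG'.leftDeriv_le_rightDeriv_of_mem_interior hx
    have h3 := h1.trans h2
    rw [slope_def_field, div_le_iff₀ (by linarith)] at h3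
    simp only [Pi.neg_apply] at h3
    linarith
  · simp
  · have h3 := hG'.rightDeriv_le_slope_of_mem_interior hx hy h
    rw [slope_def_field, le_div_iff₀ (by linarith)] at h3
    simp only [Pi.neg_apply] at h3
    linarith

theorem mul_div_le_of_integral_eq {V : ℝ → ℝ} {n : ℕ} (hn : n ≠ 0) {γ g c M : ℝ} (hγ : 0 < γ)
    (hg : 0 < g) (hM : γ ≤ c + g * M) (V0 : ∀ s, 0 ≤ V s) (hVγ : ∀ s, V s ≤ γ ^ n)
    (hV : ∀ s, V s ≤ (max 0 (c + g * s)) ^ n)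
    (hI : γ ^ n * M = ∫ t in Ioi 0, V (M - t)) : γ * (n / (n + 1)) ≤ c := by
  set T := M - (γ - c) / g with hT
  have hT0 : 0 ≤ T := by
    rw [hT, sub_nonneg, div_le_iff₀ hg]
    linarith
  have hline : ∀ t, c + g * (M - t) = γ - g * (t - T) := fun t => by
    rw [hT]; field_simp; ring
  set p : ℝ → ℝ := fun t => (γ - g * (t - T)) ^ n
  have hp : Continuous p := by fun_prop
  have hTT : T ≤ T + γ / g := by have := div_pos hγ hg; linarith
  have hp' : ∫ t in T..T + γ / g, p t = γ ^ n * (γ / (g * (n + 1))) := by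
    rw [intervalIntegral.integral_eq_sub_of_hasDerivAt
      (f := fun t => -(γ - g * (t - T)) ^ (n + 1) / (g * (n + 1))) (fun t _ => ?_)
      (hp.intervalIntegrable _ _)]
    · have : γ - g * (T + γ / g - T) = 0 := by field_simp; ring
      simp only [this, sub_self, mul_zero, sub_zero]
      rw [zero_pow (by omega)]
      field_simp
      ring
    · have h1 : HasDerivAt (fun t => γ - g * (t - T)) (-(g * 1)) t :=
        (((hasDerivAt_id t).sub_const T).const_mul g).const_sub γ
      refine ((h1.pow (n + 1)).neg.div_const (g * (n + 1))).congr_deriv ?_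
      simp only [p]
      push_cast
      field_simp
  have hi1 : Integrable ((Ioc 0 T).indicator fun _ => γ ^ n) :=
    (integrable_indicator_iff measurableSet_Ioc).2 (by simp)
  have hi2 : Integrable ((Ioc T (T + γ / g)).indicator p) :=
    (integrable_indicator_iff measurableSet_Ioc).2 (hp.integrableOn_Ioc)
  have hle : ∫ t in Ioi 0, V (M - t) ≤
      ∫ t, ((Ioc 0 T).indicator (fun _ => γ ^ n) t + (Ioc T (T + γ / g)).indicator p t) := by
    rw [← integral_indicator measurableSet_Ioi]
    refine integral_mono_of_nonneg
      (ae_of_all _ fun t => indicator_nonneg (fun t _ => V0 _) t) (hi1.add hi2)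
      (ae_of_all _ fun t => ?_)
    by_cases h0 : 0 < t
    · have h2 := hV (M - t)
      rw [hline] at h2
      rw [indicator_of_mem (show t ∈ Ioi 0 from h0)]
      rcases le_or_gt t T with h1 | h1
      · simpa [h0, h1, h1.not_gt] using hVγ (M - t)
      · rcases le_or_gt t (T + γ / g) with h3 | h3
        · have : 0 ≤ γ - g * (t - T) := by
            have : t - T ≤ γ / g := by linarith
            rw [le_div_iff₀ hg] at this
            linarith
          rw [max_eq_right this] at h2
          simpa [h0, h1, h3, h1.not_ge] using h2
        · have : γ - g * (t - T) ≤ 0 := by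
            have : γ / g ≤ t - T := by linarith
            rw [div_le_iff₀ hg] at this
            linarith
          rw [max_eq_left this, zero_pow hn] at h2
          simpa [h0, h1, h3.not_ge, h1.not_ge] using h2
    · have h1 : ¬ T < t := by linarith
      simp [h0, h1]
  rw [← hI, integral_add hi1 hi2, integral_indicator measurableSet_Ioc,
    integral_indicator measurableSet_Ioc, ← intervalIntegral.integral_of_le hTT, hp',
    setIntegral_const, Real.volume_real_Ioc_of_le hT0, smul_eq_mul, sub_zero, mul_comm T,
    ← mul_add] at hle
  have h1 := le_of_mul_le_mul_left hle (by positivity)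
  have h2 : (γ - c) / g ≤ γ / (n + 1) / g := by
    rw [div_div, mul_comm ((n : ℝ) + 1)]; linarith
  rw [div_le_div_iff_of_pos_right hg] at h2
  have : γ * (n / (n + 1)) = γ - γ / (n + 1) := by field_simp; ring
  linarith

/-- **Grünbaum's inequality**: a halfspace whose boundary passes through the centroid of an open
bounded convex set in dimension `n` contains at least a `(n / (n + 1)) ^ n` fraction of it. -/
theorem Convex.mul_measure_le_measure_inter_lt {E : Type*} [NormedAddCommGroup E]
    [NormedSpace ℝ E] [FiniteDimensional ℝ E] [MeasurableSpace E] [BorelSpace E] (μ : Measure E)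
    [μ.IsAddHaarMeasure] {K : Set E} (hK : Convex ℝ K) (hKo : IsOpen K)
    (hKb : Bornology.IsBounded K) (hKn : K.Nonempty) (f : E →L[ℝ] ℝ) (hf : f ≠ 0)
    (hfK : ∫ x in K, f x ∂μ = 0) :
    ENNReal.ofReal ((Module.finrank ℝ E / (Module.finrank ℝ E + 1 : ℝ)) ^ Module.finrank ℝ E) *
      μ K ≤ μ (K ∩ {x | f x < 0}) := by
  set n := Module.finrank ℝ E
  have hn : n ≠ 0 := by
    rintro h
    have : Subsingleton E := Module.finrank_zero_iff.1 h
    exact hf (ContinuousLinearMap.ext fun x => by simp [Subsingleton.elim x 0])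
  have hμK : μ K ≠ ∞ := hKb.measure_lt_top.ne
  have hopen : ∀ s, IsOpen (K ∩ {x | f x < s}) := fun s =>
    hKo.inter (isOpen_lt f.continuous continuous_const)
  have hfin : ∀ s, μ (K ∩ {x | f x < s}) ≠ ∞ := fun s =>
    measure_ne_top_of_subset inter_subset_left hμK
  set V : ℝ → ℝ := fun s => μ.real (K ∩ {x | f x < s})
  have hV0 : ∀ s, 0 ≤ V s := fun s => measureReal_nonneg
  have hVpos : ∀ s, 0 < V s ↔ (K ∩ {x | f x < s}).Nonempty := fun s => by
    rw [← (hopen s).measure_pos_iff μ]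
    exact ENNReal.toReal_pos_iff.trans (and_iff_left (hfin s).lt_top)
  set m := μ.real K
  have hm : 0 < m := ENNReal.toReal_pos (hKo.measure_pos μ hKn).ne' hμK
  have hVm : ∀ s, V s ≤ m := fun s => measureReal_mono inter_subset_left hμK
  set G : ℝ → ℝ := fun s => V s ^ (n : ℝ)⁻¹
  have hGV : ∀ s, G s ^ n = V s := fun s => Real.rpow_inv_natCast_pow (hV0 s) hn
  have hG0 : ∀ s, 0 ≤ G s := fun s => Real.rpow_nonneg (hV0 s) _
  set γ := m ^ (n : ℝ)⁻¹
  have hγm : γ ^ n = m := Real.rpow_inv_natCast_pow hm.le hn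
  have hγ : 0 < γ := Real.rpow_pos_of_pos hm _
  obtain ⟨M, hM0, hM⟩ : ∃ M, 0 < M ∧ ∀ x ∈ K, f x < M := by
    obtain ⟨R, hR0, hR⟩ := hKb.exists_pos_norm_le
    refine ⟨‖f‖ * R + 1, by positivity, fun x hx => ?_⟩
    have := (le_abs_self _).trans (f.le_of_opNorm_le_of_le le_rfl (hR x hx))
    linarith
  have hKM : K ∩ {x | f x < M} = K := inter_eq_left.2 hM
  have hint : IntegrableOn f K μ := by
    obtain ⟨R, hR0, hR⟩ := hKb.exists_pos_norm_le
    exact Measure.integrableOn_of_bounded hμK f.continuous.aestronglyMeasurable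
      (ae_restrict_of_forall_mem hKo.measurableSet
        fun x hx => f.le_of_opNorm_le_of_le le_rfl (hR x hx))
  set S : Set ℝ := {s | (K ∩ {x | f x < s}).Nonempty}
  have hconc : ConcaveOn ℝ S G := by
    refine concaveOn_iff_forall_pos.2 ⟨?_, fun s hs t ht a b ha hb hab => ?_⟩
    · refine (convex_iff_ordConnected (s := S)).2 ⟨fun s hs t _ u hu => ?_⟩
      obtain ⟨x, hx, hxs⟩ := hs
      exact ⟨x, hx, lt_of_lt_of_le hxs hu.1⟩
    · have key := ofReal_pow_le_measure μ (hopen s).measurableSet (hopen t).measurableSet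
        (hopen (a • s + b • t)).measurableSet ha hb (fun x hx y hy => ?_)
        (Real.rpow_pos_of_pos ((hVpos s).2 hs) _) (Real.rpow_pos_of_pos ((hVpos t).2 ht) _)
        ((ofReal_measureReal (hfin s)).symm.trans (congrArg ENNReal.ofReal (hGV s).symm))
        ((ofReal_measureReal (hfin t)).symm.trans (congrArg ENNReal.ofReal (hGV t).symm))
      · refine le_of_pow_le_pow_left₀ hn (hG0 _) ?_
        rw [hGV]
        exact (ENNReal.ofReal_le_iff_le_toReal (hfin _)).1 key
      · refine ⟨hK hx.1 hy.1 ha.le hb.le hab, ?_⟩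
        have hx2 : f x < s := hx.2
        have hy2 : f y < t := hy.2
        simp only [mem_ofPred, map_add, map_smul, smul_eq_mul]
        gcongr
  have hneg : (K ∩ {x | f x < 0}).Nonempty := by
    by_contra hemp
    have hpos : ∀ x ∈ K, 0 ≤ f x := fun x hx => by
      by_contra! h
      exact hemp ⟨x, hx, h⟩
    have h1 := (setIntegral_eq_zero_iff_of_nonneg_ae
      (ae_restrict_of_forall_mem hKo.measurableSet hpos) hint).1 hfK
    have h2 : EqOn f 0 K :=
      Measure.eqOn_open_of_ae_eq h1 hKo f.continuous.continuousOn continuousOn_const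
    have h3 : LinearMap.ker f.toLinearMap = ⊤ :=
      Submodule.eq_top_of_nonempty_interior' _ (hKn.mono (interior_maximal h2 hKo))
    exact hf (ContinuousLinearMap.coe_injective (LinearMap.ker_eq_top.1 h3))
  have hint0 : (0 : ℝ) ∈ interior S := by
    obtain ⟨x, hx, hx0⟩ := hneg
    exact mem_interior.2 ⟨Ioi (f x), fun s hs => ⟨x, hx, hs⟩, isOpen_Ioi, hx0⟩
  obtain ⟨g, hg⟩ := hconc.exists_le_add_mul hint0
  simp only [sub_zero] at hg
  have hGM : G M = γ := by simp only [G, V, γ, m, hKM]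
  have hMg : γ ≤ G 0 + g * M := by
    rw [← hGM]
    exact hg M (by simpa only [S, mem_ofPred, hKM] using hKn)
  have main : γ * (n / (n + 1)) ≤ G 0 := by
    rcases le_or_gt γ (G 0) with h | h
    · refine le_trans ?_ h
      refine mul_le_of_le_one_right hγ.le (div_le_one_of_le₀ (by linarith) (by positivity))
    refine mul_div_le_of_integral_eq hn hγ (pos_of_mul_pos_left (by linarith) hM0.le) hMg hV0
      (fun s => (hVm s).trans_eq hγm.symm) (fun s => ?_) ?_
    · rcases (hV0 s).eq_or_lt with h0 | h0
      · rw [← h0]; positivity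
      · rw [← hGV]
        exact pow_le_pow_left₀ (hG0 s) ((hg s ((hVpos s).1 h0)).trans (le_max_right _ _)) n
    · have hnn : 0 ≤ᵐ[μ.restrict K] fun x => M - f x :=
        ae_restrict_of_forall_mem hKo.measurableSet fun x hx => by simpa using (hM x hx).le
      have hKt : IsFiniteMeasure (μ.restrict K) := ⟨by simpa using hμK.lt_top⟩
      have := Integrable.integral_eq_integral_meas_lt
        (f := fun x => M - f x) ((integrable_const M).sub hint) hnn
      rw [integral_sub (integrable_const M) hint, hfK, integral_const] at this
      simp only [sub_zero, measureReal_restrict_apply_univ, smul_eq_mul] at this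
      rw [hγm, this]
      refine setIntegral_congr_fun measurableSet_Ioi fun t _ => ?_
      rw [measureReal_restrict_apply' hKo.measurableSet, inter_comm]
      simp only [V, lt_sub_comm]
  have hfinal : (n / (n + 1 : ℝ)) ^ n * m ≤ V 0 := by
    rw [← hGV, ← hγm, ← mul_pow, mul_comm]
    exact pow_le_pow_left₀ (by positivity) main n
  rw [← ENNReal.ofReal_toReal hμK, ← ENNReal.ofReal_mul (by positivity)]
  exact ENNReal.ofReal_le_of_le_toReal hfinal

theorem inv_exp_one_lt_one_sub_pow {d : ℕ} (hd : 2 ≤ d) :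
    (Real.exp 1)⁻¹ < (1 - 1 / (d : ℝ)) ^ (d - 1) := by
  obtain ⟨n, rfl⟩ : ∃ n, d = n + 1 := ⟨d - 1, by omega⟩
  have hn : (0 : ℝ) < n := by exact_mod_cast (show 0 < n by omega)
  have h1 : 1 - 1 / ((n + 1 : ℕ) : ℝ) = (1 / n + 1 : ℝ)⁻¹ := by
    push_cast
    field_simp
    ring
  rw [h1, inv_pow, Nat.add_sub_cancel]
  refine inv_strictAnti₀ (by positivity) ?_
  calc (1 / n + 1 : ℝ) ^ n < Real.exp (1 / n) ^ n :=
        pow_lt_pow_left₀ (Real.add_one_lt_exp (by positivity)) (by positivity) (by omega)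
    _ = Real.exp 1 := by
        rw [← Real.exp_nat_mul]
        congr 1
        field_simp

/-- The open standard simplex in Euclidean space. -/
def openSimplex (d : ℕ) : Set (EuclideanSpace ℝ (Fin d)) := {x | (∑ i, x i = 1) ∧ ∀ i, 0 < x i}

/-- The linear functional sending a vector to the sum of its coordinates. -/
def sumCoord (d : ℕ) : EuclideanSpace ℝ (Fin d) →ₗ[ℝ] ℝ where
  toFun x := ∑ i, x i
  map_add' x y := by simp [Finset.sum_add_distrib]
  map_smul' c x := by simp [Finset.mul_sum]

@[simp]
theorem sumCoord_apply {d : ℕ} (x : EuclideanSpace ℝ (Fin d)) : sumCoord d x = ∑ i, x i := rfl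

/-- The parametrization of the hyperplane of vectors with coordinate sum one by the vectors with
coordinate sum zero, sending zero to the barycenter. -/
noncomputable def barycenterAdd (d : ℕ) (w : LinearMap.ker (sumCoord d)) :
    EuclideanSpace ℝ (Fin d) :=
  WithLp.toLp 2 (fun _ => 1 / (d : ℝ)) + (w : EuclideanSpace ℝ (Fin d))

theorem barycenterAdd_apply {d : ℕ} (w : LinearMap.ker (sumCoord d)) (i : Fin d) :
    barycenterAdd d w i = 1 / d + (w : EuclideanSpace ℝ (Fin d)) i := rfl

theorem isometry_barycenterAdd (d : ℕ) : Isometry (barycenterAdd d) :=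
  (IsometryEquiv.addLeft _).isometry.comp isometry_subtype_coe

theorem range_barycenterAdd {d : ℕ} (hd : d ≠ 0) :
    range (barycenterAdd d) = {x | ∑ i, x i = 1} := by
  ext x
  constructor
  · rintro ⟨w, rfl⟩
    have := w.2
    simp only [LinearMap.mem_ker, sumCoord_apply] at this
    simp [barycenterAdd_apply, Finset.sum_add_distrib, this, hd]
  · intro hx
    refine ⟨⟨x - WithLp.toLp 2 (fun _ => 1 / (d : ℝ)), ?_⟩, ?_⟩
    · have hx : ∑ i, x i = 1 := hx
      simp [hx, hd]
    · simp [barycenterAdd]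

theorem finrank_ker_sumCoord {d : ℕ} (hd : d ≠ 0) :
    Module.finrank ℝ (LinearMap.ker (sumCoord d)) + 1 = d := by
  have h : sumCoord d ≠ 0 := fun h => by
    have := LinearMap.congr_fun h (WithLp.toLp 2 (fun _ => 1))
    simp [hd] at this
  simpa using Module.Dual.finrank_ker_add_one_of_ne_zero h

theorem isBounded_openSimplex (d : ℕ) : Bornology.IsBounded (openSimplex d) := by
  refine isBounded_iff_forall_norm_le.2 ⟨1, fun x hx => ?_⟩
  refine le_of_sq_le_sq ?_ zero_le_one
  rw [EuclideanSpace.norm_sq_eq, one_pow, ← hx.1]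
  refine Finset.sum_le_sum fun i _ => ?_
  have h0 := hx.2 i
  have h1 : x i ≤ 1 := hx.1 ▸ Finset.single_le_sum (fun j _ => (hx.2 j).le) (Finset.mem_univ i)
  rw [Real.norm_of_nonneg h0.le]
  nlinarith

theorem measurableSet_openSimplex (d : ℕ) : MeasurableSet (openSimplex d) := by
  have h : openSimplex d = {x | ∑ i, x i = 1} ∩ ⋂ i, {x | 0 < x i} := by
    ext x; simp [openSimplex]
  rw [h]
  refine (measurableSet_eq_fun (by fun_prop) (by fun_prop)).inter
    (MeasurableSet.iInter fun i => measurableSet_lt (by fun_prop) (by fun_prop))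

theorem openSimplex_inter_measure {d : ℕ} (hd : d ≠ 0) (T : Set (EuclideanSpace ℝ (Fin d))) :
    μH[(d : ℝ) - 1] (openSimplex d ∩ T) =
      μH[Module.finrank ℝ (LinearMap.ker (sumCoord d))]
        (barycenterAdd d ⁻¹' openSimplex d ∩ barycenterAdd d ⁻¹' T) := by
  have h : (d : ℝ) - 1 = Module.finrank ℝ (LinearMap.ker (sumCoord d)) := by
    rw [sub_eq_iff_eq_add]
    exact_mod_cast (finrank_ker_sumCoord hd).symm
  have hsub : openSimplex d ∩ T ⊆ {x | ∑ i, x i = 1} := fun x hx => hx.1.1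
  rw [h, ← preimage_inter, (isometry_barycenterAdd d).hausdorffMeasure_preimage
    (Or.inl (by positivity)), range_barycenterAdd hd, inter_eq_left.2 hsub]

theorem setIntegral_openSimplex_apply (d : ℕ) (s : ℝ) (i j : Fin d) :
    ∫ x in openSimplex d, x i ∂μH[s] = ∫ x in openSimplex d, x j ∂μH[s] := by
  let e := (LinearIsometryEquiv.piLpCongrLeft 2 ℝ ℝ (Equiv.swap i j)).toIsometryEquiv
  have he : ∀ (x : EuclideanSpace ℝ (Fin d)) k, e x k = x (Equiv.swap i j k) := fun x k => by
    simp [e]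
  have hpre : e ⁻¹' openSimplex d = openSimplex d := by
    ext x
    simp only [openSimplex, mem_preimage, mem_ofPred, he]
    rw [Equiv.sum_comp (Equiv.swap i j) (fun k => x k),
      (Equiv.swap i j).forall_congr_left (p := fun k => 0 < x (Equiv.swap i j k))]
    simp
  have := (e.measurePreserving_hausdorffMeasure s).setIntegral_preimage_emb
    e.toHomeomorph.measurableEmbedding (fun x => x i) (openSimplex d)
  rw [hpre] at this
  simpa [he] using this.symm

theorem ofReal_mul_measure_openSimplex_le {d : ℕ} (u : EuclideanSpace ℝ (Fin d)) (t : ℝ)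
    (hu : ¬ ∃ s : ℝ, ∀ i, u i = s) (hc : ∑ i, u i * ((1 : ℝ) / d) = t) :
    0 < μH[(d : ℝ) - 1] (openSimplex d) ∧ μH[(d : ℝ) - 1] (openSimplex d) < ∞ ∧
      ENNReal.ofReal ((1 - 1 / (d : ℝ)) ^ (d - 1)) * μH[(d : ℝ) - 1] (openSimplex d) ≤
        μH[(d : ℝ) - 1] (openSimplex d ∩ {x | ∑ i, u i * x i < t}) := by
  have hd : d ≠ 0 := by
    rintro rfl
    exact hu ⟨0, fun i => i.elim0⟩
  have hd0 : (0 : ℝ) < d := by positivity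
  set W := LinearMap.ker (sumCoord d)
  set φ := barycenterAdd d
  have hφ : Isometry φ := isometry_barycenterAdd d
  set K := φ ⁻¹' openSimplex d
  have hrank : Module.finrank ℝ W + 1 = d := finrank_ker_sumCoord hd
  have hd1 : (d : ℝ) - 1 = Module.finrank ℝ W := by
    rw [sub_eq_iff_eq_add]
    exact_mod_cast hrank.symm
  set ν : Measure W := μH[Module.finrank ℝ W]
  have hνK : μH[(d : ℝ) - 1] (openSimplex d) = ν K := by
    simpa using openSimplex_inter_measure hd univ
  have hK : K = {w : W | ∀ i, 0 < 1 / (d : ℝ) + (w : EuclideanSpace ℝ (Fin d)) i} := by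
    ext w
    have : ∑ i, φ w i = 1 := (range_barycenterAdd hd).subset ⟨w, rfl⟩
    simp only [K, openSimplex, mem_preimage, mem_ofPred, this, true_and]
    rfl
  have hKo : IsOpen K := by
    rw [hK]
    simp only [ofPred_forall]
    exact isOpen_iInter_of_finite fun i => isOpen_lt (by fun_prop) (by fun_prop)
  have hKc : Convex ℝ K := by
    rw [hK]
    intro x hx y hy a b ha hb hab i
    have e : 1 / (d : ℝ) + ((a • x + b • y : W) : EuclideanSpace ℝ (Fin d)) i =
        a * (1 / d + (x : EuclideanSpace ℝ (Fin d)) i) +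
          b * (1 / d + (y : EuclideanSpace ℝ (Fin d)) i) := by
      simp only [Submodule.coe_add, Submodule.coe_smul, PiLp.add_apply, PiLp.smul_apply,
        smul_eq_mul]
      linear_combination (-1 / (d : ℝ)) * hab
    rw [e]
    rcases ha.eq_or_lt with rfl | ha
    · have : b = 1 := by linarith
      simpa [this] using hy i
    · exact add_pos_of_pos_of_nonneg (mul_pos ha (hx i)) (mul_nonneg hb (hy i).le)
  have hKn : K.Nonempty := ⟨0, by rw [hK]; intro i; simp [Nat.pos_of_ne_zero hd]⟩
  have hKb : Bornology.IsBounded K := hφ.antilipschitz.isBounded_preimage (isBounded_openSimplex d)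
  have hfin : μH[(d : ℝ) - 1] (openSimplex d) < ∞ := hνK ▸ hKb.measure_lt_top
  refine ⟨hνK ▸ hKo.measure_pos ν hKn, hfin, ?_⟩
  let ℓ : EuclideanSpace ℝ (Fin d) →L[ℝ] ℝ := ∑ i, u i • EuclideanSpace.proj i
  have hℓ : ∀ x, ℓ x = ∑ i, u i * x i := fun x => by simp [ℓ]
  let f : W →L[ℝ] ℝ := ℓ.comp W.subtypeL
  have hf : ∀ w, f w = ℓ (φ w) - t := fun w => by
    have : φ w = WithLp.toLp 2 (fun _ => 1 / (d : ℝ)) + (w : EuclideanSpace ℝ (Fin d)) := rfl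
    rw [this, map_add, hℓ, hc]
    simp [f]
  have hf0 : f ≠ 0 := by
    intro h0
    refine hu ⟨u ⟨0, Nat.pos_of_ne_zero hd⟩, fun i => ?_⟩
    set o : Fin d := ⟨0, Nat.pos_of_ne_zero hd⟩
    have hw : EuclideanSpace.single i (1 : ℝ) - EuclideanSpace.single o 1 ∈ W := by
      simp [W]
    have := DFunLike.congr_fun h0 ⟨_, hw⟩
    simpa [f, hℓ, mul_sub, sub_eq_zero] using this
  have hΔ := measurableSet_openSimplex d
  set μ : Measure (EuclideanSpace ℝ (Fin d)) := μH[(d : ℝ) - 1]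
  have : IsFiniteMeasure (μ.restrict (openSimplex d)) := ⟨by simpa using hfin⟩
  have hint : ∀ i, IntegrableOn (fun x => x i) (openSimplex d) μ := fun i => by
    refine Measure.integrableOn_of_bounded (M := 1) hfin.ne
      (by fun_prop) (ae_restrict_of_forall_mem hΔ fun x hx => ?_)
    rw [Real.norm_of_nonneg (hx.2 i).le, ← hx.1]
    exact Finset.single_le_sum (fun j _ => (hx.2 j).le) (Finset.mem_univ i)
  have hmean : ∀ i, ∫ x in openSimplex d, x i ∂μ = μ.real (openSimplex d) / d := fun i => by
    have h1 : ∑ j, ∫ x in openSimplex d, x j ∂μ = μ.real (openSimplex d) := by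
      rw [← integral_finsetSum _ fun j _ => hint j,
        setIntegral_congr_fun hΔ (g := fun _ => (1 : ℝ)) fun x hx => hx.1]
      simp
    rw [Finset.sum_congr rfl fun j _ => setIntegral_openSimplex_apply d _ j i] at h1
    rw [eq_div_iff hd0.ne', ← h1]
    simp [mul_comm, μ]
  have hfK : ∫ w in K, f w ∂ν = 0 := by
    have hm : MeasurableEmbedding φ := hφ.isClosedEmbedding.measurableEmbedding
    have h1 := hm.setIntegral_map (μ := ν) (fun x => ℓ x - t) (openSimplex d)
    rw [hφ.map_hausdorffMeasure (Or.inl (by positivity)), ← hd1,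
      Measure.restrict_restrict_of_subset (by
        rw [range_barycenterAdd hd]
        exact fun x hx => hx.1)] at h1
    simp only [hf]
    rw [← h1]
    change ∫ x in openSimplex d, (ℓ x - t) ∂μ = 0
    simp only [hℓ]
    rw [integral_sub (integrable_finsetSum _ fun i _ => (hint i).const_mul (u i))
      (integrable_const t), integral_finsetSum _ fun i _ => (hint i).const_mul (u i)]
    simp only [integral_const_mul, hmean]
    simp only [integral_const, measureReal_restrict_apply_univ, smul_eq_mul, ← hc, Finset.mul_sum]
    rw [← Finset.sum_sub_distrib]
    exact Finset.sum_eq_zero fun i _ => by ring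
  have key := hKc.mul_measure_le_measure_inter_lt ν hKo hKb hKn f hf0 hfK
  have hratio : (Module.finrank ℝ W / (Module.finrank ℝ W + 1) : ℝ) = 1 - 1 / d := by
    rw [← hd1, sub_add_cancel, sub_div, div_self hd0.ne']
  rw [hratio] at key
  rw [openSimplex_inter_measure hd, hνK, show d - 1 = Module.finrank ℝ W by omega]
  refine key.trans_eq ?_
  congr 2
  ext w
  simp only [mem_ofPred, mem_preimage, hf, hℓ, sub_neg, φ]

/-- Lemma 4.1, part 1; Grünbaum. If an affine hyperplane `H` of
`A = {x : Σ x_i = 1}` passes through the center `c = (1/d, …, 1/d)` of the standard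
simplex `Δ`, then each of the two open halfspaces of `A` bounded by `H` contains at
least a `(1 − 1/d)^{d−1} > 1/e` fraction of the volume of `Δ`. -/
theorem simplex_central_halfspace_volume
    (d : ℕ)
    (A : Set (EuclideanSpace ℝ (Fin d))) (hA : A = {x | ∑ i, x i = 1})
    (Δ : Set (EuclideanSpace ℝ (Fin d)))
    (hΔ : Δ = {x | (∑ i, x i = 1) ∧ ∀ i, 0 < x i})
    (u : EuclideanSpace ℝ (Fin d)) (t : ℝ)
    (hu : ¬ ∃ s : ℝ, ∀ i, u i = s)
    (hc : ∑ i, u i * ((1 : ℝ) / d) = t) :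
    (μH[(d : ℝ) - 1] (Δ ∩ {x ∈ A | ∑ i, u i * x i < t}) / μH[(d : ℝ) - 1] Δ ≥
        ENNReal.ofReal ((1 - 1 / (d : ℝ)) ^ (d - 1)) ∧
      μH[(d : ℝ) - 1] (Δ ∩ {x ∈ A | t < ∑ i, u i * x i}) / μH[(d : ℝ) - 1] Δ ≥
        ENNReal.ofReal ((1 - 1 / (d : ℝ)) ^ (d - 1))) ∧
    (1 - 1 / (d : ℝ)) ^ (d - 1) > (Real.exp 1)⁻¹ := by
  have hd : 2 ≤ d := by
    by_contra! h
    have : Subsingleton (Fin d) := Fin.subsingleton_iff_le_one.2 (by omega)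
    rcases isEmpty_or_nonempty (Fin d) with h0 | ⟨⟨i⟩⟩
    · exact hu ⟨0, fun i => h0.elim i⟩
    · exact hu ⟨u i, fun j => by rw [Subsingleton.elim j i]⟩
  change Δ = openSimplex d at hΔ
  subst hA hΔ
  have hinter : ∀ p : EuclideanSpace ℝ (Fin d) → Prop,
      openSimplex d ∩ {x ∈ {x | ∑ i, x i = 1} | p x} = openSimplex d ∩ {x | p x} := fun p => by
    ext x
    exact ⟨fun h => ⟨h.1, h.2.2⟩, fun h => ⟨h.1, h.1.1, h.2⟩⟩
  obtain ⟨h0, htop, h1⟩ := ofReal_mul_measure_openSimplex_le u t hu hc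
  obtain ⟨-, -, h2⟩ := ofReal_mul_measure_openSimplex_le (-u) (-t)
    (fun ⟨s, hs⟩ => hu ⟨-s, fun i => by rw [← hs i]; simp⟩) (by rw [← hc]; simp)
  refine ⟨⟨?_, ?_⟩, inv_exp_one_lt_one_sub_pow hd⟩
  · rw [ge_iff_le, hinter, ENNReal.le_div_iff_mul_le (Or.inl h0.ne') (Or.inl htop.ne)]
    exact h1
  · rw [ge_iff_le, hinter, ENNReal.le_div_iff_mul_le (Or.inl h0.ne') (Or.inl htop.ne)]
    simpa using h2
end
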